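/- Let X be a germ at 0 ∈ ℂ² of a holomorphic vector field with X(0) = 0 whose linear part DX(0) has eigenvalues λ₁ and λ₂ with λ₁ ≠ 0 and λ₂ = −μ·λ₁ for some real number μ > 0 (a saddle with eigenratio −μ < 0). Then X is analytically equivalent as a singular foliation to a vector field of the form X_f = −x∂x + μ·(f(y) + x)·y∂y, where f is a function of one variable holomorphic near 0 ∈ ℂ with f(0) = 1. -/

import Mathlib

open Filter

/-- Two germs at `0` of holomorphic vector fields on `ℂ × ℂ` (a vector field
`a ∂x + b ∂y` being identified with the map `p ↦ (a p, b p)`) are *analytically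
equivalent as singular foliations* if a germ of biholomorphism `Φ` fixing `0`
carries the first to a nonvanishing holomorphic multiple of the second. -/
def FoliationEquiv (X X' : ℂ × ℂ → ℂ × ℂ) : Prop :=
  ∃ (Φ : ℂ × ℂ → ℂ × ℂ) (u : ℂ × ℂ → ℂ),
    AnalyticAt ℂ Φ 0 ∧ Φ 0 = 0 ∧
    LinearMap.det ((fderiv ℂ Φ 0).toLinearMap) ≠ 0 ∧
    AnalyticAt ℂ u 0 ∧ u 0 ≠ 0 ∧
    ∀ᶠ p in nhds (0 : ℂ × ℂ), fderiv ℂ Φ p (X p) = u p • X' (Φ p)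

section

open MeasureTheory Set Metric Topology

theorem analyticOnNhd_of_separately_differentiable {U : Set (ℂ × ℂ)} (hU : IsOpen U)
    {f : ℂ × ℂ → ℂ} (hc : ContinuousOn f U)
    (h1 : ∀ p ∈ U, DifferentiableAt ℂ (fun x => f (x, p.2)) p.1)
    (h2 : ∀ p ∈ U, DifferentiableAt ℂ (fun y => f (p.1, y)) p.2) :
    AnalyticOnNhd ℂ f U := by
  classical
  rintro ⟨a, b⟩ hp
  obtain ⟨R, hR, hball⟩ := Metric.nhds_basis_closedBall.mem_iff.1 (hU.mem_nhds hp)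
  have hsub : ∀ x ∈ closedBall a R, ∀ y ∈ closedBall b R, (x, y) ∈ U := fun x hx y hy =>
    hball (by rw [← closedBall_prod_same]; exact ⟨hx, hy⟩)
  let K := sphere b R
  have : CompactSpace K := isCompact_iff_compactSpace.1 (isCompact_sphere b R)
  have hKb : ∀ k : K, (k : ℂ) ∈ closedBall b R := fun k => sphere_subset_closedBall k.2
  -- restriction of `f` to vertical circles, as a continuous family
  let F₀ : closedBall a R → C(K, ℂ) := fun x =>
    ⟨fun k => f (x, k), by
      refine hc.comp_continuous (by fun_prop) fun k => hsub _ x.2 _ (hKb k)⟩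
  have hF₀ : Continuous F₀ := by
    refine ContinuousMap.continuous_of_continuous_uncurry _ ?_
    refine hc.comp_continuous (f := fun q : closedBall a R × K => ((q.1 : ℂ), (q.2 : ℂ)))
      (by fun_prop) fun q => hsub _ q.1.2 _ (hKb q.2)
  let F : ℂ → C(K, ℂ) := fun x => if h : x ∈ closedBall a R then F₀ ⟨x, h⟩ else 0
  have hFc : ContinuousOn F (closedBall a R) := by
    rw [continuousOn_iff_continuous_domRestrict]
    convert hF₀ using 1
    ext1 x
    exact dif_pos x.2
  have hFint : CircleIntegrable F a R :=
    (hFc.mono sphere_subset_closedBall).circleIntegrable hR.le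
  let G : ℂ → C(K, ℂ) := fun x => (2 * Real.pi * Complex.I : ℂ)⁻¹ • ∮ z in C(a, R), (z - x)⁻¹ • F z
  have hG : AnalyticAt ℂ G a := by
    have := hasFPowerSeriesOn_cauchy_integral (R := ⟨R, hR.le⟩) hFint (by exact_mod_cast hR)
    exact this.analyticAt
  have hGev : ∀ x ∈ ball a R, ∀ k : K, G x k = f (x, k) := by
    intro x hx k
    let ev : C(K, ℂ) →L[ℂ] ℂ := ContinuousMap.evalCLM ℂ k
    have hci : CircleIntegrable (fun z => (z - x)⁻¹ • F z) a R := by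
      refine ContinuousOn.circleIntegrable hR.le ?_
      refine ContinuousOn.fun_smul ?_ (hFc.mono sphere_subset_closedBall)
      refine ContinuousOn.inv₀ (by fun_prop) fun z hz h => ?_
      rw [sub_eq_zero] at h
      subst h
      simp only [mem_sphere, mem_ball] at hz hx
      linarith
    have e1 : ev (∮ z in C(a, R), (z - x)⁻¹ • F z) = ∮ z in C(a, R), (z - x)⁻¹ • f (z, k) := by
      unfold circleIntegral
      rw [← ContinuousLinearMap.intervalIntegral_comp_comm _ hci.out]
      refine intervalIntegral.integral_congr fun θ _ => ?_
      have hm : circleMap a R θ ∈ closedBall a R := circleMap_mem_closedBall a hR.le θ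
      have : ev (F (circleMap a R θ)) = f (circleMap a R θ, k) := by
        change (F (circleMap a R θ)) k = _
        rw [show F (circleMap a R θ) = F₀ ⟨_, hm⟩ from dif_pos hm]
        rfl
      simp only [map_smul, this]
    have hd : DiffContOnCl ℂ (fun z => f (z, (k : ℂ))) (ball a R) := by
      refine DifferentiableOn.diffContOnCl fun z hz => ?_
      rw [closure_ball a hR.ne'] at hz
      exact (h1 (z, k) (hsub _ hz _ (hKb k))).differentiableWithinAt
    have e2 := hd.two_pi_i_inv_smul_circleIntegral_sub_inv_smul hx
    calc G x k = ev (G x) := rfl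
      _ = _ := by simp only [G, map_smul, e1, e2]
  -- the Cauchy kernel in the second variable
  let κ : ℂ → C(K, ℂ) := fun y => ⟨fun k => (k : ℂ), by fun_prop⟩ - algebraMap ℂ _ y
  have hκev : ∀ y ∈ ball b R, ∀ k : K, Ring.inverse (κ y) k = ((k : ℂ) - y)⁻¹ := by
    intro y hy k
    have hne : ∀ k : K, (k : ℂ) - y ≠ 0 := by
      intro k h
      rw [sub_eq_zero] at h
      have := k.2
      rw [h] at this
      simp only [K, mem_sphere, mem_ball] at this hy
      linarith
    have hk : ∀ k, κ y k = k - y := fun k => rfl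
    have hu : IsUnit (κ y) := by
      rw [ContinuousMap.isUnit_iff_forall_ne_zero]
      exact fun k => hne k
    have := congrArg (fun g : C(K, ℂ) => g k) (Ring.inverse_mul_cancel _ hu)
    simp only [ContinuousMap.mul_apply, hk, ContinuousMap.one_apply] at this
    exact eq_inv_of_mul_eq_one_left this
  have hκ : AnalyticAt ℂ (fun y => Ring.inverse (κ y)) b := by
    have hu : IsUnit (κ b) := by
      rw [ContinuousMap.isUnit_iff_forall_ne_zero]
      intro k h
      have h' : (k : ℂ) - b = 0 := h
      have := k.2
      rw [sub_eq_zero.1 h'] at this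
      simp only [K, mem_sphere, dist_self] at this
      exact hR.ne this
    obtain ⟨u, hu⟩ := hu
    have hκa : AnalyticAt ℂ κ b := by
      refine analyticAt_const.sub ?_
      exact (Algebra.linearMap ℂ C(K, ℂ)).toContinuousLinearMap.analyticAt b
    have := analyticAt_inverse (𝕜 := ℂ) u
    rw [hu] at this
    exact this.comp hκa
  -- integration over the circle as a linear functional
  have hcont : ∀ φ : C(K, ℂ), Continuous fun θ : ℝ =>
      φ ⟨circleMap b R θ, circleMap_mem_sphere b hR.le θ⟩ := fun φ => by fun_prop
  have hcont' : ∀ φ : C(K, ℂ), Continuous fun θ : ℝ =>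
      deriv (circleMap b R) θ * φ ⟨circleMap b R θ, circleMap_mem_sphere b hR.le θ⟩ := fun φ => by
    have := hcont φ
    simp only [deriv_circleMap]
    fun_prop
  let Λ₀ : C(K, ℂ) →ₗ[ℂ] ℂ :=
    { toFun := fun φ => ∫ θ in (0:ℝ)..2 * Real.pi,
        deriv (circleMap b R) θ * φ ⟨circleMap b R θ, circleMap_mem_sphere b hR.le θ⟩
      map_add' := fun φ ψ => by
        rw [← intervalIntegral.integral_add ((hcont' φ).intervalIntegrable _ _)
          ((hcont' ψ).intervalIntegrable _ _)]
        simp only [ContinuousMap.add_apply, mul_add]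
      map_smul' := fun c φ => by
        simp only [RingHom.id_apply, smul_eq_mul]
        rw [← intervalIntegral.integral_const_mul]
        refine intervalIntegral.integral_congr fun θ _ => ?_
        simp only [ContinuousMap.smul_apply, smul_eq_mul]
        ring }
  let Λ : C(K, ℂ) →L[ℂ] ℂ := Λ₀.mkContinuous (R * (2 * Real.pi)) fun φ => by
    have := intervalIntegral.norm_integral_le_of_norm_le_const (a := 0) (b := 2 * Real.pi)
      (C := R * ‖φ‖) (f := fun θ : ℝ =>
      deriv (circleMap b R) θ * φ ⟨circleMap b R θ, circleMap_mem_sphere b hR.le θ⟩) ?_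
    · rw [sub_zero, abs_of_pos Real.two_pi_pos] at this
      calc _ ≤ _ := this
        _ = _ := by ring
    · intro θ _
      rw [norm_mul]
      have : ‖deriv (circleMap b R) θ‖ = R := by
        simp [deriv_circleMap, abs_of_pos hR]
      rw [this]
      exact mul_le_mul_of_nonneg_left (φ.norm_coe_le_norm _) hR.le
  have hfin : AnalyticAt ℂ (fun p : ℂ × ℂ =>
      (2 * Real.pi * Complex.I : ℂ)⁻¹ * Λ (Ring.inverse (κ p.2) * G p.1)) (a, b) := by
    refine analyticAt_const.mul ?_
    refine (Λ.analyticAt _).comp (AnalyticAt.mul ?_ ?_)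
    · exact AnalyticAt.comp (f := fun p : ℂ × ℂ => p.2) (g := fun y => Ring.inverse (κ y)) hκ
        analyticAt_snd
    · exact AnalyticAt.comp (f := fun p : ℂ × ℂ => p.1) (g := G) hG analyticAt_fst
  refine hfin.congr ?_
  have hnhds : ball a R ×ˢ ball b R ∈ 𝓝 (a, b) :=
    prod_mem_nhds (ball_mem_nhds a hR) (ball_mem_nhds b hR)
  filter_upwards [hnhds]
  rintro ⟨x, y⟩ ⟨hx, hy⟩
  have hd : DiffContOnCl ℂ (fun z => f (x, z)) (ball b R) := by
    refine DifferentiableOn.diffContOnCl fun z hz => ?_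
    rw [closure_ball b hR.ne'] at hz
    exact (h2 (x, z) (hsub _ (ball_subset_closedBall hx) _ hz)).differentiableWithinAt
  have e2 := hd.two_pi_i_inv_smul_circleIntegral_sub_inv_smul hy
  rw [← e2, smul_eq_mul]
  congr 1
  change ∫ θ in (0:ℝ)..2 * Real.pi, _ = ∫ θ in (0:ℝ)..2 * Real.pi, _
  refine intervalIntegral.integral_congr fun θ _ => ?_
  simp only [ContinuousMap.mul_apply, hκev y hy, hGev x hx, smul_eq_mul]

theorem DifferentiableOn.analyticOnNhd_prod {U : Set (ℂ × ℂ)} (hU : IsOpen U) {f : ℂ × ℂ → ℂ}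
    (hf : DifferentiableOn ℂ f U) : AnalyticOnNhd ℂ f U := by
  refine analyticOnNhd_of_separately_differentiable hU hf.continuousOn (fun p hp => ?_)
    fun p hp => ?_
  · have := hf.differentiableAt (hU.mem_nhds hp)
    exact DifferentiableAt.comp (f := fun x : ℂ => (x, p.2)) p.1 this (by fun_prop)
  · have := hf.differentiableAt (hU.mem_nhds hp)
    exact DifferentiableAt.comp (f := fun x : ℂ => (p.1, x)) p.2 this (by fun_prop)

theorem differentiableOn_of_separately_differentiable {U : Set (ℂ × ℂ)} (hU : IsOpen U)
    {f : ℂ × ℂ → ℂ} (hc : ContinuousOn f U)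
    (h1 : ∀ p ∈ U, DifferentiableAt ℂ (fun x => f (x, p.2)) p.1)
    (h2 : ∀ p ∈ U, DifferentiableAt ℂ (fun y => f (p.1, y)) p.2) :
    DifferentiableOn ℂ f U :=
  (analyticOnNhd_of_separately_differentiable hU hc h1 h2).differentiableOn

theorem IsOpen.slice_fst {U : Set (ℂ × ℂ)} (hU : IsOpen U) (y : ℂ) : IsOpen {x | (x, y) ∈ U} :=
  hU.preimage (by fun_prop)

theorem IsOpen.slice_snd {U : Set (ℂ × ℂ)} (hU : IsOpen U) (x : ℂ) : IsOpen {y | (x, y) ∈ U} :=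
  hU.preimage (by fun_prop)

theorem DifferentiableOn.slice_fst {U : Set (ℂ × ℂ)} {f : ℂ × ℂ → ℂ}
    (hf : DifferentiableOn ℂ f U) (y : ℂ) :
    DifferentiableOn ℂ (fun x => f (x, y)) {x | (x, y) ∈ U} :=
  DifferentiableOn.comp (f := fun x : ℂ => (x, y)) hf (by fun_prop) fun _ h => h

theorem DifferentiableOn.slice_snd {U : Set (ℂ × ℂ)} {f : ℂ × ℂ → ℂ}
    (hf : DifferentiableOn ℂ f U) (x : ℂ) :
    DifferentiableOn ℂ (fun y => f (x, y)) {y | (x, y) ∈ U} :=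
  DifferentiableOn.comp (f := fun y : ℂ => (x, y)) hf (by fun_prop) fun _ h => h

/-- Uniform limits of holomorphic functions of two variables are holomorphic. -/
theorem TendstoUniformlyOn.differentiableOn_prod {U : Set (ℂ × ℂ)} (hU : IsOpen U)
    {F : ℕ → ℂ × ℂ → ℂ} {f : ℂ × ℂ → ℂ} (h : TendstoUniformlyOn F f atTop U)
    (hF : ∀ n, DifferentiableOn ℂ (F n) U) : DifferentiableOn ℂ f U := by
  refine differentiableOn_of_separately_differentiable hU
    (h.continuousOn (Frequently.of_forall fun n => (hF n).continuousOn)) (fun p hp => ?_)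
    fun p hp => ?_
  · have h' : TendstoUniformlyOn (fun n x => F n (x, p.2)) (fun x => f (x, p.2)) atTop
        {x | (x, p.2) ∈ U} := h.comp fun x => (x, p.2)
    have := h'.tendstoLocallyUniformlyOn.differentiableOn
      (Eventually.of_forall fun n => (hF n).slice_fst p.2) (hU.slice_fst p.2)
    exact this.differentiableAt ((hU.slice_fst p.2).mem_nhds hp)
  · have h' : TendstoUniformlyOn (fun n y => F n (p.1, y)) (fun y => f (p.1, y)) atTop
        {y | (p.1, y) ∈ U} := h.comp fun y => (p.1, y)
    have := h'.tendstoLocallyUniformlyOn.differentiableOn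
      (Eventually.of_forall fun n => (hF n).slice_snd p.1) (hU.slice_snd p.1)
    exact this.differentiableAt ((hU.slice_snd p.1).mem_nhds hp)

/-- A sup-norm contraction preserving a class of functions that is closed under uniform limits
has a fixed point in that class. -/
theorem exists_fixedPoint_of_half_lipschitz {α : Type*} {Ω : Set α} {H : Set (α → ℂ)}
    (h0 : (fun _ => 0) ∈ H)
    (hlim : ∀ (F : ℕ → α → ℂ) (f : α → ℂ), (∀ n, F n ∈ H) → TendstoUniformlyOn F f atTop Ω → f ∈ H)
    {M : ℝ} (hM : 0 ≤ M) {G : (α → ℂ) → α → ℂ}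
    (hG : ∀ f ∈ H, (∀ p ∈ Ω, ‖f p‖ ≤ M) → G f ∈ H ∧ ∀ p ∈ Ω, ‖G f p‖ ≤ M)
    (hL : ∀ f ∈ H, ∀ g ∈ H, (∀ p ∈ Ω, ‖f p‖ ≤ M) → (∀ p ∈ Ω, ‖g p‖ ≤ M) → ∀ d : ℝ,
      (∀ p ∈ Ω, ‖f p - g p‖ ≤ d) → ∀ p ∈ Ω, ‖G f p - G g p‖ ≤ d / 2) :
    ∃ f ∈ H, (∀ p ∈ Ω, ‖f p‖ ≤ M) ∧ ∀ p ∈ Ω, G f p = f p := by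
  classical
  let F : ℕ → α → ℂ := fun n => G^[n] fun _ => 0
  have hFs : ∀ n, F (n + 1) = G (F n) := fun n => Function.iterate_succ_apply' G n _
  have hF : ∀ n, F n ∈ H ∧ ∀ p ∈ Ω, ‖F n p‖ ≤ M := by
    intro n
    induction n with
    | zero => exact ⟨h0, fun p _ => by simpa [F] using hM⟩
    | succ n ih => rw [hFs]; exact hG _ ih.1 ih.2
  have hstep : ∀ n, ∀ p ∈ Ω, ‖F n p - F (n + 1) p‖ ≤ 2 * M / 2 / 2 ^ n := by
    intro n
    induction n with
    | zero =>
      intro p hp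
      have : F 0 p = 0 := rfl
      rw [this, zero_sub, norm_neg]
      simpa using (hF 1).2 p hp
    | succ n ih =>
      intro p hp
      have := hL _ (hF n).1 _ (hF (n + 1)).1 (hF n).2 (hF (n + 1)).2 _ ih p hp
      rw [← hFs, ← hFs] at this
      refine this.trans (le_of_eq ?_)
      rw [pow_succ]; field_simp
  have hlim' : ∀ p ∈ Ω, ∃ l, Tendsto (fun n => F n p) atTop (𝓝 l) := fun p hp =>
    cauchySeq_tendsto_of_complete
      (cauchySeq_of_le_geometric_two fun n => by rw [dist_eq_norm]; exact hstep n p hp)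
  let f : α → ℂ := fun p => if hp : p ∈ Ω then (hlim' p hp).choose else 0
  have hf : ∀ p ∈ Ω, Tendsto (fun n => F n p) atTop (𝓝 (f p)) := fun p hp => by
    simp only [f, dif_pos hp]
    exact (hlim' p hp).choose_spec
  have hdist : ∀ n, ∀ p ∈ Ω, ‖F n p - f p‖ ≤ 2 * M / 2 ^ n := fun n p hp => by
    have := dist_le_of_le_geometric_two_of_tendsto
      (fun n => by rw [dist_eq_norm]; exact hstep n p hp) (hf p hp) n
    rwa [dist_eq_norm] at this
  have hgeo : Tendsto (fun n : ℕ => 2 * M / 2 ^ n) atTop (𝓝 0) := by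
    have := (tendsto_pow_atTop_nhds_zero_of_lt_one (r := (1 / 2 : ℝ)) (by norm_num)
      (by norm_num)).const_mul (2 * M)
    simpa [div_eq_mul_inv] using this
  have hunif : TendstoUniformlyOn F f atTop Ω := by
    rw [Metric.tendstoUniformlyOn_iff]
    intro ε hε
    filter_upwards [hgeo.eventually (gt_mem_nhds hε)] with n hn p hp
    rw [dist_comm, dist_eq_norm]
    exact (hdist n p hp).trans_lt hn
  have hfH : f ∈ H := hlim F f (fun n => (hF n).1) hunif
  have hfM : ∀ p ∈ Ω, ‖f p‖ ≤ M := fun p hp =>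
    le_of_tendsto (hf p hp).norm (Eventually.of_forall fun n => (hF n).2 p hp)
  refine ⟨f, hfH, hfM, fun p hp => ?_⟩
  have h1 : Tendsto (fun n => F (n + 1) p) atTop (𝓝 (G f p)) := by
    rw [tendsto_iff_norm_sub_tendsto_zero]
    have h2 : Tendsto (fun n : ℕ => 2 * M / 2 ^ n / 2) atTop (𝓝 0) := by
      simpa using hgeo.div_const 2
    refine squeeze_zero (fun _ => norm_nonneg _) (fun n => ?_) h2
    rw [hFs]
    exact hL _ (hF n).1 _ hfH (hF n).2 hfM _ (hdist n) p hp
  exact tendsto_nhds_unique h1 ((tendsto_add_atTop_iff_nat 1).2 (hf p hp))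


/-- Parametric integrals of dominated holomorphic families are holomorphic (one variable). -/
theorem differentiableOn_integral_of_dominated {α : Type*} [MeasurableSpace α] {ν : Measure α}
    {U : Set ℂ} {F : ℂ → α → ℂ} (hU : IsOpen U)
    (hm : ∀ z ∈ U, AEStronglyMeasurable (F z) ν)
    (hb : ∀ z ∈ U, ∃ V ∈ 𝓝 z, ∃ bd : α → ℝ, Integrable bd ν ∧ ∀ᵐ t ∂ν, ∀ w ∈ V, ‖F w t‖ ≤ bd t)
    (hd : ∀ᵐ t ∂ν, DifferentiableOn ℂ (fun z => F z t) U) :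
    DifferentiableOn ℂ (fun z => ∫ t, F z t ∂ν) U := by
  intro z hz
  obtain ⟨V, hV, bd, hbi, hbd⟩ := hb z hz
  obtain ⟨r, hr, hrV⟩ := Metric.nhds_basis_closedBall.mem_iff.1 (inter_mem hV (hU.mem_nhds hz))
  have hr2 : 0 < r / 2 := by linarith
  have hsub : ∀ w ∈ ball z (r / 2), closedBall w (r / 2) ⊆ closedBall z r := by
    intro w hw
    refine closedBall_subset_closedBall' ?_
    rw [mem_ball] at hw
    linarith
  have hmem : ∀ w ∈ ball z (r / 2), w ∈ closedBall z r := fun w hw =>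
    hsub w hw (mem_closedBall_self hr2.le)
  have key := hasDerivAt_integral_of_dominated_loc_of_deriv_le (μ := ν) (𝕜 := ℂ) (F := F) (x₀ := z)
    (s := ball z (r / 2)) (bound := fun t => bd t / (r / 2)) (F' := fun w t => deriv (fun z => F z t) w)
    (ball_mem_nhds z hr2) ?_ ?_ ?_ ?_ (hbi.div_const _) ?_
  · exact key.2.differentiableAt.differentiableWithinAt
  · filter_upwards [ball_mem_nhds z hr2] with w hw using hm w (hrV (hmem w hw)).2
  · refine hbi.mono' (hm z hz) ?_
    filter_upwards [hbd] with t ht using ht z (mem_of_mem_nhds hV)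
  · -- the derivative is a limit of difference quotients
    let s : ℕ → ℂ := fun n => ((r / 2 / (n + 1) : ℝ) : ℂ)
    have hs0 : ∀ n, s n ≠ 0 := fun n => by
      simp only [s]
      exact_mod_cast (by positivity : r / 2 / ((n : ℝ) + 1) ≠ 0)
    have hsr : ∀ n, z + s n ∈ closedBall z r := fun n => by
      rw [mem_closedBall, dist_eq_norm, add_sub_cancel_left, Complex.norm_real, Real.norm_eq_abs,
        abs_of_pos (by positivity)]
      calc r / 2 / ((n : ℝ) + 1) ≤ r / 2 := div_le_self hr2.le (by linarith [n.cast_nonneg (α := ℝ)])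
        _ ≤ r := by linarith
    have hst : Tendsto s atTop (𝓝 0) := by
      have : Tendsto (fun n : ℕ => r / 2 / ((n : ℝ) + 1)) atTop (𝓝 0) :=
        tendsto_const_nhds.div_atTop
          (tendsto_atTop_add_const_right _ _ tendsto_natCast_atTop_atTop)
      have := (Complex.continuous_ofReal.tendsto 0).comp this
      rwa [Complex.ofReal_zero] at this
    refine aestronglyMeasurable_of_tendsto_ae (u := atTop)
      (f := fun n t => (s n)⁻¹ • (F (z + s n) t - F z t)) (fun n => ?_) ?_
    · exact AEStronglyMeasurable.const_smul ((hm _ (hrV (hsr n)).2).sub (hm z hz)) (s n)⁻¹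
    · filter_upwards [hd] with t ht
      have hda := (ht.differentiableAt (hU.mem_nhds hz)).hasDerivAt
      rw [hasDerivAt_iff_tendsto_slope_zero] at hda
      exact hda.comp (tendsto_nhdsWithin_iff.2 ⟨hst, Eventually.of_forall fun n => hs0 n⟩)
  · filter_upwards [hbd, hd] with t ht hdt w hw
    refine Complex.norm_deriv_le_of_forall_mem_sphere_norm_le hr2 ?_ fun u hu => ?_
    · refine (hdt.mono ?_).diffContOnCl
      exact (closure_ball_subset_closedBall.trans (hsub w hw)).trans fun u hu => (hrV hu).2
    · exact ht u (hrV (hsub w hw (sphere_subset_closedBall hu))).1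
  · filter_upwards [hd] with t ht w hw
    exact (ht.differentiableAt (hU.mem_nhds (hrV (hmem w hw)).2)).hasDerivAt

/-- Parametric integrals of dominated holomorphic families are holomorphic (two variables). -/
theorem differentiableOn_integral_of_dominated_prod {α : Type*} [MeasurableSpace α] {ν : Measure α}
    {U : Set (ℂ × ℂ)} {F : ℂ × ℂ → α → ℂ} (hU : IsOpen U)
    (hm : ∀ z ∈ U, AEStronglyMeasurable (F z) ν)
    (hb : ∀ z ∈ U, ∃ V ∈ 𝓝 z, ∃ bd : α → ℝ, Integrable bd ν ∧ ∀ᵐ t ∂ν, ∀ w ∈ V, ‖F w t‖ ≤ bd t)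
    (hd : ∀ᵐ t ∂ν, DifferentiableOn ℂ (fun z => F z t) U) :
    DifferentiableOn ℂ (fun z => ∫ t, F z t ∂ν) U := by
  refine differentiableOn_of_separately_differentiable hU (fun p hp => ?_) (fun p hp => ?_)
    fun p hp => ?_
  · obtain ⟨V, hV, bd, hbi, hbd⟩ := hb p hp
    refine ContinuousAt.continuousWithinAt (continuousAt_of_dominated (bound := bd) ?_ ?_ hbi ?_)
    · filter_upwards [hU.mem_nhds hp] with w hw using hm w hw
    · filter_upwards [hV] with w hw
      filter_upwards [hbd] with t ht using ht w hw
    · filter_upwards [hd] with t ht using (ht.differentiableAt (hU.mem_nhds hp)).continuousAt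
  · have := differentiableOn_integral_of_dominated (ν := ν) (F := fun x t => F (x, p.2) t)
      (hU.slice_fst p.2) (fun z hz => hm _ hz) (fun z hz => ?_) ?_
    · exact this.differentiableAt ((hU.slice_fst p.2).mem_nhds hp)
    · obtain ⟨V, hV, bd, hbi, hbd⟩ := hb _ hz
      refine ⟨(fun x => (x, p.2)) ⁻¹' V, ?_, bd, hbi, ?_⟩
      · exact (by fun_prop : Continuous fun x : ℂ => (x, p.2)).continuousAt.preimage_mem_nhds hV
      · filter_upwards [hbd] with t ht w hw using ht _ hw
    · filter_upwards [hd] with t ht using ht.slice_fst p.2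
  · have := differentiableOn_integral_of_dominated (ν := ν) (F := fun x t => F (p.1, x) t)
      (hU.slice_snd p.1) (fun z hz => hm _ hz) (fun z hz => ?_) ?_
    · exact this.differentiableAt ((hU.slice_snd p.1).mem_nhds hp)
    · obtain ⟨V, hV, bd, hbi, hbd⟩ := hb _ hz
      refine ⟨(fun x => (p.1, x)) ⁻¹' V, ?_, bd, hbi, ?_⟩
      · exact (by fun_prop : Continuous fun x : ℂ => (p.1, x)).continuousAt.preimage_mem_nhds hV
      · filter_upwards [hbd] with t ht w hw using ht _ hw
    · filter_upwards [hd] with t ht using ht.slice_snd p.1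

theorem continuousOn_uncurry_local_bound {E : Type*} [NormedAddCommGroup E] [ProperSpace E]
    {U : Set E} (hU : IsOpen U) {F : E → ℝ → ℂ} {a b : ℝ}
    (hc : ContinuousOn (Function.uncurry F) (U ×ˢ Icc a b)) :
    (∀ z ∈ U, AEStronglyMeasurable (F z) (volume.restrict (Ioc a b))) ∧
    ∀ z ∈ U, ∃ V ∈ 𝓝 z, ∃ bd : ℝ → ℝ, Integrable bd (volume.restrict (Ioc a b)) ∧
      ∀ᵐ t ∂(volume.restrict (Ioc a b)), ∀ w ∈ V, ‖F w t‖ ≤ bd t := by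
  constructor
  · intro z hz
    refine ContinuousOn.aestronglyMeasurable ?_ measurableSet_Ioc
    exact ContinuousOn.comp (f := fun t => (z, t)) hc (by fun_prop)
      fun t ht => ⟨hz, Ioc_subset_Icc_self ht⟩
  · intro z hz
    obtain ⟨r, hr, hrU⟩ := Metric.nhds_basis_closedBall.mem_iff.1 (hU.mem_nhds hz)
    obtain ⟨C, hC⟩ := ((isCompact_closedBall z r).prod isCompact_Icc).exists_bound_of_continuousOn
      (hc.mono (prod_mono hrU (Subset.refl _)))
    refine ⟨closedBall z r, closedBall_mem_nhds z hr, fun _ => C, integrable_const _, ?_⟩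
    filter_upwards [ae_restrict_mem measurableSet_Ioc] with t ht w hw
    exact hC (w, t) ⟨hw, Ioc_subset_Icc_self ht⟩

theorem differentiableOn_intervalIntegral {U : Set ℂ} (hU : IsOpen U) {F : ℂ → ℝ → ℂ} {a b : ℝ}
    (hab : a ≤ b) (hc : ContinuousOn (Function.uncurry F) (U ×ˢ Icc a b))
    (hd : ∀ t ∈ Icc a b, DifferentiableOn ℂ (fun z => F z t) U) :
    DifferentiableOn ℂ (fun z => ∫ t in a..b, F z t) U := by
  simp only [intervalIntegral.integral_of_le hab]
  obtain ⟨h1, h2⟩ := continuousOn_uncurry_local_bound hU hc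
  refine differentiableOn_integral_of_dominated hU h1 h2 ?_
  filter_upwards [ae_restrict_mem measurableSet_Ioc] with t ht
  exact hd t (Ioc_subset_Icc_self ht)

theorem differentiableOn_intervalIntegral_prod {U : Set (ℂ × ℂ)} (hU : IsOpen U)
    {F : ℂ × ℂ → ℝ → ℂ} {a b : ℝ}
    (hab : a ≤ b) (hc : ContinuousOn (Function.uncurry F) (U ×ˢ Icc a b))
    (hd : ∀ t ∈ Icc a b, DifferentiableOn ℂ (fun z => F z t) U) :
    DifferentiableOn ℂ (fun z => ∫ t in a..b, F z t) U := by
  simp only [intervalIntegral.integral_of_le hab]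
  obtain ⟨h1, h2⟩ := continuousOn_uncurry_local_bound hU hc
  refine differentiableOn_integral_of_dominated_prod hU h1 h2 ?_
  filter_upwards [ae_restrict_mem measurableSet_Ioc] with t ht
  exact hd t (Ioc_subset_Icc_self ht)

/-- A function holomorphic in `x` near every fibre and holomorphic off `x = 0` is holomorphic. -/
theorem differentiableOn_of_differentiableOn_punctured {R : ℝ} {D : Set ℂ} (hD : IsOpen D)
    {g : ℂ × ℂ → ℂ} (hg : DifferentiableOn ℂ g ((ball 0 R \ {0}) ×ˢ D))
    (hx : ∀ y ∈ D, DifferentiableOn ℂ (fun x => g (x, y)) (ball 0 R)) :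
    DifferentiableOn ℂ g (ball 0 R ×ˢ D) := by
  rintro ⟨x₀, y₀⟩ ⟨hx₀, hy₀⟩
  simp only [mem_ball_zero_iff] at hx₀
  obtain ⟨r, hr1, hr2⟩ := exists_between hx₀
  have hr : 0 < r := (norm_nonneg _).trans_lt hr1
  have hUo : IsOpen (ball (0 : ℂ) r ×ˢ D) := isOpen_ball.prod hD
  have hcm : ∀ θ : ℝ, circleMap 0 r θ ∈ ball (0 : ℂ) R \ {0} := fun θ => by
    refine ⟨?_, circleMap_ne_center hr.ne'⟩
    rw [mem_ball_zero_iff, norm_circleMap_zero, abs_of_pos hr]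
    exact hr2
  have hne : ∀ x ∈ ball (0 : ℂ) r, ∀ θ, circleMap 0 r θ - x ≠ 0 := by
    intro x hx θ h
    rw [mem_ball_zero_iff, ← sub_eq_zero.1 h, norm_circleMap_zero, abs_of_pos hr] at hx
    exact lt_irrefl _ hx
  have key : DifferentiableOn ℂ (fun p : ℂ × ℂ => ∫ θ in (0:ℝ)..2 * Real.pi,
      deriv (circleMap 0 r) θ * ((circleMap 0 r θ - p.1)⁻¹ * g (circleMap 0 r θ, p.2)))
      (ball 0 r ×ˢ D) := by
    refine differentiableOn_intervalIntegral_prod hUo Real.two_pi_pos.le ?_ fun θ _ => ?_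
    · simp only [deriv_circleMap]
      refine ContinuousOn.mul (by fun_prop) (ContinuousOn.mul ?_ ?_)
      · exact ContinuousOn.inv₀ (by fun_prop) fun q hq => hne _ hq.1.1 _
      · exact ContinuousOn.comp (f := fun q : (ℂ × ℂ) × ℝ => (circleMap 0 r q.2, q.1.2))
          hg.continuousOn (by fun_prop) fun q hq => ⟨hcm _, hq.1.2⟩
    · refine DifferentiableOn.const_mul (DifferentiableOn.mul ?_ ?_) _
      · exact DifferentiableOn.inv (by fun_prop) fun q hq => hne _ hq.1 _
      · exact DifferentiableOn.comp (f := fun q : ℂ × ℂ => (circleMap 0 r θ, q.2))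
          hg (by fun_prop) fun q hq => ⟨hcm _, hq.2⟩
  have hmem : ball (0 : ℂ) r ×ˢ D ∈ 𝓝 (x₀, y₀) :=
    hUo.mem_nhds ⟨mem_ball_zero_iff.2 hr1, hy₀⟩
  refine DifferentiableAt.differentiableWithinAt ?_
  refine ((key.differentiableAt hmem).const_mul (2 * Real.pi * Complex.I : ℂ)⁻¹).congr_of_eventuallyEq
    ?_
  filter_upwards [hmem]
  rintro ⟨x, y⟩ ⟨hx', hy'⟩
  have hd : DiffContOnCl ℂ (fun x => g (x, y)) (ball 0 r) :=
    ((hx y hy').mono ((closure_ball_subset_closedBall).trans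
      (closedBall_subset_ball hr2))).diffContOnCl
  have e := hd.two_pi_i_inv_smul_circleIntegral_sub_inv_smul hx'
  rw [← e]
  rfl

theorem exists_extension_of_bounded {R : ℝ} {D : Set ℂ} (hR : 0 < R) (hD : IsOpen D) {g : ℂ × ℂ → ℂ}
    (hg : DifferentiableOn ℂ g ((ball 0 R \ {0}) ×ˢ D)) {C : ℂ → ℝ}
    (hb : ∀ x ∈ ball (0 : ℂ) R \ {0}, ∀ y ∈ D, ‖g (x, y)‖ ≤ C y) :
    ∃ G : ℂ × ℂ → ℂ, DifferentiableOn ℂ G (ball 0 R ×ˢ D) ∧ ∀ x y, x ≠ 0 → G (x, y) = g (x, y) := by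
  let G : ℂ × ℂ → ℂ := fun p => Function.update (fun x => g (x, p.2)) 0
    (limUnder (𝓝[≠] (0:ℂ)) fun x => g (x, p.2)) p.1
  have hGg : ∀ x y, x ≠ 0 → G (x, y) = g (x, y) := fun x y hx => Function.update_of_ne hx _ _
  refine ⟨G, ?_, hGg⟩
  refine differentiableOn_of_differentiableOn_punctured hD ?_ fun y hy => ?_
  · exact hg.congr fun p hp => hGg p.1 p.2 hp.1.2
  · refine Complex.differentiableOn_update_limUnder_of_bddAbove (ball_mem_nhds 0 hR) ?_ ?_
    · exact DifferentiableOn.comp (f := fun x : ℂ => (x, y)) hg (by fun_prop) fun x hx => ⟨hx, hy⟩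
    · refine ⟨C y, ?_⟩
      rintro _ ⟨x, hx, rfl⟩
      exact hb x hx y hy

theorem exists_div_fst {R : ℝ} {D : Set ℂ} (hR : 0 < R) (hD : IsOpen D) {g : ℂ × ℂ → ℂ}
    (hg : DifferentiableOn ℂ g (ball 0 R ×ˢ D)) (h0 : ∀ y ∈ D, g (0, y) = 0) :
    ∃ G : ℂ × ℂ → ℂ, DifferentiableOn ℂ G (ball 0 R ×ˢ D) ∧
      ∀ x, ∀ y ∈ D, g (x, y) = x * G (x, y) := by
  let G : ℂ × ℂ → ℂ := fun p => dslope (fun x => g (x, p.2)) 0 p.1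
  have hG : ∀ x, ∀ y ∈ D, g (x, y) = x * G (x, y) := fun x y hy => by
    have := sub_smul_dslope (fun x => g (x, y)) 0 x
    rw [sub_zero, smul_eq_mul, h0 y hy, sub_zero] at this
    exact this.symm
  refine ⟨G, ?_, hG⟩
  refine differentiableOn_of_differentiableOn_punctured hD ?_ fun y hy => ?_
  · have h1 : DifferentiableOn ℂ (fun p : ℂ × ℂ => g p * p.1⁻¹) ((ball 0 R \ {0}) ×ˢ D) :=
      (hg.mono (prod_mono sdiff_subset (Subset.refl _))).fun_mul
        (differentiable_fst.differentiableOn.fun_inv fun p hp => hp.1.2)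
    refine h1.congr fun p hp => ?_
    have := hG p.1 p.2 hp.2
    rw [← div_eq_mul_inv, eq_div_iff (hp.1.2 : p.1 ≠ 0), mul_comm]
    exact this.symm
  · refine (Complex.differentiableOn_dslope (ball_mem_nhds 0 hR)).2 ?_
    exact DifferentiableOn.comp (f := fun x : ℂ => (x, y)) hg (by fun_prop) fun x hx => ⟨hx, hy⟩

/-- Primitive of a holomorphic function on a star-shaped open set. -/
theorem hasDerivAt_segment_integral {U : Set ℂ} (hU : IsOpen U) {z₀ : ℂ} (hs : StarConvex ℝ z₀ U)
    {R : ℂ → ℂ} (hR : DifferentiableOn ℂ R U) {z : ℂ} (hz : z ∈ U) :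
    HasDerivAt (fun z => (z - z₀) * ∫ t in (0:ℝ)..1, R (z₀ + t * (z - z₀))) (R z) z := by
  have hmem : ∀ w ∈ U, ∀ t ∈ Icc (0:ℝ) 1, z₀ + t * (w - z₀) ∈ U := fun w hw t ht => by
    have := hs.add_smul_sub_mem hw ht.1 ht.2
    rwa [Complex.real_smul] at this
  have hI : DifferentiableOn ℂ (fun z => ∫ t in (0:ℝ)..1, R (z₀ + t * (z - z₀))) U := by
    refine differentiableOn_intervalIntegral hU zero_le_one ?_ fun t ht => ?_
    · exact ContinuousOn.comp (f := fun q : ℂ × ℝ => z₀ + q.2 * (q.1 - z₀)) hR.continuousOn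
        (by fun_prop) fun q hq => hmem _ hq.1 _ hq.2
    · exact DifferentiableOn.comp (f := fun w : ℂ => z₀ + t * (w - z₀)) hR (by fun_prop)
        fun w hw => hmem w hw t ht
  have hId := hI.differentiableAt (hU.mem_nhds hz)
  have hP := ((hasDerivAt_id z).sub_const z₀).fun_mul hId.hasDerivAt
  by_cases h : z = z₀
  · subst h
    exact hP.congr_deriv (by simp)
  · have hP' : HasDerivAt (fun z => (z - z₀) * ∫ t in (0:ℝ)..1, R (z₀ + t * (z - z₀)))
      (deriv (fun z => (z - z₀) * ∫ t in (0:ℝ)..1, R (z₀ + t * (z - z₀))) z) z :=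
      hP.differentiableAt.hasDerivAt
    suffices e : deriv (fun z => (z - z₀) * ∫ t in (0:ℝ)..1, R (z₀ + t * (z - z₀))) z = R z by
      rwa [e] at hP'
    have hl : HasDerivAt (fun s : ℝ => z₀ + s * (z - z₀)) (z - z₀) 1 := by
      have := ((hasDerivAt_id (1:ℝ)).ofReal_comp.mul_const (z - z₀)).const_add z₀
      simpa using this
    have hz1 : z₀ + ((1 : ℝ) : ℂ) * (z - z₀) = z := by simp
    have hcomp : HasDerivAt (fun s : ℝ => (z₀ + s * (z - z₀) - z₀) *
        ∫ t in (0:ℝ)..1, R (z₀ + t * (z₀ + s * (z - z₀) - z₀))) _ 1 :=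
      HasDerivAt.comp (h := fun s : ℝ => z₀ + s * (z - z₀)) (h₂ := fun z => (z - z₀) *
        ∫ t in (0:ℝ)..1, R (z₀ + t * (z - z₀))) 1 (by rw [hz1]; exact hP') hl
    have heq : (fun s : ℝ => (z₀ + s * (z - z₀) - z₀) *
        ∫ t in (0:ℝ)..1, R (z₀ + t * (z₀ + s * (z - z₀) - z₀))) = fun s : ℝ =>
        (z - z₀) * ∫ t in (0:ℝ)..s, R (z₀ + t * (z - z₀)) := by
      funext s
      have := intervalIntegral.smul_integral_comp_mul_left (a := 0) (b := 1)
        (fun t : ℝ => R (z₀ + t * (z - z₀))) s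
      rw [mul_zero, mul_one] at this
      rw [← this, Complex.real_smul, add_sub_cancel_left]
      rw [mul_comm (s : ℂ), mul_assoc]
      congr 2
      refine intervalIntegral.integral_congr fun t _ => ?_
      simp only [Complex.ofReal_mul]
      ring_nf
    rw [heq] at hcomp
    have hcont : ContinuousOn (fun t : ℝ => R (z₀ + t * (z - z₀))) (Icc 0 1) :=
      ContinuousOn.comp (f := fun t : ℝ => z₀ + t * (z - z₀)) hR.continuousOn (by fun_prop)
        fun t ht => hmem z hz t ht
    have hopen : IsOpen {t : ℝ | z₀ + t * (z - z₀) ∈ U} := hU.preimage (by fun_prop)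
    have hcont' : ContinuousOn (fun t : ℝ => R (z₀ + t * (z - z₀))) {t : ℝ | z₀ + t * (z - z₀) ∈ U} :=
      ContinuousOn.comp (f := fun t : ℝ => z₀ + t * (z - z₀)) hR.continuousOn (by fun_prop)
        fun t ht => ht
    have h1mem : (1 : ℝ) ∈ {t : ℝ | z₀ + t * (z - z₀) ∈ U} := by simpa using hz
    have hF := (intervalIntegral.integral_hasDerivAt_right
      (hcont.intervalIntegrable_of_Icc zero_le_one)
      (hcont'.stronglyMeasurableAtFilter hopen 1 h1mem)
      (hcont'.continuousAt (hopen.mem_nhds h1mem))).const_mul (z - z₀)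
    have := hcomp.unique hF
    rw [hz1, mul_comm] at this
    exact mul_left_cancel₀ (sub_ne_zero.2 h) this

theorem ContinuousLinearMap.det_prod_eq (L : ℂ × ℂ →L[ℂ] ℂ × ℂ) :
    LinearMap.det L.toLinearMap = (L (1, 0)).1 * (L (0, 1)).2 - (L (0, 1)).1 * (L (1, 0)).2 := by
  rw [← LinearMap.det_toMatrix (Module.Basis.finTwoProd ℂ), Matrix.det_fin_two]
  simp [LinearMap.toMatrix_apply]

theorem ContinuousLinearMap.trace_prod_eq (L : ℂ × ℂ →L[ℂ] ℂ × ℂ) :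
    LinearMap.trace ℂ (ℂ × ℂ) L.toLinearMap = (L (1, 0)).1 + (L (0, 1)).2 := by
  rw [LinearMap.trace_eq_matrix_trace ℂ (Module.Basis.finTwoProd ℂ), Matrix.trace_fin_two]
  simp [LinearMap.toMatrix_apply]

theorem AnalyticAt.clm_apply' {f : ℂ × ℂ → ℂ × ℂ →L[ℂ] ℂ × ℂ} {g : ℂ × ℂ → ℂ × ℂ} {p : ℂ × ℂ}
    (hf : AnalyticAt ℂ f p) (hg : AnalyticAt ℂ g p) : AnalyticAt ℂ (fun q => f q (g q)) p :=
  ((ContinuousLinearMap.id ℂ (ℂ × ℂ →L[ℂ] ℂ × ℂ)).analyticAt_bilinear _).comp (hf.prod hg)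

theorem FoliationEquiv.trans {X Y Z : ℂ × ℂ → ℂ × ℂ} (h₁ : FoliationEquiv X Y)
    (h₂ : FoliationEquiv Y Z) : FoliationEquiv X Z := by
  obtain ⟨Φ, u, hΦ, hΦ0, hdΦ, hu, hu0, he⟩ := h₁
  obtain ⟨Ψ, v, hΨ, hΨ0, hdΨ, hv, hv0, hf⟩ := h₂
  rw [← hΦ0] at hΨ hv hf
  have hfd : ∀ᶠ p in 𝓝 (0 : ℂ × ℂ), fderiv ℂ (Ψ ∘ Φ) p = (fderiv ℂ Ψ (Φ p)).comp (fderiv ℂ Φ p) := by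
    filter_upwards [hΦ.eventually_analyticAt,
      hΦ.continuousAt.eventually hΨ.eventually_analyticAt] with p h1 h2
    exact fderiv_comp p h2.differentiableAt h1.differentiableAt
  refine ⟨Ψ ∘ Φ, fun p => u p * v (Φ p), hΨ.comp hΦ, by simp [hΦ0, hΨ0], ?_, hu.mul (hv.comp hΦ),
    by simp [hΦ0, hu0, hv0], ?_⟩
  · rw [hfd.self_of_nhds, ContinuousLinearMap.toLinearMap_comp, LinearMap.det_comp, hΦ0]
    exact mul_ne_zero hdΨ hdΦ
  · filter_upwards [hfd, he, hΦ.continuousAt.eventually hf] with p h1 h2 h3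
    rw [h1, ContinuousLinearMap.comp_apply, h2, map_smul, h3, smul_smul]
    rfl

theorem FoliationEquiv.symm {X Y : ℂ × ℂ → ℂ × ℂ} (h : FoliationEquiv X Y) :
    FoliationEquiv Y X := by
  obtain ⟨Φ, u, hΦ, hΦ0, hdΦ, hu, hu0, he⟩ := h
  let i := (fderiv ℂ Φ 0).toContinuousLinearEquivOfDetNeZero hdΦ
  have hi : (i : ℂ × ℂ →L[ℂ] ℂ × ℂ) = fderiv ℂ Φ 0 := by
    ext <;> simp [i]
  have hs : HasStrictFDerivAt Φ (i : ℂ × ℂ →L[ℂ] ℂ × ℂ) 0 := by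
    rw [hi]; exact hΦ.hasStrictFDerivAt
  let e := hs.toOpenPartialHomeomorph Φ
  have h0s : (0 : ℂ × ℂ) ∈ e.source := hs.mem_toOpenPartialHomeomorph_source
  have hΨ : AnalyticAt ℂ e.symm 0 := by
    have := e.analyticAt_symm' (a := 0) (i := i) h0s hΦ hi.symm
    rwa [show e 0 = 0 from hΦ0] at this
  have hΨ0 : e.symm 0 = 0 := by
    have := e.left_inv h0s
    rwa [show e 0 = 0 from hΦ0] at this
  have hΨΦ : ∀ᶠ q in 𝓝 (0 : ℂ × ℂ), Φ (e.symm q) = q := by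
    have := e.eventually_right_inverse' h0s
    rwa [show e 0 = 0 from hΦ0] at this
  have hcont : Tendsto e.symm (𝓝 0) (𝓝 0) := by
    have := hΨ.continuousAt.tendsto
    rwa [hΨ0] at this
  have hΦΨ : ∀ᶠ p in 𝓝 (0 : ℂ × ℂ), e.symm (Φ p) = p := e.eventually_left_inverse h0s
  have hΦt : Tendsto Φ (𝓝 0) (𝓝 0) := by
    have := hΦ.continuousAt.tendsto
    rwa [hΦ0] at this
  have hinv : ∀ᶠ p in 𝓝 (0 : ℂ × ℂ), ∀ w, fderiv ℂ e.symm (Φ p) (fderiv ℂ Φ p w) = w := by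
    filter_upwards [hΦΨ.eventually_nhds, hΦ.eventually_analyticAt,
      hΦt.eventually hΨ.eventually_analyticAt] with p h1 h2 h3 w
    have h4 := fderiv_comp p h3.differentiableAt h2.differentiableAt
    rw [show fderiv ℂ (e.symm ∘ Φ) p = fderiv ℂ id p from
      EventuallyEq.fderiv_eq (by filter_upwards [h1] with q hq using hq), fderiv_id] at h4
    exact (DFunLike.congr_fun h4 w).symm
  refine ⟨e.symm, fun q => (u (e.symm q))⁻¹, hΨ, hΨ0, ?_, ?_, ?_, ?_⟩
  · have h1 : (fderiv ℂ e.symm 0).comp (fderiv ℂ Φ 0) = ContinuousLinearMap.id ℂ _ := by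
      refine ContinuousLinearMap.ext fun w => ?_
      simpa [hΦ0] using hinv.self_of_nhds w
    have h2 := congrArg (fun L : ℂ × ℂ →L[ℂ] ℂ × ℂ => LinearMap.det L.toLinearMap) h1
    simp only [ContinuousLinearMap.toLinearMap_comp, LinearMap.det_comp,
      ContinuousLinearMap.coe_id, LinearMap.det_id] at h2
    exact left_ne_zero_of_mul_eq_one h2
  · have h1 : AnalyticAt ℂ u (e.symm 0) := by rwa [hΨ0]
    exact (h1.comp hΨ).inv (by simpa [hΨ0] using hu0)
  · simpa [hΨ0] using hu0
  · filter_upwards [hΨΦ, hcont.eventually he, hcont.eventually hinv,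
      hcont.eventually (hu.continuousAt.eventually_ne hu0)] with q h1 h2 h3 h4
    rw [h1] at h2 h3
    have := h3 (X (e.symm q))
    rw [h2, map_smul] at this
    rw [← this, smul_smul, inv_mul_cancel₀ h4, one_smul]

/-- Pull-back of a vector field by a germ of biholomorphism. -/
theorem exists_pullback {X Φ : ℂ × ℂ → ℂ × ℂ} (hX : AnalyticAt ℂ X 0) (hΦ : AnalyticAt ℂ Φ 0)
    (hΦ0 : Φ 0 = 0) (hd : LinearMap.det ((fderiv ℂ Φ 0).toLinearMap) ≠ 0) :
    ∃ Y : ℂ × ℂ → ℂ × ℂ, AnalyticAt ℂ Y 0 ∧ FoliationEquiv X Y ∧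
      ∀ᶠ p in 𝓝 (0 : ℂ × ℂ), Function.Injective (fderiv ℂ Φ p) ∧ fderiv ℂ Φ p (Y p) = X (Φ p) := by
  let i := (fderiv ℂ Φ 0).toContinuousLinearEquivOfDetNeZero hd
  let e := ContinuousLinearEquiv.toUnit i
  have he : (e : ℂ × ℂ →L[ℂ] ℂ × ℂ) = fderiv ℂ Φ 0 := by
    ext <;> simp [e, i, ContinuousLinearEquiv.toUnit]
  have hfa : AnalyticAt ℂ (fderiv ℂ Φ) 0 := hΦ.fderiv
  have hinv : AnalyticAt ℂ (fun p => Ring.inverse (fderiv ℂ Φ p)) 0 := by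
    have := analyticAt_inverse (𝕜 := ℂ) e
    rw [he] at this
    exact this.comp hfa
  have hunit : ∀ᶠ p in 𝓝 (0 : ℂ × ℂ), IsUnit (fderiv ℂ Φ p) := by
    refine hfa.continuousAt.eventually (Units.isOpen.mem_nhds ?_)
    exact ⟨e, he⟩
  have hXΦ : AnalyticAt ℂ (fun p => X (Φ p)) 0 := by
    rw [← hΦ0] at hX
    exact hX.comp hΦ
  have key : ∀ᶠ p in 𝓝 (0 : ℂ × ℂ), Function.Injective (fderiv ℂ Φ p) ∧
      fderiv ℂ Φ p (Ring.inverse (fderiv ℂ Φ p) (X (Φ p))) = X (Φ p) := by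
    filter_upwards [hunit] with p hp
    constructor
    · refine Function.LeftInverse.injective (g := ⇑(Ring.inverse (fderiv ℂ Φ p))) fun w => ?_
      exact DFunLike.congr_fun (Ring.inverse_mul_cancel _ hp) w
    · exact DFunLike.congr_fun (Ring.mul_inverse_cancel _ hp) (X (Φ p))
  refine ⟨fun p => Ring.inverse (fderiv ℂ Φ p) (X (Φ p)), hinv.clm_apply' hXΦ, ?_, key⟩
  refine FoliationEquiv.symm ⟨Φ, fun _ => 1, hΦ, hΦ0, hd, analyticAt_const, one_ne_zero, ?_⟩
  filter_upwards [key] with p hp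
  rw [hp.2, one_smul]

theorem FoliationEquiv.of_smul {X Y : ℂ × ℂ → ℂ × ℂ} {u : ℂ × ℂ → ℂ} (hu : AnalyticAt ℂ u 0)
    (hu0 : u 0 ≠ 0) (h : ∀ᶠ p in 𝓝 (0 : ℂ × ℂ), X p = u p • Y p) : FoliationEquiv X Y := by
  refine ⟨id, u, analyticAt_id, rfl, ?_, hu, hu0, ?_⟩
  · rw [fderiv_id, ContinuousLinearMap.coe_id, LinearMap.det_id]
    exact one_ne_zero
  · filter_upwards [h] with p hp
    rw [fderiv_id, ContinuousLinearMap.id_apply, hp]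
    rfl

theorem fderiv_prod_apply {E : Type*} [NormedAddCommGroup E] [NormedSpace ℂ E] {f : ℂ × ℂ → E}
    {p : ℂ × ℂ} (hf : DifferentiableAt ℂ f p) (v : ℂ × ℂ) :
    fderiv ℂ f p v = v.1 • deriv (fun x => f (x, p.2)) p.1 + v.2 • deriv (fun y => f (p.1, y)) p.2 := by
  have h1 : HasDerivAt (fun x => f (x, p.2)) (fderiv ℂ f p (1, 0)) p.1 :=
    HasFDerivAt.comp_hasDerivAt p.1 (f := fun x : ℂ => (x, p.2)) hf.hasFDerivAt
      ((hasDerivAt_id p.1).prodMk (hasDerivAt_const p.1 p.2))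
  have h2 : HasDerivAt (fun y => f (p.1, y)) (fderiv ℂ f p (0, 1)) p.2 :=
    HasFDerivAt.comp_hasDerivAt p.2 (f := fun y : ℂ => (p.1, y)) hf.hasFDerivAt
      ((hasDerivAt_const p.2 p.1).prodMk (hasDerivAt_id p.2))
  rw [h1.deriv, h2.deriv, ← map_smul, ← map_smul, ← map_add]
  congr 1
  simp

/-- A criterion for the fibred biholomorphisms `(x, y) ↦ (α x, y U(x, y))`. -/
theorem FoliationEquiv.of_fibred {X Y : ℂ × ℂ → ℂ × ℂ} {U : ℂ × ℂ → ℂ} {α : ℂ} (hα : α ≠ 0)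
    (hU : AnalyticAt ℂ U 0) (hU0 : U 0 ≠ 0)
    (h : ∀ᶠ p in 𝓝 (0 : ℂ × ℂ), α * (X p).1 = (Y (α * p.1, p.2 * U p)).1 ∧
      (X p).1 * deriv (fun x => p.2 * U (x, p.2)) p.1 + (X p).2 * deriv (fun y => y * U (p.1, y)) p.2
        = (Y (α * p.1, p.2 * U p)).2) : FoliationEquiv X Y := by
  have hg : AnalyticAt ℂ (fun p : ℂ × ℂ => p.2 * U p) 0 := analyticAt_snd.mul hU
  have hf : AnalyticAt ℂ (fun p : ℂ × ℂ => α * p.1) 0 := analyticAt_const.mul analyticAt_fst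
  have hfd : ∀ p v : ℂ × ℂ, DifferentiableAt ℂ U p →
      fderiv ℂ (fun p : ℂ × ℂ => (α * p.1, p.2 * U p)) p v = (α * v.1,
        v.1 * deriv (fun x => p.2 * U (x, p.2)) p.1 + v.2 * deriv (fun y => y * U (p.1, y)) p.2) := by
    intro p v hp
    have h1 : DifferentiableAt ℂ (fun p : ℂ × ℂ => α * p.1) p := by fun_prop
    have h2 : DifferentiableAt ℂ (fun p : ℂ × ℂ => p.2 * U p) p := by fun_prop
    rw [h1.fderiv_prodMk h2, ContinuousLinearMap.prod_apply, fderiv_prod_apply h1,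
      fderiv_prod_apply h2]
    simp [mul_comm]
  refine ⟨fun p => (α * p.1, p.2 * U p), fun _ => 1, hf.prod hg, by simp, ?_, analyticAt_const,
    one_ne_zero, ?_⟩
  · rw [ContinuousLinearMap.det_prod_eq, hfd _ _ hU.differentiableAt, hfd _ _ hU.differentiableAt]
    have hd : DifferentiableAt ℂ (fun y => U ((0 : ℂ), y)) 0 :=
      DifferentiableAt.comp (f := fun y : ℂ => ((0:ℂ), y)) (0:ℂ) hU.differentiableAt (by fun_prop)
    have : deriv (fun y => y * U (0, y)) 0 = U 0 := by
      have := ((hasDerivAt_id (0:ℂ)).fun_mul hd.hasDerivAt).deriv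
      simpa [Prod.mk_zero_zero] using this
    simpa [this] using ⟨hα, hU0⟩
  · filter_upwards [h, hU.eventually_analyticAt] with p hp hUp
    rw [hfd _ _ hUp.differentiableAt, one_smul, hp.2, hp.1]

theorem AnalyticAt.exists_ball_prod {f : ℂ × ℂ → ℂ} (hf : AnalyticAt ℂ f 0) :
    ∃ R > 0, DifferentiableOn ℂ f (ball 0 R ×ˢ ball 0 R) := by
  obtain ⟨R, hR, h⟩ := Metric.nhds_basis_ball.mem_iff.1 hf.eventually_analyticAt
  refine ⟨R, hR, fun p hp => ?_⟩
  rw [ball_prod_same] at hp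
  exact (h hp).differentiableAt.differentiableWithinAt

theorem isOpen_ball_prod_ball (r s : ℝ) : IsOpen (ball (0 : ℂ) r ×ˢ ball (0 : ℂ) s) :=
  isOpen_ball.prod isOpen_ball

theorem ball_prod_ball_mem_nhds {r s : ℝ} (hr : 0 < r) (hs : 0 < s) :
    ball (0 : ℂ) r ×ˢ ball (0 : ℂ) s ∈ 𝓝 (0 : ℂ × ℂ) :=
  prod_mem_nhds (ball_mem_nhds 0 hr) (ball_mem_nhds 0 hs)

theorem DifferentiableOn.analyticAt_prod {U : Set (ℂ × ℂ)} (hU : IsOpen U) {f : ℂ × ℂ → ℂ}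
    (hf : DifferentiableOn ℂ f U) {p : ℂ × ℂ} (hp : p ∈ U) : AnalyticAt ℂ f p :=
  hf.analyticOnNhd_prod hU p hp

theorem AnalyticAt.exists_eq_fst_mul {f : ℂ × ℂ → ℂ} (hf : AnalyticAt ℂ f 0)
    (h0 : ∀ᶠ y in 𝓝 (0 : ℂ), f (0, y) = 0) :
    ∃ g : ℂ × ℂ → ℂ, AnalyticAt ℂ g 0 ∧ ∀ᶠ p in 𝓝 (0 : ℂ × ℂ), f p = p.1 * g p := by
  obtain ⟨R, hR, hd⟩ := hf.exists_ball_prod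
  obtain ⟨r, hr, h0⟩ := Metric.nhds_basis_ball.mem_iff.1 (inter_mem h0 (ball_mem_nhds 0 hR))
  obtain ⟨g, hg, he⟩ := exists_div_fst hR (isOpen_ball : IsOpen (ball (0 : ℂ) r))
    (hd.mono (prod_mono (Subset.refl _) (h0.trans inter_subset_right))) fun y hy => (h0 hy).1
  refine ⟨g, hg.analyticAt_prod (isOpen_ball_prod_ball _ _) (mem_of_mem_nhds
    (ball_prod_ball_mem_nhds hR hr)), ?_⟩
  filter_upwards [ball_prod_ball_mem_nhds hR hr] with p hp using he p.1 p.2 hp.2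

theorem AnalyticAt.exists_lipschitz {f : ℂ × ℂ → ℂ} (hf : AnalyticAt ℂ f 0) :
    ∃ R > 0, ∃ K ≥ 0, (∀ x ∈ ball (0 : ℂ) R, ∀ y ∈ ball (0 : ℂ) R, ‖f (x, y)‖ ≤ K) ∧
      ∀ x ∈ ball (0 : ℂ) R, ∀ y ∈ ball (0 : ℂ) R, ∀ y' ∈ ball (0 : ℂ) R,
        ‖f (x, y) - f (x, y')‖ ≤ K * ‖y - y'‖ := by
  obtain ⟨K, t, ht, hK⟩ := (hf.contDiffAt (n := 1)).exists_lipschitzOnWith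
  have hb : ∀ᶠ p in 𝓝 (0 : ℂ × ℂ), ‖f p‖ < ‖f 0‖ + 1 :=
    hf.continuousAt.norm.eventually_lt_const (lt_add_one _)
  obtain ⟨R, hR, h⟩ := Metric.nhds_basis_ball.mem_iff.1 (inter_mem ht hb)
  have h' : ∀ x ∈ ball (0 : ℂ) R, ∀ y ∈ ball (0 : ℂ) R, (x, y) ∈ ball (0 : ℂ × ℂ) R :=
    fun x hx y hy => by
      have : (x, y) ∈ ball (0 : ℂ) R ×ˢ ball (0 : ℂ) R := ⟨hx, hy⟩
      rwa [ball_prod_same] at this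
  refine ⟨R, hR, max K (‖f 0‖ + 1), le_max_of_le_left K.2, fun x hx y hy => ?_,
    fun x hx y hy y' hy' => ?_⟩
  · exact (h (h' x hx y hy)).2.le.trans (le_max_right _ _)
  · have := hK.norm_sub_le (h (h' x hx y hy)).1 (h (h' x hx y' hy')).1
    refine this.trans (mul_le_mul (le_max_left _ _) ?_ (norm_nonneg _) (le_max_of_le_left K.2))
    simp [Prod.norm_def]

/-- `w(x) = x ∫₀¹ t^κ g(t x) dt` solves `x w' + κ w = x g`. -/
theorem hasDerivAt_power_integral {r κ : ℝ} (hκ : 0 < κ) {g : ℂ → ℂ}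
    (hg : DifferentiableOn ℂ g (ball 0 r)) {w : ℂ → ℂ} (hw : DifferentiableOn ℂ w (ball 0 r))
    (hwg : ∀ x ∈ ball (0 : ℂ) r, w x = x * ∫ t in (0:ℝ)..1, ((t ^ κ : ℝ) : ℂ) * g (t * x)) {x : ℂ}
    (hx : x ∈ ball (0 : ℂ) r) : x * deriv w x + κ * w x = x * g x := by
  have hmem : ∀ t : ℝ, t ∈ Icc (0:ℝ) 1 → (t : ℂ) * x ∈ ball (0 : ℂ) r := fun t ht => by
    rw [mem_ball_zero_iff] at hx ⊢
    rw [norm_mul, Complex.norm_real, Real.norm_eq_abs, abs_of_nonneg ht.1]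
    exact (mul_le_of_le_one_left (norm_nonneg _) ht.2).trans_lt hx
  have hopen : IsOpen {t : ℝ | (t : ℂ) * x ∈ ball (0 : ℂ) r} := isOpen_ball.preimage (by fun_prop)
  have hone : (1 : ℝ) ∈ {t : ℝ | (t : ℂ) * x ∈ ball (0 : ℂ) r} := by simpa using hx
  have hcont : ContinuousOn (fun t : ℝ => ((t ^ κ : ℝ) : ℂ) * g (t * x))
      {t : ℝ | (t : ℂ) * x ∈ ball (0 : ℂ) r} := by
    refine ContinuousOn.mul (Continuous.continuousOn ?_) ?_
    · exact Complex.continuous_ofReal.comp (Real.continuous_rpow_const hκ.le)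
    · exact ContinuousOn.comp (f := fun t : ℝ => (t : ℂ) * x) hg.continuousOn (by fun_prop)
        fun t ht => ht
  have h1 : HasDerivAt (fun s : ℝ => x * ∫ t in (0:ℝ)..s, ((t ^ κ : ℝ) : ℂ) * g (t * x))
      (x * (((1 ^ κ : ℝ) : ℂ) * g ((1:ℝ) * x))) 1 :=
    (intervalIntegral.integral_hasDerivAt_right
      ((hcont.mono fun t ht => hmem t ht).intervalIntegrable_of_Icc zero_le_one)
      (hcont.stronglyMeasurableAtFilter hopen 1 hone)
      (hcont.continuousAt (hopen.mem_nhds hone))).const_mul x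
  have h2 : HasDerivAt (fun s : ℝ => ((s ^ κ : ℝ) : ℂ) * w (s * x))
      (((κ * 1 ^ (κ - 1) : ℝ) : ℂ) * w ((1:ℝ) * x) + ((1 ^ κ : ℝ) : ℂ) * (deriv w x * x)) 1 := by
    refine HasDerivAt.mul (Real.hasDerivAt_rpow_const (Or.inl one_ne_zero)).ofReal_comp ?_
    have h3 : HasDerivAt (fun s : ℝ => (s : ℂ) * x) x 1 := by
      simpa using (hasDerivAt_id (1:ℝ)).ofReal_comp.mul_const x
    have h4 : HasDerivAt w (deriv w x) (((1:ℝ) : ℂ) * x) := by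
      rw [Complex.ofReal_one, one_mul]
      exact (hw.differentiableAt (isOpen_ball.mem_nhds hx)).hasDerivAt
    exact HasDerivAt.comp (h := fun s : ℝ => (s : ℂ) * x) (1:ℝ) h4 h3
  have h5 : (fun s : ℝ => ((s ^ κ : ℝ) : ℂ) * w (s * x)) =ᶠ[𝓝 1]
      fun s : ℝ => x * ∫ t in (0:ℝ)..s, ((t ^ κ : ℝ) : ℂ) * g (t * x) := by
    filter_upwards [hopen.mem_nhds hone, lt_mem_nhds zero_lt_one] with s hs hs0
    rw [hwg _ hs]
    have := intervalIntegral.smul_integral_comp_mul_left (a := 0) (b := 1)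
      (fun t : ℝ => ((t ^ κ : ℝ) : ℂ) * g (t * x)) s
    rw [mul_zero, mul_one] at this
    rw [← this, Complex.real_smul]
    have : ∫ t in (0:ℝ)..1, (((s * t) ^ κ : ℝ) : ℂ) * g ((s * t : ℝ) * x) =
        ((s ^ κ : ℝ) : ℂ) * ∫ t in (0:ℝ)..1, ((t ^ κ : ℝ) : ℂ) * g (t * (s * x)) := by
      rw [← intervalIntegral.integral_const_mul]
      refine intervalIntegral.integral_congr fun t ht => ?_
      rw [uIcc_of_le zero_le_one] at ht
      simp only [Real.mul_rpow hs0.le ht.1, Complex.ofReal_mul]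
      rw [show (s : ℂ) * t * x = t * (s * x) by ring]
      ring
    rw [this]
    ring
  have := (h1.congr_of_eventuallyEq h5).unique h2
  simp only [Real.one_rpow, Complex.ofReal_one, one_mul, mul_one] at this
  rw [this]
  ring

/-- A solution of the Briot–Bouquet type equation `x w' + κ w = x S(x, w)`. -/
theorem exists_briotBouquet {κ : ℝ} (hκ : 0 < κ) {S : ℂ × ℂ → ℂ} (hS : AnalyticAt ℂ S 0) :
    ∃ w : ℂ → ℂ, AnalyticAt ℂ w 0 ∧ w 0 = 0 ∧
      ∀ᶠ x in 𝓝 (0 : ℂ), x * deriv w x + κ * w x = x * S (x, w x) := by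
  obtain ⟨R₁, hR₁, hSd⟩ := hS.exists_ball_prod
  obtain ⟨R₂, hR₂, K, hK, hSb, hSl⟩ := hS.exists_lipschitz
  obtain ⟨ρ, hρ, hρ1, hρ2⟩ : ∃ ρ > 0, ρ ≤ R₁ ∧ ρ ≤ R₂ :=
    ⟨min R₁ R₂, lt_min hR₁ hR₂, min_le_left _ _, min_le_right _ _⟩
  obtain ⟨r, hr, hrρ, hrK⟩ : ∃ r > 0, r ≤ ρ ∧ r * K ≤ min (ρ / 2) (1 / 2) := by
    have hm : 0 < min (ρ / 2) (1 / 2) := lt_min (by linarith) (by norm_num)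
    refine ⟨min ρ (min (ρ / 2) (1 / 2) / (K + 1)), lt_min hρ (by positivity), min_le_left _ _, ?_⟩
    calc _ ≤ min (ρ / 2) (1 / 2) / (K + 1) * K := mul_le_mul_of_nonneg_right (min_le_right _ _) hK
      _ ≤ _ := by
        rw [div_mul_eq_mul_div, div_le_iff₀ (by positivity)]
        exact mul_le_mul_of_nonneg_left (by linarith) hm.le
  have hsc : ∀ x ∈ ball (0 : ℂ) r, ∀ t ∈ Icc (0:ℝ) 1, (t : ℂ) * x ∈ ball (0 : ℂ) r :=
    fun x hx t ht => by
      rw [mem_ball_zero_iff] at hx ⊢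
      rw [norm_mul, Complex.norm_real, Real.norm_eq_abs, abs_of_nonneg ht.1]
      exact (mul_le_of_le_one_left (norm_nonneg _) ht.2).trans_lt hx
  have hb : ∀ w : ℂ → ℂ, (∀ x ∈ ball (0 : ℂ) r, ‖w x‖ ≤ ρ / 2) → ∀ x ∈ ball (0 : ℂ) r,
      w x ∈ ball (0 : ℂ) ρ := fun w hw x hx => by
    rw [mem_ball_zero_iff]
    linarith [hw x hx]
  have hcomp : ∀ w : ℂ → ℂ, DifferentiableOn ℂ w (ball 0 r) →
      (∀ x ∈ ball (0 : ℂ) r, ‖w x‖ ≤ ρ / 2) →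
      DifferentiableOn ℂ (fun x => S (x, w x)) (ball 0 r) := fun w hw hwb =>
    DifferentiableOn.comp (f := fun x => (x, w x)) hSd (differentiableOn_id.prodMk hw)
      fun x hx => ⟨ball_subset_ball (hrρ.trans hρ1) hx, ball_subset_ball hρ1 (hb w hwb x hx)⟩
  let G : (ℂ → ℂ) → ℂ → ℂ := fun w x =>
    x * ∫ t in (0:ℝ)..1, ((t ^ κ : ℝ) : ℂ) * S (t * x, w (t * x))
  have hpow : ∀ t ∈ Icc (0:ℝ) 1, ‖((t ^ κ : ℝ) : ℂ)‖ ≤ 1 := fun t ht => by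
    rw [Complex.norm_real, Real.norm_eq_abs, abs_of_nonneg (Real.rpow_nonneg ht.1 _)]
    exact Real.rpow_le_one ht.1 ht.2 hκ.le
  have hcontF : ∀ w : ℂ → ℂ, DifferentiableOn ℂ w (ball 0 r) →
      (∀ x ∈ ball (0 : ℂ) r, ‖w x‖ ≤ ρ / 2) →
      ContinuousOn (fun q : ℂ × ℝ => ((q.2 ^ κ : ℝ) : ℂ) * S (q.2 * q.1, w (q.2 * q.1)))
        (ball 0 r ×ˢ Icc 0 1) := by
    intro w hw hwb
    refine ContinuousOn.mul (Continuous.continuousOn ?_) ?_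
    · exact Complex.continuous_ofReal.comp ((Real.continuous_rpow_const hκ.le).comp continuous_snd)
    · exact ContinuousOn.comp (f := fun q : ℂ × ℝ => (q.2 : ℂ) * q.1) (hcomp w hw hwb).continuousOn
        (by fun_prop) fun q hq => hsc _ hq.1 _ hq.2
  have hii : ∀ w : ℂ → ℂ, DifferentiableOn ℂ w (ball 0 r) →
      (∀ x ∈ ball (0 : ℂ) r, ‖w x‖ ≤ ρ / 2) → ∀ x ∈ ball (0 : ℂ) r, IntervalIntegrable
      (fun t : ℝ => ((t ^ κ : ℝ) : ℂ) * S (t * x, w (t * x))) volume 0 1 := by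
    intro w hw hwb x hx
    refine ContinuousOn.intervalIntegrable_of_Icc zero_le_one ?_
    exact ContinuousOn.comp (f := fun t : ℝ => (x, t)) (hcontF w hw hwb) (by fun_prop)
      fun t ht => ⟨hx, ht⟩
  have hdiff0 : ∀ w : ℂ → ℂ, DifferentiableOn ℂ w (ball 0 r) →
      (∀ x ∈ ball (0 : ℂ) r, ‖w x‖ ≤ ρ / 2) → DifferentiableOn ℂ (G w) (ball 0 r) := by
    intro w hw hwb
    refine differentiableOn_id.mul (differentiableOn_intervalIntegral isOpen_ball zero_le_one
      (hcontF w hw hwb) fun t ht => ?_)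
    refine DifferentiableOn.const_mul ?_ _
    exact DifferentiableOn.comp (f := fun x : ℂ => (t : ℂ) * x) (hcomp w hw hwb) (by fun_prop)
      fun x hx => hsc x hx t ht
  have hnorm : ∀ x ∈ ball (0 : ℂ) r, ‖x‖ ≤ r := fun x hx => (mem_ball_zero_iff.1 hx).le
  have hGb : ∀ w : ℂ → ℂ, (∀ x ∈ ball (0 : ℂ) r, ‖w x‖ ≤ ρ / 2) → ∀ x ∈ ball (0 : ℂ) r,
      ‖G w x‖ ≤ ρ / 2 := by
    intro w hwb x hx
    have : ‖∫ t in (0:ℝ)..1, ((t ^ κ : ℝ) : ℂ) * S (t * x, w (t * x))‖ ≤ K * |1 - 0| := by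
      refine intervalIntegral.norm_integral_le_of_norm_le_const fun t ht => ?_
      rw [uIoc_of_le zero_le_one] at ht
      have ht' := Ioc_subset_Icc_self ht
      have hm := hsc x hx t ht'
      rw [norm_mul]
      rw [← one_mul K]
      exact mul_le_mul (hpow t ht') (hSb _ (ball_subset_ball (hrρ.trans hρ2) hm) _
        (ball_subset_ball hρ2 (hb w hwb _ hm)))
        (norm_nonneg _) zero_le_one
    rw [sub_zero, abs_one, mul_one] at this
    calc ‖G w x‖ = ‖x‖ * ‖∫ t in (0:ℝ)..1, ((t ^ κ : ℝ) : ℂ) * S (t * x, w (t * x))‖ := norm_mul _ _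
      _ ≤ r * K := mul_le_mul (hnorm x hx) this (norm_nonneg _) hr.le
      _ ≤ ρ / 2 := hrK.trans (min_le_left _ _)
  have hGl : ∀ w : ℂ → ℂ, DifferentiableOn ℂ w (ball 0 r) → ∀ w' : ℂ → ℂ,
      DifferentiableOn ℂ w' (ball 0 r) → (∀ x ∈ ball (0 : ℂ) r, ‖w x‖ ≤ ρ / 2) →
      (∀ x ∈ ball (0 : ℂ) r, ‖w' x‖ ≤ ρ / 2) → ∀ d : ℝ,
      (∀ x ∈ ball (0 : ℂ) r, ‖w x - w' x‖ ≤ d) → ∀ x ∈ ball (0 : ℂ) r, ‖G w x - G w' x‖ ≤ d / 2 := by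
    intro w hw w' hw' hwb hwb' d hd x hx
    have hGG : G w x - G w' x = x * ∫ t in (0:ℝ)..1, (((t ^ κ : ℝ) : ℂ) * S (t * x, w (t * x)) -
        ((t ^ κ : ℝ) : ℂ) * S (t * x, w' (t * x))) := by
      rw [intervalIntegral.integral_sub (hii w hw hwb x hx) (hii w' hw' hwb' x hx)]
      simp only [G]
      ring
    have : ‖∫ t in (0:ℝ)..1, (((t ^ κ : ℝ) : ℂ) * S (t * x, w (t * x)) -
        ((t ^ κ : ℝ) : ℂ) * S (t * x, w' (t * x)))‖ ≤ (K * d) * |1 - 0| := by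
      refine intervalIntegral.norm_integral_le_of_norm_le_const fun t ht => ?_
      rw [uIoc_of_le zero_le_one] at ht
      have ht' := Ioc_subset_Icc_self ht
      have hm := hsc x hx t ht'
      rw [← mul_sub, norm_mul]
      calc _ ≤ 1 * (K * ‖w (t * x) - w' (t * x)‖) := mul_le_mul (hpow t ht')
            (hSl _ (ball_subset_ball (hrρ.trans hρ2) hm) _ (ball_subset_ball hρ2 (hb w hwb _ hm)) _
              (ball_subset_ball hρ2 (hb w' hwb' _ hm))) (norm_nonneg _) zero_le_one
        _ ≤ K * d := by
          rw [one_mul]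
          exact mul_le_mul_of_nonneg_left (hd _ hm) hK
    rw [sub_zero, abs_one, mul_one] at this
    have hd0 : 0 ≤ d := (norm_nonneg _).trans (hd x hx)
    calc ‖G w x - G w' x‖ ≤ r * (K * d) := by
          rw [hGG, norm_mul]
          exact mul_le_mul (hnorm x hx) this (norm_nonneg _) hr.le
      _ = r * K * d := by ring
      _ ≤ 1 / 2 * d := mul_le_mul_of_nonneg_right (hrK.trans (min_le_right _ _)) hd0
      _ = d / 2 := by ring
  obtain ⟨w, hw, hwb, hfix⟩ := exists_fixedPoint_of_half_lipschitz (Ω := ball (0 : ℂ) r)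
    (H := {w | DifferentiableOn ℂ w (ball 0 r)}) (M := ρ / 2) (G := G) (differentiableOn_const 0)
    (fun F f hF hFf => hFf.tendstoLocallyUniformlyOn.differentiableOn (Eventually.of_forall hF)
      isOpen_ball) (by linarith) (fun w hw hwb => ⟨hdiff0 w hw hwb, hGb w hwb⟩) hGl
  refine ⟨w, hw.analyticAt (ball_mem_nhds 0 hr), ?_, ?_⟩
  · rw [← hfix 0 (mem_ball_self hr)]
    simp [G]
  · filter_upwards [ball_mem_nhds 0 hr] with x hx
    exact hasDerivAt_power_integral hκ (hcomp w hw hwb) hw (fun x hx => (hfix x hx).symm) hx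

theorem AnalyticAt.exists_blowup {F : ℂ × ℂ → ℂ} (hF : AnalyticAt ℂ F 0) (hF0 : F 0 = 0) :
    ∃ G : ℂ × ℂ → ℂ, AnalyticAt ℂ G 0 ∧ (∀ᶠ p in 𝓝 (0 : ℂ × ℂ), F (p.1, p.1 * p.2) = p.1 * G p) ∧
      ∀ᶠ w in 𝓝 (0 : ℂ), G (0, w) = fderiv ℂ F 0 (1, w) := by
  have hb : AnalyticAt ℂ (fun p : ℂ × ℂ => (p.1, p.1 * p.2)) 0 :=
    analyticAt_fst.prod (analyticAt_fst.mul analyticAt_snd)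
  have hFb : AnalyticAt ℂ (fun p : ℂ × ℂ => F (p.1, p.1 * p.2)) 0 :=
    AnalyticAt.fun_comp (f := fun p : ℂ × ℂ => (p.1, p.1 * p.2)) (by simpa [Prod.mk_zero_zero] using hF) hb
  obtain ⟨G, hG, he⟩ := hFb.exists_eq_fst_mul (Eventually.of_forall fun y => by
    simpa [Prod.mk_zero_zero] using hF0)
  refine ⟨G, hG, he, ?_⟩
  have hG' := hG.eventually_analyticAt
  have hp : Tendsto (fun w : ℂ => ((0 : ℂ), w)) (𝓝 0) (𝓝 0) :=
    (by fun_prop : Continuous fun w : ℂ => ((0 : ℂ), w)).tendsto' _ _ rfl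
  filter_upwards [hp.eventually he.eventually_nhds, hp.eventually hG'] with w h1 h2
  have hx : Tendsto (fun x : ℂ => (x, w)) (𝓝 0) (𝓝 (0, w)) :=
    (by fun_prop : Continuous fun x : ℂ => (x, w)).tendsto' _ _ rfl
  have hl : HasDerivAt (fun x : ℂ => (x, x * w)) ((1 : ℂ), w) 0 := by
    simpa using (hasDerivAt_id (0 : ℂ)).prodMk ((hasDerivAt_id (0 : ℂ)).mul_const w)
  have hd1 : HasDerivAt (fun x => F (x, x * w)) (fderiv ℂ F 0 (1, w)) 0 := by
    refine HasFDerivAt.comp_hasDerivAt (f := fun x : ℂ => (x, x * w)) (0 : ℂ) ?_ hl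
    rw [zero_mul]
    exact hF.differentiableAt.hasFDerivAt
  have hGd : DifferentiableAt ℂ (fun x => G (x, w)) 0 :=
    DifferentiableAt.comp (f := fun x : ℂ => (x, w)) (0 : ℂ) h2.differentiableAt (by fun_prop)
  have hd2 : HasDerivAt (fun x => F (x, x * w)) (1 * G (0, w) + 0 * deriv (fun x => G (x, w)) 0) 0 := by
    refine ((hasDerivAt_id (0 : ℂ)).fun_mul hGd.hasDerivAt).congr_of_eventuallyEq ?_
    filter_upwards [hx.eventually h1] with x hx
    exact hx
  simpa using hd2.unique hd1

theorem exists_separatrix {P Q : ℂ × ℂ → ℂ} (hP : AnalyticAt ℂ P 0) (hQ : AnalyticAt ℂ Q 0)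
    (hP0 : P 0 = 0) (hQ0 : Q 0 = 0) {a : ℂ} (ha : a ≠ 0) {κ : ℝ} (hκ : 0 < κ)
    (hPd : ∀ v, fderiv ℂ P 0 v = a * v.1) (hQd : ∀ v, fderiv ℂ Q 0 v = -(κ * a) * v.2) :
    ∃ σ : ℂ → ℂ, AnalyticAt ℂ σ 0 ∧ σ 0 = 0 ∧ deriv σ 0 = 0 ∧
      ∀ᶠ x in 𝓝 (0 : ℂ), Q (x, σ x) = deriv σ x * P (x, σ x) := by
  obtain ⟨p, hp, hpe, hp0⟩ := hP.exists_blowup hP0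
  obtain ⟨q, hq, hqe, hq0⟩ := hQ.exists_blowup hQ0
  have hpa : p 0 ≠ 0 := by
    have := hp0.self_of_nhds
    rw [hPd] at this
    rw [← Prod.mk_zero_zero, this]
    simpa using ha
  have hS : AnalyticAt ℂ (fun z : ℂ × ℂ => q z / p z + κ * z.2) 0 :=
    (hq.div hp hpa).add (analyticAt_const.mul analyticAt_snd)
  obtain ⟨S, hS, hSe⟩ := hS.exists_eq_fst_mul (by
    filter_upwards [hp0, hq0] with w h1 h2
    rw [h1, h2, hPd, hQd]
    field_simp
    ring)
  have hκ1 : 0 < κ + 1 := by linarith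
  obtain ⟨w, hw, hw0, hwe⟩ := exists_briotBouquet hκ1 hS
  have ht : Tendsto (fun x => (x, w x)) (𝓝 0) (𝓝 (0 : ℂ × ℂ)) := by
    have := (continuousAt_id (x := (0 : ℂ))).prodMk hw.continuousAt
    have h := this.tendsto
    rwa [hw0] at h
  have hd : ∀ᶠ x in 𝓝 (0 : ℂ), HasDerivAt (fun x => x * w x) (w x + x * deriv w x) x := by
    filter_upwards [hw.eventually_analyticAt] with x hx
    simpa using (hasDerivAt_id x).fun_mul hx.differentiableAt.hasDerivAt
  refine ⟨fun x => x * w x, analyticAt_id.mul hw, by simp, ?_, ?_⟩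
  · rw [hd.self_of_nhds.deriv, hw0]
    simp
  · filter_upwards [hd, hwe, ht.eventually hpe, ht.eventually hqe, ht.eventually hSe,
      ht.eventually (hp.continuousAt.eventually_ne hpa)] with x h1 h2 h3 h4 h5 h6
    rw [h1.deriv, h3, h4]
    rw [← h5] at h2
    push_cast at h2
    have h7 : q (x, w x) = (w x + x * deriv w x) * p (x, w x) := by
      rw [← div_eq_iff h6]
      linear_combination -h2
    rw [h7]
    ring

theorem exists_diagonal {X : ℂ × ℂ → ℂ × ℂ} (hX : AnalyticAt ℂ X 0) (hX0 : X 0 = 0) {l₁ l₂ : ℂ}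
    (hne : l₁ ≠ l₂) (hdet : LinearMap.det ((fderiv ℂ X 0).toLinearMap) = l₁ * l₂)
    (htr : LinearMap.trace ℂ (ℂ × ℂ) ((fderiv ℂ X 0).toLinearMap) = l₁ + l₂) :
    ∃ Y : ℂ × ℂ → ℂ × ℂ, AnalyticAt ℂ Y 0 ∧ FoliationEquiv X Y ∧ Y 0 = 0 ∧
      ∀ v, fderiv ℂ Y 0 v = (l₁ * v.1, l₂ * v.2) := by
  set L := fderiv ℂ X 0 with hL
  rw [ContinuousLinearMap.det_prod_eq] at hdet
  rw [ContinuousLinearMap.trace_prod_eq] at htr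
  have heig : ∀ l : ℂ, (l - l₁) * (l - l₂) = 0 → ∃ v ≠ 0, L v = l • v := by
    intro l hl
    have h0 : LinearMap.det (L - l • ContinuousLinearMap.id ℂ (ℂ × ℂ)).toLinearMap = 0 := by
      rw [ContinuousLinearMap.det_prod_eq]
      simp
      linear_combination hdet - l * htr + hl
    obtain ⟨v, hv, hv0⟩ := Submodule.exists_mem_ne_zero_of_ne_bot
      (LinearMap.bot_lt_ker_of_det_eq_zero h0).ne'
    refine ⟨v, hv0, ?_⟩
    rw [LinearMap.mem_ker] at hv
    simpa [sub_eq_zero] using hv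
  obtain ⟨v₁, hv₁, he₁⟩ := heig l₁ (by ring)
  obtain ⟨v₂, hv₂, he₂⟩ := heig l₂ (by ring)
  let T : ℂ × ℂ →L[ℂ] ℂ × ℂ := (ContinuousLinearMap.fst ℂ ℂ ℂ).smulRight v₁ +
    (ContinuousLinearMap.snd ℂ ℂ ℂ).smulRight v₂
  have hT : ∀ w, T w = w.1 • v₁ + w.2 • v₂ := fun w => rfl
  have hTdet : LinearMap.det T.toLinearMap ≠ 0 := by
    intro h
    obtain ⟨w, hw, hw0⟩ := Submodule.exists_mem_ne_zero_of_ne_bot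
      (LinearMap.bot_lt_ker_of_det_eq_zero h).ne'
    have hw' : w.1 • v₁ + w.2 • v₂ = 0 := hw
    have h2 := congrArg L hw'
    rw [map_add, map_smul, map_smul, he₁, he₂, map_zero] at h2
    have h3 : (w.2 * (l₂ - l₁)) • v₂ = 0 := by
      calc (w.2 * (l₂ - l₁)) • v₂ = (w.1 • l₁ • v₁ + w.2 • l₂ • v₂) - l₁ • (w.1 • v₁ + w.2 • v₂) := by
            module
        _ = 0 := by rw [h2, hw', smul_zero, sub_zero]
    have h4 : w.2 = 0 := by
      simpa [hv₂, sub_eq_zero, hne.symm] using h3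
    have h5 : w.1 = 0 := by
      simpa [h4, hv₁] using hw'
    exact hw0 (Prod.ext h5 h4)
  have hTf : ∀ p, fderiv ℂ T p = T := fun p => T.fderiv
  obtain ⟨Y, hY, hXY, he⟩ := exists_pullback hX (T.analyticAt 0) (map_zero T) (by rwa [hTf])
  have hinj : Function.Injective T := by
    have := he.self_of_nhds.1
    rwa [hTf] at this
  have he' : ∀ᶠ p in 𝓝 (0 : ℂ × ℂ), T (Y p) = X (T p) := by
    filter_upwards [he] with p hp
    have := hp.2
    rwa [hTf] at this
  refine ⟨Y, hY, hXY, ?_, fun v => ?_⟩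
  · refine hinj ?_
    rw [he'.self_of_nhds, map_zero, hX0]
  · have h1 : HasFDerivAt (fun p => T (Y p)) (T.comp (fderiv ℂ Y 0)) 0 :=
      T.hasFDerivAt.comp 0 hY.differentiableAt.hasFDerivAt
    have h2 : HasFDerivAt (fun p => X (T p)) (L.comp T) 0 := by
      refine HasFDerivAt.comp (f := T) 0 ?_ T.hasFDerivAt
      rw [map_zero]
      exact hX.differentiableAt.hasFDerivAt
    have h3 := DFunLike.congr_fun (h1.unique (h2.congr_of_eventuallyEq he')) v
    refine hinj ?_
    rw [ContinuousLinearMap.comp_apply, ContinuousLinearMap.comp_apply] at h3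
    rw [h3, hT, hT, map_add, map_smul, map_smul, he₁, he₂, smul_smul, smul_smul, mul_comm v.1,
      mul_comm v.2]

theorem exists_axes_invariant {X : ℂ × ℂ → ℂ × ℂ} (hX : AnalyticAt ℂ X 0) (hX0 : X 0 = 0) {l₁ : ℂ}
    {μ : ℝ} (hμ : 0 < μ) (hl₁ : l₁ ≠ 0)
    (hd : ∀ v, fderiv ℂ X 0 v = (l₁ * v.1, -(μ * l₁) * v.2)) :
    ∃ a b : ℂ × ℂ → ℂ, AnalyticAt ℂ a 0 ∧ AnalyticAt ℂ b 0 ∧ a 0 = l₁ ∧ b 0 = -(μ * l₁) ∧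
      FoliationEquiv X (fun p => (p.1 * a p, p.2 * b p)) := by
  have hμ' : (μ : ℂ) ≠ 0 := by exact_mod_cast hμ.ne'
  let P : ℂ × ℂ → ℂ := fun p => (X p).1
  let Q : ℂ × ℂ → ℂ := fun p => (X p).2
  have hP : AnalyticAt ℂ P 0 := analyticAt_fst.comp hX
  have hQ : AnalyticAt ℂ Q 0 := analyticAt_snd.comp hX
  have hP0 : P 0 = 0 := by simp [P, hX0]
  have hQ0 : Q 0 = 0 := by simp [Q, hX0]
  have hPd : HasFDerivAt P ((ContinuousLinearMap.fst ℂ ℂ ℂ).comp (fderiv ℂ X 0)) 0 :=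
    (ContinuousLinearMap.fst ℂ ℂ ℂ).hasFDerivAt.comp 0 hX.differentiableAt.hasFDerivAt
  have hQd : HasFDerivAt Q ((ContinuousLinearMap.snd ℂ ℂ ℂ).comp (fderiv ℂ X 0)) 0 :=
    (ContinuousLinearMap.snd ℂ ℂ ℂ).hasFDerivAt.comp 0 hX.differentiableAt.hasFDerivAt
  obtain ⟨σ, hσ, hσ0, hσd, hσe⟩ := exists_separatrix hP hQ hP0 hQ0 hl₁ hμ
    (fun v => by rw [hPd.fderiv]; simp [hd]) (fun v => by rw [hQd.fderiv]; simp [hd])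
  -- the second separatrix, after exchanging the coordinates
  let sw : ℂ × ℂ →L[ℂ] ℂ × ℂ :=
    (ContinuousLinearMap.snd ℂ ℂ ℂ).prod (ContinuousLinearMap.fst ℂ ℂ ℂ)
  have hsw : ∀ {F : ℂ × ℂ → ℂ} {F' : ℂ × ℂ →L[ℂ] ℂ}, HasFDerivAt F F' 0 →
      HasFDerivAt (fun p => F (sw p)) (F'.comp sw) 0 := fun hF =>
    HasFDerivAt.comp (f := sw) 0 (by rwa [map_zero]) sw.hasFDerivAt
  have hswa : ∀ {F : ℂ × ℂ → ℂ}, AnalyticAt ℂ F 0 → AnalyticAt ℂ (fun p => F (sw p)) 0 :=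
    fun hF => AnalyticAt.fun_comp (f := sw) (by rwa [map_zero]) (sw.analyticAt 0)
  obtain ⟨τ, hτ, hτ0, hτd, hτe⟩ := exists_separatrix (hswa hQ) (hswa hP) (by simpa using hQ0)
    (by simpa using hP0) (a := -(μ * l₁)) (by simp [hμ', hl₁]) (inv_pos.2 hμ)
    (fun v => by rw [(hsw hQd).fderiv]; simp [hd, sw]) (fun v => by
      rw [(hsw hPd).fderiv]
      simp [hd, sw, hμ'])
  have hτe' : ∀ᶠ y in 𝓝 (0 : ℂ), P (τ y, y) = deriv τ y * Q (τ y, y) := hτe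
  let Φ : ℂ × ℂ → ℂ × ℂ := fun p => (p.1 + τ p.2, p.2 + σ p.1)
  have hτs : AnalyticAt ℂ (fun p : ℂ × ℂ => τ p.2) 0 :=
    AnalyticAt.fun_comp (f := fun p : ℂ × ℂ => p.2) (x := (0 : ℂ × ℂ)) hτ analyticAt_snd
  have hσs : AnalyticAt ℂ (fun p : ℂ × ℂ => σ p.1) 0 :=
    AnalyticAt.fun_comp (f := fun p : ℂ × ℂ => p.1) (x := (0 : ℂ × ℂ)) hσ analyticAt_fst
  have hΦ : AnalyticAt ℂ Φ 0 := (analyticAt_fst.add hτs).prod (analyticAt_snd.add hσs)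
  have hΦ0 : Φ 0 = 0 := by simp [Φ, hτ0, hσ0]
  have hfd : ∀ x y : ℂ, DifferentiableAt ℂ σ x → DifferentiableAt ℂ τ y → ∀ v,
      fderiv ℂ Φ (x, y) v = (v.1 + v.2 * deriv τ y, v.2 + v.1 * deriv σ x) := by
    intro x y h1 h2 v
    have h3 : HasFDerivAt (fun p : ℂ × ℂ => τ p.2) _ (x, y) :=
      HasDerivAt.comp_hasFDerivAt (f := fun p : ℂ × ℂ => p.2) (x, y) h2.hasDerivAt
        (ContinuousLinearMap.snd ℂ ℂ ℂ).hasFDerivAt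
    have h4 : HasFDerivAt (fun p : ℂ × ℂ => σ p.1) _ (x, y) :=
      HasDerivAt.comp_hasFDerivAt (f := fun p : ℂ × ℂ => p.1) (x, y) h1.hasDerivAt
        (ContinuousLinearMap.fst ℂ ℂ ℂ).hasFDerivAt
    have h5 : HasFDerivAt Φ _ (x, y) :=
      ((ContinuousLinearMap.fst ℂ ℂ ℂ).hasFDerivAt.add h3).prodMk
        ((ContinuousLinearMap.snd ℂ ℂ ℂ).hasFDerivAt.add h4)
    rw [h5.fderiv]
    simp [mul_comm]
  have hfd0 : ∀ v, fderiv ℂ Φ 0 v = v := fun v => by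
    rw [← Prod.mk_zero_zero, hfd 0 0 hσ.differentiableAt hτ.differentiableAt, hτd, hσd]
    simp
  obtain ⟨Y, hY, hXY, he⟩ := exists_pullback hX hΦ hΦ0 (by
    rw [ContinuousLinearMap.det_prod_eq, hfd0, hfd0]; simp)
  have hx : Tendsto (fun x : ℂ => (x, (0 : ℂ))) (𝓝 0) (𝓝 0) :=
    (by fun_prop : Continuous fun x : ℂ => (x, (0 : ℂ))).tendsto' _ _ rfl
  have hy : Tendsto (fun y : ℂ => ((0 : ℂ), y)) (𝓝 0) (𝓝 0) :=
    (by fun_prop : Continuous fun y : ℂ => ((0 : ℂ), y)).tendsto' _ _ rfl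
  have hYx : ∀ᶠ x in 𝓝 (0 : ℂ), Y (x, 0) = (P (x, σ x), 0) := by
    filter_upwards [hx.eventually he, hσe, hσ.eventually_analyticAt] with x h1 h2 h3
    refine h1.1 ?_
    rw [h1.2, hfd x 0 h3.differentiableAt hτ.differentiableAt]
    simp only [Φ, hτ0, add_zero, zero_add, zero_mul]
    rw [mul_comm, ← h2]
  have hYy : ∀ᶠ y in 𝓝 (0 : ℂ), Y (0, y) = (0, Q (τ y, y)) := by
    filter_upwards [hy.eventually he, hτe', hτ.eventually_analyticAt] with y h1 h2 h3
    refine h1.1 ?_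
    rw [h1.2, hfd 0 y hσ.differentiableAt h3.differentiableAt]
    simp only [Φ, hσ0, add_zero, zero_add, zero_mul]
    rw [mul_comm, ← h2]
  have hY1 : AnalyticAt ℂ (fun p => (Y p).1) 0 := analyticAt_fst.comp hY
  have hY2 : AnalyticAt ℂ (fun p => (Y p).2) 0 := analyticAt_snd.comp hY
  obtain ⟨a, ha, hae⟩ := hY1.exists_eq_fst_mul (by filter_upwards [hYy] with y h; rw [h])
  obtain ⟨b, hb, hbe⟩ := (hswa hY2).exists_eq_fst_mul (by
    filter_upwards [hYx] with x h
    change (Y (x, 0)).2 = 0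
    rw [h])
  have hst : Tendsto sw (𝓝 0) (𝓝 0) := sw.continuous.tendsto' _ _ (map_zero sw)
  have hbe' : ∀ᶠ p in 𝓝 (0 : ℂ × ℂ), (Y p).2 = p.2 * b (sw p) := by
    filter_upwards [hst.eventually hbe] with p hp
    exact hp
  have key : ∀ {F : ℂ → ℂ} {G : ℂ × ℂ → ℂ} {c : ℂ}, AnalyticAt ℂ G 0 → HasDerivAt F c 0 →
      (∀ᶠ x in 𝓝 (0 : ℂ), F x = x * G (x, 0)) → G 0 = c := by
    intro F G c hG hF h
    have hGd : DifferentiableAt ℂ (fun x => G (x, (0 : ℂ))) 0 :=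
      DifferentiableAt.comp (f := fun x : ℂ => (x, (0 : ℂ))) (0 : ℂ) hG.differentiableAt (by fun_prop)
    have := ((hasDerivAt_id (0 : ℂ)).fun_mul hGd.hasDerivAt).unique (hF.congr_of_eventuallyEq
      (by filter_upwards [h] with x hx using hx.symm))
    simpa [Prod.mk_zero_zero] using this
  refine ⟨a, fun p => b (sw p), ha, hswa hb, ?_, ?_, ?_⟩
  · refine key (F := fun x => P (x, σ x)) ha ?_ ?_
    · have hl : HasDerivAt (fun x => (x, σ x)) ((1 : ℂ), (0 : ℂ)) 0 := by
        have := (hasDerivAt_id (0 : ℂ)).prodMk hσ.differentiableAt.hasDerivAt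
        rwa [hσd] at this
      have hP' : HasFDerivAt P ((ContinuousLinearMap.fst ℂ ℂ ℂ).comp (fderiv ℂ X 0)) (0, σ 0) := by
        rw [hσ0]; exact hPd
      have : HasDerivAt (fun x => P (x, σ x)) _ 0 :=
        HasFDerivAt.comp_hasDerivAt (f := fun x => (x, σ x)) (0 : ℂ) hP' hl
      simpa [hd] using this
    · filter_upwards [hYx, hx.eventually hae] with x h1 h2
      rw [← h2, h1]
  · simp only [map_zero]
    refine key (F := fun y => Q (τ y, y)) hb ?_ ?_
    · have hl : HasDerivAt (fun x => (τ x, x)) ((0 : ℂ), (1 : ℂ)) 0 := by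
        have := hτ.differentiableAt.hasDerivAt.prodMk (hasDerivAt_id (0 : ℂ))
        rwa [hτd] at this
      have hQ' : HasFDerivAt Q ((ContinuousLinearMap.snd ℂ ℂ ℂ).comp (fderiv ℂ X 0)) (τ 0, 0) := by
        rw [hτ0]; exact hQd
      have : HasDerivAt (fun x => Q (τ x, x)) _ 0 :=
        HasFDerivAt.comp_hasDerivAt (f := fun x => (τ x, x)) (0 : ℂ) hQ' hl
      simpa [hd] using this
    · filter_upwards [hYy, hy.eventually hbe'] with y h1 h2
      rw [h1] at h2
      exact h2
  · refine hXY.trans (FoliationEquiv.of_smul analyticAt_const one_ne_zero ?_)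
    filter_upwards [hae, hbe'] with p h1 h2
    rw [one_smul, ← h1, ← h2]

theorem exists_linear_on_axis {B : ℂ × ℂ → ℂ} (hB : AnalyticAt ℂ B 0) {μ : ℝ} (hμ : 0 < μ)
    (hB0 : B 0 = μ) {ε : ℝ} (hε : 0 < ε) :
    ∃ h : ℂ × ℂ → ℂ, DifferentiableOn ℂ h (ball 0 3 ×ˢ ball 0 1) ∧
      (∀ x ∈ ball (0 : ℂ) 3, h (x, 0) = 0) ∧
      (∀ x ∈ ball (0 : ℂ) 3, ∀ y ∈ ball (0 : ℂ) 1, ∀ y' ∈ ball (0 : ℂ) 1,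
        ‖h (x, y) - h (x, y')‖ ≤ ε * ‖y - y'‖) ∧
      FoliationEquiv (fun p => (-p.1, p.2 * B p)) (fun p => (-p.1, μ * (1 + h p) * p.2)) := by
  have hμ' : (μ : ℂ) ≠ 0 := by exact_mod_cast hμ.ne'
  obtain ⟨R₁, hR₁, hBd⟩ := hB.exists_ball_prod
  obtain ⟨R₂, hR₂, K, hK, -, hBl⟩ := hB.exists_lipschitz
  obtain ⟨R, hR, hRR₁, hRR₂⟩ : ∃ R > 0, R ≤ R₁ ∧ R ≤ R₂ :=
    ⟨min R₁ R₂, lt_min hR₁ hR₂, min_le_left _ _, min_le_right _ _⟩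
  let b : ℂ → ℂ := fun x => B (x, 0)
  have hb : DifferentiableOn ℂ b (ball 0 R) := (hBd.slice_fst 0).mono fun x hx =>
    ⟨ball_subset_ball hRR₁ hx, mem_ball_self hR₁⟩
  let m : ℂ → ℂ := dslope b 0
  have hm : DifferentiableOn ℂ m (ball 0 R) :=
    (Complex.differentiableOn_dslope (ball_mem_nhds 0 hR)).2 hb
  have hbm : ∀ x, B (x, 0) = μ + x * m x := fun x => by
    have h1 := sub_smul_dslope b 0 x
    have h2 : b 0 = μ := hB0
    rw [h2, smul_eq_mul, sub_zero] at h1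
    rw [h1]
    simp [b]
  let N : ℂ → ℂ := fun z => (z - 0) * ∫ t in (0:ℝ)..1, m (0 + t * (z - 0))
  have hN : ∀ z ∈ ball (0 : ℂ) R, HasDerivAt N (m z) z := fun z hz =>
    hasDerivAt_segment_integral isOpen_ball ((convex_ball 0 R).starConvex (mem_ball_self hR)) hm hz
  have hN0 : N 0 = 0 := by simp [N]
  obtain ⟨r, hr, hrR⟩ := Metric.nhds_basis_ball.mem_iff.1 (inter_mem
    ((hN 0 (mem_ball_self hR)).continuousAt.norm.eventually_lt_const (u := 1) (by simp [hN0]))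
    (ball_mem_nhds 0 hR))
  have hNr : ∀ z ∈ ball (0 : ℂ) r, z ∈ ball (0 : ℂ) R ∧ ‖Complex.exp (-N z)‖ ≤ 3 := fun z hz => by
    refine ⟨(hrR hz).2, ?_⟩
    have h1 : ‖N z‖ < 1 := (hrR hz).1
    have h2 : (-N z).re ≤ 1 := (Complex.re_le_norm _).trans (by rw [norm_neg]; exact h1.le)
    rw [Complex.norm_exp]
    exact (Real.exp_le_exp.2 h2).trans (by have := Real.exp_one_lt_d9; linarith)
  have hrR : ball (0 : ℂ) r ⊆ ball 0 R := fun z hz => (hNr z hz).1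
  obtain ⟨β, hβ, hβr, hβK⟩ : ∃ β : ℝ, 0 < β ∧ 3 / R ≤ β ∧ K * 3 / (β * μ) ≤ ε := by
    refine ⟨3 / R + K * 3 / (μ * ε), by positivity, le_add_of_nonneg_right (by positivity), ?_⟩
    rw [div_le_iff₀ (by positivity)]
    have : K * 3 / (μ * ε) * μ * ε = K * 3 := by field_simp
    have h2 : 0 < ε * (3 / R * μ) := by positivity
    nlinarith
  have hβ' : (β : ℂ) ≠ 0 := by exact_mod_cast hβ.ne'
  have hr' : (r : ℂ) ≠ 0 := by exact_mod_cast hr.ne'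
  let α : ℂ := 3 / r
  have hα : α ≠ 0 := by simp [α, hr']
  have hx : ∀ x ∈ ball (0 : ℂ) 3, x / α ∈ ball (0 : ℂ) r := fun x hx => by
    rw [mem_ball_zero_iff] at hx ⊢
    simp only [α, norm_div, Complex.norm_real, Complex.norm_ofNat, Real.norm_eq_abs, abs_of_pos hr]
    rw [div_div_eq_mul_div, div_lt_iff₀ (by norm_num)]
    nlinarith
  have hy : ∀ x ∈ ball (0 : ℂ) 3, ∀ y ∈ ball (0 : ℂ) 1,
      y / β * Complex.exp (-N (x / α)) ∈ ball (0 : ℂ) R := fun x hx' y hy => by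
    rw [mem_ball_zero_iff] at hy ⊢
    rw [norm_mul, norm_div, Complex.norm_real, Real.norm_eq_abs, abs_of_pos hβ]
    have h1 := (hNr _ (hx x hx')).2
    rw [div_le_iff₀ hR] at hβr
    calc ‖y‖ / β * ‖Complex.exp (-N (x / α))‖ ≤ ‖y‖ / β * 3 := by gcongr
      _ < R := by
        rw [div_mul_eq_mul_div, div_lt_iff₀ hβ]
        nlinarith
  have hd : DifferentiableOn ℂ N (ball 0 R) := fun z hz =>
    (hN z hz).differentiableAt.differentiableWithinAt
  have hdx : DifferentiableOn ℂ (fun p : ℂ × ℂ => N (p.1 / α)) (ball 0 3 ×ˢ ball 0 1) :=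
    DifferentiableOn.comp (f := fun p : ℂ × ℂ => p.1 / α) (t := ball 0 R) hd (by fun_prop)
      fun p hp => hrR (hx _ hp.1)
  refine ⟨fun p => (B (p.1 / α, p.2 / β * Complex.exp (-N (p.1 / α))) - B (p.1 / α, 0)) / μ,
    ?_, ?_, ?_, ?_⟩
  · simp only [div_eq_mul_inv (b := (μ : ℂ))]
    refine DifferentiableOn.mul_const (DifferentiableOn.fun_sub ?_ ?_) _
    · refine DifferentiableOn.comp (f := fun p : ℂ × ℂ => (p.1 / α, p.2 / β * Complex.exp (-N (p.1 / α))))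
        (t := ball 0 R₁ ×ˢ ball 0 R₁) hBd ?_ fun p hp =>
        ⟨ball_subset_ball hRR₁ (hrR (hx _ hp.1)), ball_subset_ball hRR₁ (hy _ hp.1 _ hp.2)⟩
      have hf : DifferentiableOn ℂ (fun p : ℂ × ℂ => p.1 / α) (ball 0 3 ×ˢ ball 0 1) := by fun_prop
      have hs : DifferentiableOn ℂ (fun p : ℂ × ℂ => p.2 / β) (ball 0 3 ×ˢ ball 0 1) := by fun_prop
      exact hf.prodMk (hs.mul hdx.neg.cexp)
    · exact DifferentiableOn.comp (f := fun p : ℂ × ℂ => (p.1 / α, (0 : ℂ)))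
        (t := ball 0 R₁ ×ˢ ball 0 R₁) hBd (by fun_prop) fun p hp =>
        ⟨ball_subset_ball hRR₁ (hrR (hx _ hp.1)), mem_ball_self hR₁⟩
  · intro x _
    simp
  · intro x hx' y hy₁ y' hy₂
    have h1 := hBl _ (ball_subset_ball hRR₂ (hrR (hx x hx'))) _
      (ball_subset_ball hRR₂ (hy x hx' y hy₁)) _ (ball_subset_ball hRR₂ (hy x hx' y' hy₂))
    rw [← sub_div, norm_div, Complex.norm_real, Real.norm_eq_abs, abs_of_pos hμ, sub_sub_sub_cancel_right,
      div_le_iff₀ hμ]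
    refine h1.trans ?_
    rw [← sub_mul, ← sub_div, norm_mul, norm_div, Complex.norm_real, Real.norm_eq_abs, abs_of_pos hβ]
    rw [div_le_iff₀ (by positivity)] at hβK
    calc K * (‖y - y'‖ / β * ‖Complex.exp (-N (x / α))‖) ≤ K * (‖y - y'‖ / β * 3) := by
          gcongr; exact (hNr _ (hx x hx')).2
      _ = K * 3 * (‖y - y'‖ / β) := by ring
      _ ≤ ε * (β * μ) * (‖y - y'‖ / β) := by gcongr
      _ = ε * ‖y - y'‖ * μ := by field_simp
  · have hU : AnalyticAt ℂ (fun p : ℂ × ℂ => (β : ℂ) * Complex.exp (N p.1)) 0 := by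
      have : DifferentiableOn ℂ (fun p : ℂ × ℂ => N p.1) (ball 0 R ×ˢ ball 0 R) :=
        DifferentiableOn.comp (f := fun p : ℂ × ℂ => p.1) hd (by fun_prop) fun p hp => hp.1
      refine DifferentiableOn.analyticAt_prod (isOpen_ball_prod_ball R R) ?_
        (mem_of_mem_nhds (ball_prod_ball_mem_nhds hR hR))
      exact this.cexp.const_mul _
    refine FoliationEquiv.of_fibred hα hU (by simp [hβ']) ?_
    filter_upwards [ball_prod_ball_mem_nhds hr hr] with p hp
    refine ⟨by ring, ?_⟩
    have h1 : HasDerivAt (fun x => p.2 * ((β : ℂ) * Complex.exp (N x)))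
        (p.2 * (β * (Complex.exp (N p.1) * m p.1))) p.1 :=
      ((hN p.1 (hrR hp.1)).cexp.const_mul _).const_mul _
    have h2 : HasDerivAt (fun y => y * ((β : ℂ) * Complex.exp (N p.1)))
        (1 * (β * Complex.exp (N p.1))) p.2 := (hasDerivAt_id p.2).mul_const _
    rw [h1.deriv, h2.deriv]
    have h3 : α * p.1 / α = p.1 := by field_simp
    have h4 : p.2 * (β * Complex.exp (N p.1)) / β * Complex.exp (-N p.1) = p.2 := by
      rw [Complex.exp_neg]
      have := Complex.exp_ne_zero (N p.1)
      field_simp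
    simp only [h3, h4, hbm]
    field_simp
    ring

theorem exists_preliminary_form {X : ℂ × ℂ → ℂ × ℂ} (hX : AnalyticAt ℂ X 0) (hX0 : X 0 = 0)
    {μ : ℝ} (hμ : 0 < μ) {l₁ l₂ : ℂ} (hl₁ : l₁ ≠ 0) (hl₂ : l₂ = -(μ : ℂ) * l₁)
    (hdet : LinearMap.det ((fderiv ℂ X 0).toLinearMap) = l₁ * l₂)
    (htr : LinearMap.trace ℂ (ℂ × ℂ) ((fderiv ℂ X 0).toLinearMap) = l₁ + l₂)
    {ε : ℝ} (hε : 0 < ε) :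
    ∃ h : ℂ × ℂ → ℂ, DifferentiableOn ℂ h (ball 0 3 ×ˢ ball 0 1) ∧
      (∀ x ∈ ball (0 : ℂ) 3, h (x, 0) = 0) ∧
      (∀ x ∈ ball (0 : ℂ) 3, ∀ y ∈ ball (0 : ℂ) 1, ∀ y' ∈ ball (0 : ℂ) 1,
        ‖h (x, y) - h (x, y')‖ ≤ ε * ‖y - y'‖) ∧
      FoliationEquiv X (fun p => (-p.1, μ * (1 + h p) * p.2)) := by
  have hne : l₁ ≠ l₂ := by
    intro h
    have h1 : ((1 + μ : ℝ) : ℂ) * l₁ = 0 := by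
      push_cast
      linear_combination h + hl₂
    have h2 : (1 + μ : ℝ) ≠ 0 := by positivity
    exact (mul_ne_zero (by exact_mod_cast h2) hl₁) h1
  obtain ⟨Y, hY, hXY, hY0, hYd⟩ := exists_diagonal hX hX0 hne hdet htr
  obtain ⟨a, b, ha, hb, ha0, hb0, hYab⟩ := exists_axes_invariant hY hY0 hμ hl₁ fun v => by
    rw [hYd, hl₂, neg_mul]
  have ha1 : a 0 ≠ 0 := by rwa [ha0]
  have hB : AnalyticAt ℂ (fun p => -(b p) / a p) 0 := hb.neg.div ha ha1
  obtain ⟨h, h1, h2, h3, h4⟩ := exists_linear_on_axis hB hμ (by rw [ha0, hb0]; field_simp) hε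
  refine ⟨h, h1, h2, h3, hXY.trans (hYab.trans (.trans ?_ h4))⟩
  refine FoliationEquiv.of_smul ha.neg (by simpa using ha1) ?_
  filter_upwards [ha.continuousAt.eventually_ne ha1] with p hp
  simp only [Prod.smul_mk, smul_eq_mul, Pi.neg_apply]
  refine Prod.ext ?_ ?_
  · simp only; ring
  · simp only; field_simp

/-- The region `Re z < 1`, `-1 < Im z < 2π + 1`, `|c| < ρ`, `|c e^{-μ z}| < ρ` over which the leaves
`z ↦ c e^{-μ z + D(z, c)}` of the foliation are parametrised through `x = -e^z`. -/
def flowBox (μ ρ : ℝ) : Set (ℂ × ℂ) :=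
  {p | p.1.re < 1 ∧ -1 < p.1.im ∧ p.1.im < 2 * Real.pi + 1 ∧ ‖p.2‖ < ρ ∧
    ‖p.2 * Complex.exp (-(μ * p.1))‖ < ρ}

theorem isOpen_flowBox (μ ρ : ℝ) : IsOpen (flowBox μ ρ) := by
  have h1 : Continuous fun p : ℂ × ℂ => p.1.re := by fun_prop
  have h2 : Continuous fun p : ℂ × ℂ => p.1.im := by fun_prop
  have h3 : Continuous fun p : ℂ × ℂ => ‖p.2‖ := by fun_prop
  have h4 : Continuous fun p : ℂ × ℂ => ‖p.2 * Complex.exp (-(μ * p.1))‖ :=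
    (continuous_snd.mul (Complex.continuous_exp.comp (by fun_prop))).norm
  exact (isOpen_lt h1 continuous_const).inter <| (isOpen_lt continuous_const h2).inter <|
    (isOpen_lt h2 continuous_const).inter <| (isOpen_lt h3 continuous_const).inter <|
    isOpen_lt h4 continuous_const

theorem add_mul_sub_lt {x y b t : ℝ} (hx : x < b) (hy : y < b) (ht : t ∈ Icc (0:ℝ) 1) :
    y + t * (x - y) < b := by
  rcases ht.2.lt_or_eq with h | h
  · nlinarith [mul_nonneg ht.1 (sub_nonneg.2 hx.le), mul_pos (sub_pos.2 h) (sub_pos.2 hy)]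
  · rw [h]; linarith

theorem norm_exp_neg_real_mul (μ : ℝ) (z : ℂ) : ‖Complex.exp (-(μ * z))‖ = Real.exp (-(μ * z.re)) := by
  rw [Complex.norm_exp]
  simp

theorem norm_mul_exp_segment_le {μ : ℝ} (hμ : 0 < μ) {c : ℂ} {x t : ℝ} (ht : t ∈ Icc (0:ℝ) 1) :
    ‖c‖ * Real.exp (-(μ * (t * x))) ≤ max ‖c‖ (‖c‖ * Real.exp (-(μ * x))) := by
  rcases le_total 0 x with hx | hx
  · refine le_max_of_le_left (mul_le_of_le_one_right (norm_nonneg c) (Real.exp_le_one_iff.2 ?_))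
    have := mul_nonneg hμ.le (mul_nonneg ht.1 hx)
    linarith
  · refine le_max_of_le_right ?_
    gcongr
    nlinarith [ht.2]

theorem flowBox_segment_mem {μ ρ : ℝ} (hμ : 0 < μ) {p : ℂ × ℂ} (hp : p ∈ flowBox μ ρ) {t : ℝ}
    (ht : t ∈ Icc (0:ℝ) 1) {y : ℝ} (hy : -1 < y) (hy' : y < 2 * Real.pi + 1) :
    (y * Complex.I + t * (p.1 - y * Complex.I), p.2) ∈ flowBox μ ρ := by
  obtain ⟨h1, h2, h3, h4, h5⟩ := hp
  have hre : (y * Complex.I + t * (p.1 - y * Complex.I)).re = t * p.1.re := by simp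
  have him : (y * Complex.I + t * (p.1 - y * Complex.I)).im = y + t * (p.1.im - y) := by simp
  refine ⟨?_, ?_, ?_, h4, ?_⟩
  · rw [hre]
    simpa using add_mul_sub_lt h1 one_pos ht
  · rw [him]
    have := add_mul_sub_lt (neg_lt_neg h2) (neg_lt_neg hy) ht
    linarith
  · rw [him]
    exact add_mul_sub_lt h3 hy' ht
  · rw [norm_mul, norm_exp_neg_real_mul] at h5
    simp only
    rw [norm_mul, norm_exp_neg_real_mul, hre]
    exact (norm_mul_exp_segment_le hμ ht).trans_lt (max_lt h4 h5)

theorem integral_exp_segment_le {μ ρ : ℝ} (hμ : 0 < μ) {p : ℂ × ℂ} (hp : p ∈ flowBox μ ρ) :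
    ‖p.1 - (2 * Real.pi : ℝ) * Complex.I‖ * ∫ t in (0:ℝ)..1, ‖p.2‖ * Real.exp (-(μ * (t * p.1.re)))
      ≤ ρ * (1 / μ + 9) := by
  obtain ⟨z, c⟩ := p
  obtain ⟨h1, h2, h3, h4, h5⟩ := hp
  simp only at h1 h2 h3 h4 h5 ⊢
  rw [norm_mul, norm_exp_neg_real_mul] at h5
  have hρ : 0 < ρ := (norm_nonneg _).trans_lt h4
  have hn : ‖z - (2 * Real.pi : ℝ) * Complex.I‖ ≤ |z.re| + 8 := by
    refine (Complex.norm_le_abs_re_add_abs_im _).trans ?_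
    have hre : (z - (2 * Real.pi : ℝ) * Complex.I).re = z.re := by simp
    have him : (z - (2 * Real.pi : ℝ) * Complex.I).im = z.im - 2 * Real.pi := by simp
    rw [hre, him]
    gcongr
    rw [abs_le]
    constructor <;> linarith [Real.pi_lt_d2]
  have hcont : Continuous fun t : ℝ => ‖c‖ * Real.exp (-(μ * (t * z.re))) := by fun_prop
  have hle : ∀ t ∈ Icc (0:ℝ) 1, ‖c‖ * Real.exp (-(μ * (t * z.re))) ≤ ρ := fun t ht =>
    (norm_mul_exp_segment_le hμ ht).trans (max_lt h4 h5).le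
  have hI : ∫ t in (0:ℝ)..1, ‖c‖ * Real.exp (-(μ * (t * z.re))) ≤ ρ := by
    have := intervalIntegral.integral_mono_on zero_le_one (hcont.intervalIntegrable (μ := volume) 0 1)
      ((continuous_const (y := ρ)).intervalIntegrable 0 1) hle
    simpa using this
  have hI0 : 0 ≤ ∫ t in (0:ℝ)..1, ‖c‖ * Real.exp (-(μ * (t * z.re))) :=
    intervalIntegral.integral_nonneg zero_le_one fun t _ => by positivity
  -- the weight `|Re z|` is absorbed by integrating the exponential
  have hexact : -z.re * ∫ t in (0:ℝ)..1, ‖c‖ * Real.exp (-(μ * (t * z.re))) =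
      (‖c‖ * Real.exp (-(μ * z.re)) - ‖c‖) / μ := by
    rw [← intervalIntegral.integral_const_mul]
    have hd : ∀ t ∈ uIcc (0:ℝ) 1, HasDerivAt (fun t => ‖c‖ * Real.exp (-(μ * (t * z.re))) / μ)
        (-z.re * (‖c‖ * Real.exp (-(μ * (t * z.re))))) t := fun t _ => by
      have h6 : HasDerivAt (fun t : ℝ => -(μ * (t * z.re))) (-(μ * (1 * z.re))) t :=
        (((hasDerivAt_id t).mul_const z.re).const_mul μ).neg
      refine ((h6.exp.const_mul ‖c‖).div_const μ).congr_deriv ?_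
      field_simp
    rw [intervalIntegral.integral_eq_sub_of_hasDerivAt hd
      ((continuous_const.mul hcont).intervalIntegrable 0 1)]
    simp [sub_div]
  have habs : |z.re| * ∫ t in (0:ℝ)..1, ‖c‖ * Real.exp (-(μ * (t * z.re))) ≤ ρ / μ + ρ := by
    rcases le_total 0 z.re with hz | hz
    · rw [abs_of_nonneg hz]
      have : 0 < ρ / μ := by positivity
      nlinarith
    · rw [abs_of_nonpos hz, hexact]
      have : (‖c‖ * Real.exp (-(μ * z.re)) - ‖c‖) / μ ≤ ρ / μ := by
        gcongr
        linarith [norm_nonneg c]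
      linarith
  calc _ ≤ (|z.re| + 8) * ∫ t in (0:ℝ)..1, ‖c‖ * Real.exp (-(μ * (t * z.re))) := by gcongr
    _ ≤ (ρ / μ + ρ) + 8 * ρ := by linarith
    _ = ρ * (1 / μ + 9) := by ring

theorem norm_exp_le_three {w : ℂ} (hw : ‖w‖ ≤ 1) : ‖Complex.exp w‖ ≤ 3 := by
  rw [Complex.norm_exp]
  refine (Real.exp_le_exp.2 ((Complex.re_le_norm w).trans hw)).trans ?_
  have := Real.exp_one_lt_d9
  linarith

theorem norm_exp_sub_exp_le {M : ℝ} {w w' : ℂ} (hw : ‖w‖ ≤ M) (hw' : ‖w'‖ ≤ M) :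
    ‖Complex.exp w - Complex.exp w'‖ ≤ Real.exp M * ‖w - w'‖ := by
  refine (convex_closedBall (0 : ℂ) M).norm_image_sub_le_of_norm_hasDerivWithin_le
    (f := Complex.exp) (f' := Complex.exp) (fun z _ => (Complex.hasDerivAt_exp z).hasDerivWithinAt)
    (fun z hz => ?_) (by simpa using hw') (by simpa using hw)
  rw [Complex.norm_exp]
  exact Real.exp_le_exp.2 ((Complex.re_le_norm z).trans (by simpa using hz))

theorem exp_one_le_three : Real.exp 1 ≤ 3 := by
  have := Real.exp_one_lt_d9
  linarith

theorem neg_exp_mem_ball {z : ℂ} (hz : z.re < 1) : -Complex.exp z ∈ ball (0 : ℂ) 3 := by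
  rw [mem_ball_zero_iff, norm_neg, Complex.norm_exp]
  exact (Real.exp_lt_exp.2 hz).trans_le exp_one_le_three

theorem mul_exp_mem_ball {u w : ℂ} (hu : ‖u‖ < 1 / 3) (hw : ‖w‖ ≤ 1) :
    u * Complex.exp w ∈ ball (0 : ℂ) 1 := by
  rw [mem_ball_zero_iff, norm_mul]
  have := norm_exp_le_three hw
  nlinarith [norm_nonneg u]

theorem exists_flowBox_solution {μ ε : ℝ} (hμ : 0 < μ) (hε : 0 < ε) (hεμ : ε * (1 + 9 * μ) ≤ 1 / 2)
    {h : ℂ × ℂ → ℂ} (hd : DifferentiableOn ℂ h (ball 0 3 ×ˢ ball 0 1))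
    (h0 : ∀ x ∈ ball (0 : ℂ) 3, h (x, 0) = 0)
    (hl : ∀ x ∈ ball (0 : ℂ) 3, ∀ y ∈ ball (0 : ℂ) 1, ∀ y' ∈ ball (0 : ℂ) 1,
        ‖h (x, y) - h (x, y')‖ ≤ ε * ‖y - y'‖) :
    ∃ D : ℂ × ℂ → ℂ, DifferentiableOn ℂ D (flowBox μ (1 / 3)) ∧
      (∀ p ∈ flowBox μ (1 / 3), ‖D p‖ ≤ 1) ∧
      (∀ z, (z, 0) ∈ flowBox μ (1 / 3) → D (z, 0) = 0) ∧
      (∀ c, D ((2 * Real.pi : ℝ) * Complex.I, c) = 0) ∧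
      ∀ z c, (z, c) ∈ flowBox μ (1 / 3) → HasDerivAt (fun z => D (z, c))
        (-(μ * h (-Complex.exp z, c * Complex.exp (-(μ * z)) * Complex.exp (D (z, c))))) z := by
  set Ω := flowBox μ (1 / 3) with hΩ
  have hΩo : IsOpen Ω := isOpen_flowBox _ _
  have hx : ∀ p ∈ Ω, -Complex.exp p.1 ∈ ball (0 : ℂ) 3 := fun p hp => neg_exp_mem_ball hp.1
  have hy : ∀ p ∈ Ω, ∀ w : ℂ, ‖w‖ ≤ 1 →
      p.2 * Complex.exp (-(μ * p.1)) * Complex.exp w ∈ ball (0 : ℂ) 1 := fun p hp w hw =>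
    mul_exp_mem_ball hp.2.2.2.2 hw
  set z₀ : ℂ := (2 * Real.pi : ℝ) * Complex.I with hz₀
  have hseg : ∀ p ∈ Ω, ∀ t ∈ Icc (0:ℝ) 1, (z₀ + t * (p.1 - z₀), p.2) ∈ Ω := fun p hp t ht =>
    flowBox_segment_mem hμ hp ht (by linarith [Real.pi_pos]) (by linarith)
  let K : ℂ × ℂ → ℂ → ℂ := fun p w =>
    h (-Complex.exp p.1, p.2 * Complex.exp (-(μ * p.1)) * Complex.exp w)
  have hKl : ∀ p ∈ Ω, ∀ w w' : ℂ, ‖w‖ ≤ 1 → ‖w'‖ ≤ 1 →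
      ‖K p w - K p w'‖ ≤ ε * (‖p.2‖ * Real.exp (-(μ * p.1.re)) * (3 * ‖w - w'‖)) := by
    intro p hp w w' hw hw'
    refine (hl _ (hx p hp) _ (hy p hp w hw) _ (hy p hp w' hw')).trans ?_
    rw [← mul_sub, norm_mul, norm_mul, norm_exp_neg_real_mul]
    gcongr
    exact (norm_exp_sub_exp_le hw hw').trans (by gcongr; exact exp_one_le_three)
  have hKb : ∀ p ∈ Ω, ∀ w : ℂ, ‖w‖ ≤ 1 →
      ‖K p w‖ ≤ ε * (‖p.2‖ * Real.exp (-(μ * p.1.re)) * 3) := by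
    intro p hp w hw
    have h1 := hl _ (hx p hp) _ (hy p hp w hw) 0 (by simp)
    rw [h0 _ (hx p hp), sub_zero, sub_zero, norm_mul, norm_mul, norm_exp_neg_real_mul] at h1
    refine h1.trans ?_
    gcongr
    exact norm_exp_le_three hw
  have hre : ∀ (p : ℂ × ℂ) (t : ℝ), (z₀ + t * (p.1 - z₀)).re = t * p.1.re := fun p t => by
    simp [hz₀]
  let P : (ℂ × ℂ → ℂ) → ℂ × ℂ → ℝ → ℂ := fun f p t =>
    K (z₀ + t * (p.1 - z₀), p.2) (f (z₀ + t * (p.1 - z₀), p.2))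
  have hKd : ∀ f : ℂ × ℂ → ℂ, DifferentiableOn ℂ f Ω → (∀ p ∈ Ω, ‖f p‖ ≤ 1) →
      DifferentiableOn ℂ (fun p => K p (f p)) Ω := by
    intro f hf hfb
    have e1 : DifferentiableOn ℂ (fun p : ℂ × ℂ => -Complex.exp p.1) Ω :=
      (differentiableOn_fst.cexp).neg
    have e2 : DifferentiableOn ℂ (fun p : ℂ × ℂ => -((μ : ℂ) * p.1)) Ω := by fun_prop
    refine DifferentiableOn.comp (f := fun p : ℂ × ℂ => (-Complex.exp p.1,
      p.2 * Complex.exp (-(μ * p.1)) * Complex.exp (f p))) hd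
      (e1.prodMk ((differentiableOn_snd.mul e2.cexp).mul hf.cexp)) fun p hp =>
      ⟨hx p hp, hy p hp _ (hfb p hp)⟩
  have hPc : ∀ f : ℂ × ℂ → ℂ, DifferentiableOn ℂ f Ω → (∀ p ∈ Ω, ‖f p‖ ≤ 1) →
      ContinuousOn (Function.uncurry (P f)) (Ω ×ˢ Icc 0 1) := by
    intro f hf hfb
    exact ContinuousOn.comp (f := fun q : (ℂ × ℂ) × ℝ => (z₀ + q.2 * (q.1.1 - z₀), q.1.2))
      (hKd f hf hfb).continuousOn (by fun_prop) fun q hq => hseg _ hq.1 _ hq.2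
  have hPi : ∀ f : ℂ × ℂ → ℂ, DifferentiableOn ℂ f Ω → (∀ p ∈ Ω, ‖f p‖ ≤ 1) → ∀ p ∈ Ω,
      IntervalIntegrable (P f p) volume 0 1 := by
    intro f hf hfb p hp
    refine ContinuousOn.intervalIntegrable_of_Icc zero_le_one ?_
    exact ContinuousOn.comp (f := fun t : ℝ => (p, t)) (hPc f hf hfb) (by fun_prop)
      fun t ht => ⟨hp, ht⟩
  have hbound : ∀ p ∈ Ω, ∀ d : ℝ, 0 ≤ d → ∀ F : ℝ → ℂ,
      (∀ t ∈ Icc (0:ℝ) 1, ‖F t‖ ≤ ε * (‖p.2‖ * Real.exp (-(μ * (t * p.1.re))) * (3 * d))) →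
      ‖-(μ * ((p.1 - z₀) * ∫ t in (0:ℝ)..1, F t))‖ ≤ d / 2 := by
    intro p hp d hd0 F hF
    have hc : Continuous fun t : ℝ => ε * (‖p.2‖ * Real.exp (-(μ * (t * p.1.re))) * (3 * d)) := by
      fun_prop
    have h1 : ‖∫ t in (0:ℝ)..1, F t‖ ≤
        ε * (3 * d) * ∫ t in (0:ℝ)..1, ‖p.2‖ * Real.exp (-(μ * (t * p.1.re))) := by
      refine (intervalIntegral.norm_integral_le_of_norm_le zero_le_one (Eventually.of_forall
        fun t ht => hF t (Ioc_subset_Icc_self ht)) (hc.intervalIntegrable 0 1)).trans_eq ?_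
      rw [← intervalIntegral.integral_const_mul]
      congr 1
      ext t
      ring
    rw [norm_neg, norm_mul, norm_mul, Complex.norm_real, Real.norm_eq_abs, abs_of_pos hμ]
    calc _ ≤ μ * (‖p.1 - z₀‖ * (ε * (3 * d) *
          ∫ t in (0:ℝ)..1, ‖p.2‖ * Real.exp (-(μ * (t * p.1.re))))) := by gcongr
      _ = μ * (ε * (3 * d)) * (‖p.1 - z₀‖ *
          ∫ t in (0:ℝ)..1, ‖p.2‖ * Real.exp (-(μ * (t * p.1.re)))) := by ring
      _ ≤ μ * (ε * (3 * d)) * (1 / 3 * (1 / μ + 9)) :=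
        mul_le_mul_of_nonneg_left (integral_exp_segment_le hμ hp) (by positivity)
      _ = ε * (1 + 9 * μ) * d := by field_simp
      _ ≤ 1 / 2 * d := by gcongr
      _ = d / 2 := by ring
  let G : (ℂ × ℂ → ℂ) → ℂ × ℂ → ℂ := fun f p => -(μ * ((p.1 - z₀) * ∫ t in (0:ℝ)..1, P f p t))
  have hGm : ∀ f ∈ {f : ℂ × ℂ → ℂ | DifferentiableOn ℂ f Ω}, (∀ p ∈ Ω, ‖f p‖ ≤ 1) →
      G f ∈ {f : ℂ × ℂ → ℂ | DifferentiableOn ℂ f Ω} ∧ ∀ p ∈ Ω, ‖G f p‖ ≤ 1 := by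
    intro f hf hfb
    constructor
    · have hi : DifferentiableOn ℂ (fun p => ∫ t in (0:ℝ)..1, P f p t) Ω := by
        refine differentiableOn_intervalIntegral_prod hΩo zero_le_one (hPc f hf hfb) fun t ht => ?_
        exact DifferentiableOn.comp (f := fun p : ℂ × ℂ => (z₀ + t * (p.1 - z₀), p.2))
          (hKd f hf hfb) (by fun_prop) fun p hp => hseg p hp t ht
      have e1 : DifferentiableOn ℂ (fun p : ℂ × ℂ => p.1 - z₀) Ω := by fun_prop
      exact ((e1.mul hi).const_mul _).neg
    · intro p hp
      refine (hbound p hp 1 zero_le_one _ fun t ht => ?_).trans (by norm_num)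
      have := hKb _ (hseg p hp t ht) _ (hfb _ (hseg p hp t ht))
      rw [hre] at this
      simpa using this
  have hGl : ∀ f ∈ {f : ℂ × ℂ → ℂ | DifferentiableOn ℂ f Ω},
      ∀ g ∈ {f : ℂ × ℂ → ℂ | DifferentiableOn ℂ f Ω}, (∀ p ∈ Ω, ‖f p‖ ≤ 1) →
      (∀ p ∈ Ω, ‖g p‖ ≤ 1) → ∀ d : ℝ, (∀ p ∈ Ω, ‖f p - g p‖ ≤ d) →
      ∀ p ∈ Ω, ‖G f p - G g p‖ ≤ d / 2 := by
    intro f hf g hg hfb hgb d hfg p hp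
    have hd0 : 0 ≤ d := (norm_nonneg _).trans (hfg p hp)
    have e1 : G f p - G g p = -(μ * ((p.1 - z₀) * ∫ t in (0:ℝ)..1, (P f p t - P g p t))) := by
      rw [intervalIntegral.integral_sub (hPi f hf hfb p hp) (hPi g hg hgb p hp)]
      simp only [G]
      ring
    rw [e1]
    refine hbound p hp d hd0 _ fun t ht => ?_
    have hs := hseg p hp t ht
    have := hKl _ hs _ _ (hfb _ hs) (hgb _ hs)
    rw [hre] at this
    refine this.trans ?_
    gcongr
    exact hfg _ hs
  obtain ⟨D, hDd, hDb, hDe⟩ := exists_fixedPoint_of_half_lipschitz (Ω := Ω)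
    (H := {f : ℂ × ℂ → ℂ | DifferentiableOn ℂ f Ω}) (differentiableOn_const (0 : ℂ))
    (fun F f hF hu => hu.differentiableOn_prod hΩo hF) zero_le_one hGm hGl
  refine ⟨G D, (hGm D hDd hDb).1, (hGm D hDd hDb).2, fun z hz => ?_, fun c => ?_, fun z c hzc => ?_⟩
  · have : ∀ t ∈ uIcc (0:ℝ) 1, P D (z, 0) t = 0 := fun t ht => by
      rw [uIcc_of_le zero_le_one] at ht
      simp only [P, K, zero_mul]
      exact h0 _ (hx _ (hseg _ hz t ht))
    simp only [G]
    rw [intervalIntegral.integral_congr this]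
    simp
  · simp [G]
  · have hs : StarConvex ℝ z₀ {z | (z, c) ∈ Ω} := by
      intro w hw a b ha hb hab
      have := hseg _ hw b ⟨hb, by linarith⟩
      have ha' : (a : ℂ) = 1 - b := by
        rw [eq_sub_iff_add_eq]; exact_mod_cast hab
      simp only [mem_ofPred_eq, Complex.real_smul, ha']
      convert this using 2
      ring
    have h1 := hasDerivAt_segment_integral (hΩo.slice_fst c) hs ((hKd D hDd hDb).slice_fst c)
      (show z ∈ {z | (z, c) ∈ Ω} from hzc)
    rw [hDe _ hzc]
    exact (h1.const_mul (μ : ℂ)).neg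

/-- The period `2πi` of the exponential. -/
noncomputable def twoPiI : ℂ := ((2 * Real.pi : ℝ) : ℂ) * Complex.I

@[simp] theorem twoPiI_re : twoPiI.re = 0 := by simp [twoPiI]

@[simp] theorem twoPiI_im : twoPiI.im = 2 * Real.pi := by simp [twoPiI]

@[simp] theorem exp_twoPiI : Complex.exp twoPiI = 1 := by
  rw [twoPiI]
  push_cast
  exact Complex.exp_two_pi_mul_I

theorem norm_exp_real_mul_twoPiI (μ : ℝ) : ‖Complex.exp (μ * twoPiI)‖ = 1 := by
  rw [Complex.norm_exp]
  simp

theorem flowBox_monodromy {μ ε : ℝ} (hμ : 0 < μ) (hε : 0 < ε) {h : ℂ × ℂ → ℂ}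
    (hl : ∀ x ∈ ball (0 : ℂ) 3, ∀ y ∈ ball (0 : ℂ) 1, ∀ y' ∈ ball (0 : ℂ) 1,
        ‖h (x, y) - h (x, y')‖ ≤ ε * ‖y - y'‖) {D : ℂ × ℂ → ℂ}
    (hDb : ∀ p ∈ flowBox μ (1 / 3), ‖D p‖ ≤ 1) (hD0 : ∀ c, D (twoPiI, c) = 0)
    (hD : ∀ z c, (z, c) ∈ flowBox μ (1 / 3) → HasDerivAt (fun z => D (z, c))
        (-(μ * h (-Complex.exp z, c * Complex.exp (-(μ * z)) * Complex.exp (D (z, c))))) z)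
    {z c : ℂ} (hz : z.re < 1) (hz1 : -1 < z.im) (hz2 : z.im < 1) (hc : ‖c‖ < 1 / 9)
    (hcz : ‖c * Complex.exp (-(μ * z))‖ < 1 / 9) :
    D (z, c) = D (z + twoPiI, c * Complex.exp (μ * twoPiI + D (0, c))) + D (0, c) := by
  have hpi := Real.pi_gt_three
  have hmem0 : ∀ {z : ℂ}, z.re < 1 → -1 < z.im → z.im < 1 → ‖c * Complex.exp (-(μ * z))‖ < 1 / 9 →
      (z, c) ∈ flowBox μ (1 / 3) := fun h1 h2 h3 h4 =>
    ⟨h1, h2, by simp only; linarith, by simp only; linarith, by simp only; linarith⟩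
  have ha : ‖D (0, c)‖ ≤ 1 := hDb _ (hmem0 (by simp) (by simp) (by simp) (by simpa using hc))
  set a := D (0, c) with haD
  set c₂ := c * Complex.exp (μ * twoPiI + a) with hc₂
  have hE : ‖Complex.exp (μ * twoPiI + a)‖ ≤ 3 := by
    rw [Complex.exp_add, norm_mul, norm_exp_real_mul_twoPiI, one_mul]
    exact norm_exp_le_three ha
  have hmem1 : ∀ {z : ℂ}, z.re < 1 → -1 < z.im → z.im < 1 → ‖c * Complex.exp (-(μ * z))‖ < 1 / 9 →
      (z + twoPiI, c₂) ∈ flowBox μ (1 / 3) := by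
    intro z h1 h2 h3 h4
    refine ⟨?_, ?_, ?_, ?_, ?_⟩
    · simpa using h1
    · simp only [Complex.add_im, twoPiI_im]; linarith
    · simp only [Complex.add_im, twoPiI_im]; linarith
    · simp only [hc₂]
      rw [norm_mul]
      nlinarith [norm_nonneg c]
    · simp only
      rw [hc₂, mul_right_comm, norm_mul]
      have : ‖c * Complex.exp (-(μ * (z + twoPiI)))‖ < 1 / 9 := by
        rw [norm_mul, norm_exp_neg_real_mul] at h4 ⊢
        simpa using h4
      nlinarith [norm_nonneg (c * Complex.exp (-(μ * (z + twoPiI))))]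
  -- the segment from `0` to `z`
  have hseg : ∀ t ∈ Icc (0:ℝ) 1, (t * z : ℂ).re < 1 ∧ -1 < (t * z : ℂ).im ∧ (t * z : ℂ).im < 1 ∧
      ‖c * Complex.exp (-(μ * (t * z)))‖ < 1 / 9 := by
    intro t ht
    have e1 : (t * z : ℂ).re = t * z.re := by simp
    have e2 : (t * z : ℂ).im = t * z.im := by simp
    rw [e1, e2]
    refine ⟨?_, ?_, ?_, ?_⟩
    · simpa using add_mul_sub_lt hz one_pos ht
    · have := add_mul_sub_lt (b := 1) (neg_lt.1 hz1) one_pos ht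
      simp only [zero_add, sub_zero] at this
      linarith
    · simpa using add_mul_sub_lt hz2 one_pos ht
    · rw [norm_mul, norm_exp_neg_real_mul] at hcz ⊢
      rw [e1]
      exact (norm_mul_exp_segment_le hμ ht).trans_lt (max_lt hc hcz)
  have hm0 : ∀ t ∈ Icc (0:ℝ) 1, (t * z, c) ∈ flowBox μ (1 / 3) := fun t ht => by
    obtain ⟨h1, h2, h3, h4⟩ := hseg t ht
    exact hmem0 h1 h2 h3 h4
  have hm1 : ∀ t ∈ Icc (0:ℝ) 1, (t * z + twoPiI, c₂) ∈ flowBox μ (1 / 3) := fun t ht => by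
    obtain ⟨h1, h2, h3, h4⟩ := hseg t ht
    exact hmem1 h1 h2 h3 h4
  let v : ℝ → ℂ → ℂ := fun t u =>
    -(μ * h (-Complex.exp (t * z), c * Complex.exp (-(μ * (t * z))) * Complex.exp u)) * z
  have hf : ∀ t ∈ Icc (0:ℝ) 1, HasDerivAt (fun t : ℝ => D (t * z, c)) (v t (D (t * z, c))) t := by
    intro t ht
    have h1 : HasDerivAt (fun s : ℂ => s * z) (1 * z) t := (hasDerivAt_id (t : ℂ)).mul_const z
    refine HasDerivAt.comp_ofReal (e := fun s : ℂ => D (s * z, c)) ?_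
    refine (HasDerivAt.comp (h₂ := fun z => D (z, c)) (h := fun s : ℂ => s * z) (t : ℂ)
      (hD _ _ (hm0 t ht)) h1).congr_deriv ?_
    simp [v]
  have hg : ∀ t ∈ Icc (0:ℝ) 1, HasDerivAt (fun t : ℝ => D (t * z + twoPiI, c₂) + a)
      (v t (D (t * z + twoPiI, c₂) + a)) t := by
    intro t ht
    have h1 : HasDerivAt (fun s : ℂ => s * z + twoPiI) (1 * z) t :=
      ((hasDerivAt_id (t : ℂ)).mul_const z).add_const _
    refine HasDerivAt.comp_ofReal (e := fun s : ℂ => D (s * z + twoPiI, c₂) + a) ?_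
    refine ((HasDerivAt.comp (h₂ := fun z => D (z, c₂)) (h := fun s : ℂ => s * z + twoPiI) (t : ℂ)
      (hD _ _ (hm1 t ht)) h1).add_const a).congr_deriv ?_
    have h2 : c₂ * Complex.exp (-(μ * (t * z + twoPiI))) * Complex.exp (D (t * z + twoPiI, c₂)) =
        c * Complex.exp (-(μ * (t * z))) * Complex.exp (D (t * z + twoPiI, c₂) + a) := by
      rw [hc₂, mul_assoc, mul_assoc, mul_assoc, ← Complex.exp_add, ← Complex.exp_add,
        ← Complex.exp_add]
      congr 2
      ring
    rw [h2, Complex.exp_add (t * z), exp_twoPiI, mul_one, one_mul]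
  have key : EqOn (fun t : ℝ => D (t * z, c)) (fun t : ℝ => D (t * z + twoPiI, c₂) + a)
      (Icc 0 1) := by
    refine ODE_solution_unique_of_mem_Icc_right (v := v) (s := fun _ => closedBall 0 2)
      (K := (μ * (ε * 9) * ‖z‖).toNNReal) ?_ (fun t ht => (hf t ht).continuousAt.continuousWithinAt)
      (fun t ht => (hf t (Ico_subset_Icc_self ht)).hasDerivWithinAt) ?_
      (fun t ht => (hg t ht).continuousAt.continuousWithinAt)
      (fun t ht => (hg t (Ico_subset_Icc_self ht)).hasDerivWithinAt) ?_ ?_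
    · intro t ht
      have ht' := Ico_subset_Icc_self ht
      obtain ⟨h1, -, -, h4⟩ := hseg t ht'
      have he2 : Real.exp 2 ≤ 9 := by
        have := Real.exp_one_lt_d9
        have h2 : Real.exp 2 = Real.exp 1 * Real.exp 1 := by rw [← Real.exp_add]; norm_num
        nlinarith [Real.exp_pos 1]
      have hb : ∀ u ∈ closedBall (0 : ℂ) 2,
          c * Complex.exp (-(μ * (t * z))) * Complex.exp u ∈ ball (0 : ℂ) 1 := fun u hu => by
        rw [mem_ball_zero_iff, norm_mul]
        have : ‖Complex.exp u‖ ≤ 9 := by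
          rw [Complex.norm_exp]
          exact (Real.exp_le_exp.2 ((Complex.re_le_norm u).trans (by simpa using hu))).trans he2
        nlinarith [norm_nonneg (c * Complex.exp (-(μ * (t * z))))]
      refine LipschitzOnWith.of_dist_le_mul fun u hu w hw => ?_
      rw [Real.coe_toNNReal _ (by positivity), dist_eq_norm, dist_eq_norm, ← sub_mul, norm_mul,
        neg_sub_neg, ← mul_sub, norm_mul, Complex.norm_real, Real.norm_eq_abs, abs_of_pos hμ,
        norm_sub_rev]
      have h5 : ‖h (-Complex.exp (t * z), c * Complex.exp (-(μ * (t * z))) * Complex.exp u) -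
          h (-Complex.exp (t * z), c * Complex.exp (-(μ * (t * z))) * Complex.exp w)‖
          ≤ ε * (1 * (9 * ‖u - w‖)) := by
        refine (hl _ (neg_exp_mem_ball h1) _ (hb u hu) _ (hb w hw)).trans ?_
        rw [← mul_sub, norm_mul]
        gcongr
        · linarith
        · exact (norm_exp_sub_exp_le (by simpa using hu) (by simpa using hw)).trans (by gcongr)
      calc _ ≤ μ * (ε * (1 * (9 * ‖u - w‖))) * ‖z‖ := by gcongr
        _ = _ := by ring
    · intro t ht
      rw [mem_closedBall_zero_iff]
      exact (hDb _ (hm0 t (Ico_subset_Icc_self ht))).trans one_le_two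
    · intro t ht
      rw [mem_closedBall_zero_iff]
      refine (norm_add_le _ _).trans ?_
      linarith [hDb _ (hm1 t (Ico_subset_Icc_self ht))]
    · simp [hD0, haD]
  simpa using key (right_mem_Icc.2 zero_le_one)

theorem Real.cos_le_nine_tenths {y : ℝ} (h1 : 49 / 100 ≤ y) (h2 : y ≤ 2 * Real.pi - 49 / 100) :
    Real.cos y ≤ 9 / 10 := by
  have h0 : Real.cos (49 / 100) ≤ 9 / 10 := by
    have := (abs_le.1 (Real.cos_bound (x := 49 / 100) (by norm_num [abs_le]))).2
    rw [abs_of_nonneg (by norm_num)] at this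
    norm_num at this ⊢
    linarith
  rcases le_total y Real.pi with h | h
  · exact (Real.cos_le_cos_of_nonneg_of_le_pi (by norm_num) h h1).trans h0
  · rw [← Real.cos_two_pi_sub]
    exact (Real.cos_le_cos_of_nonneg_of_le_pi (by norm_num) (by linarith) (by linarith)).trans h0

theorem two_fifths_le_norm_one_sub_exp {u : ℂ} (hu : Real.cos u.im ≤ 9 / 10) :
    2 / 5 ≤ ‖1 - Complex.exp u‖ := by
  have h : (2 / 5 : ℝ) ^ 2 ≤ ‖1 - Complex.exp u‖ ^ 2 := by
    rw [Complex.sq_norm, Complex.normSq_apply]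
    simp only [Complex.sub_re, Complex.sub_im, Complex.one_re, Complex.one_im, Complex.exp_re,
      Complex.exp_im]
    have h1 := Real.exp_pos u.re
    have h2 := Real.sin_sq_add_cos_sq u.im
    have h3 := mul_le_mul_of_nonneg_left hu h1.le
    nlinarith [sq_nonneg (Real.exp u.re - 9 / 10),
      congrArg (fun w => Real.exp u.re ^ 2 * w) h2]
  exact (sq_le_sq₀ (by norm_num) (norm_nonneg _)).1 h

theorem one_sub_exp_ne_zero {u : ℂ} (hu : Real.cos u.im ≤ 9 / 10) : 1 - Complex.exp u ≠ 0 := by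
  rw [← norm_pos_iff]
  linarith [two_fifths_le_norm_one_sub_exp hu]

theorem norm_inv_one_sub_exp_le {u : ℂ} (hu : Real.cos u.im ≤ 9 / 10) :
    ‖(1 - Complex.exp u)⁻¹‖ ≤ 5 / 2 := by
  rw [norm_inv]
  exact (inv_anti₀ (by norm_num) (two_fifths_le_norm_one_sub_exp hu)).trans (by norm_num)

theorem norm_inv_one_sub_exp_le_of_abs_re {u : ℂ} (hu : 1 ≤ |u.re|) :
    ‖(1 - Complex.exp u)⁻¹‖ ≤ 2 := by
  have h : 1 / 2 ≤ ‖1 - Complex.exp u‖ := by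
    have h1 := abs_norm_sub_norm_le (1 : ℂ) (Complex.exp u)
    rw [norm_one, Complex.norm_exp] at h1
    refine le_trans ?_ h1
    rcases le_abs.1 hu with h | h
    · have := Real.add_one_le_exp u.re
      rw [le_abs]; right; linarith
    · have h2 := Real.add_one_le_exp (-u.re)
      rw [Real.exp_neg] at h2
      have h3 : Real.exp u.re ≤ 1 / 2 := by
        rw [le_div_iff₀ (by norm_num)]
        have := Real.exp_pos u.re
        have h4 : Real.exp u.re * (Real.exp u.re)⁻¹ = 1 := mul_inv_cancel₀ this.ne'
        nlinarith
      rw [le_abs]; left; linarith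
  rw [norm_inv]
  exact (inv_anti₀ (by norm_num) h).trans (by norm_num)

/-- Cauchy's theorem for two horizontal lines bounding a strip on which the function decays. -/
theorem tendsto_integral_lines_sub {f : ℂ → ℂ} {b₁ b₂ x : ℝ} (hb : b₁ ≤ b₂)
    (hf : ∀ σ : ℂ, b₁ ≤ σ.im → σ.im ≤ b₂ → DifferentiableAt ℂ f σ) {ω : ℝ → ℝ}
    (hω : Tendsto ω atTop (𝓝 0))
    (hfω : ∀ σ : ℂ, b₁ ≤ σ.im → σ.im ≤ b₂ → 1 ≤ |σ.re - x| → ‖f σ‖ ≤ ω |σ.re - x|) :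
    Tendsto (fun R : ℝ => (∫ t in (x - R)..(x + R), f (t + b₁ * Complex.I)) -
      ∫ t in (x - R)..(x + R), f (t + b₂ * Complex.I)) atTop (𝓝 0) := by
  rw [tendsto_zero_iff_norm_tendsto_zero]
  have h0 : Tendsto (fun R => 2 * (ω R * |b₂ - b₁|)) atTop (𝓝 0) := by
    simpa using (hω.mul_const |b₂ - b₁|).const_mul 2
  refine squeeze_zero' (Eventually.of_forall fun _ => norm_nonneg _) ?_ h0
  filter_upwards [eventually_ge_atTop 1] with R hR
  have key := Complex.integral_boundary_rect_eq_zero_of_differentiableOn f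
    (⟨x - R, b₁⟩ : ℂ) ⟨x + R, b₂⟩ (fun σ hσ => by
      rw [Complex.mem_reProdIm] at hσ
      have h2 := hσ.2
      simp only [uIcc_of_le hb] at h2
      exact (hf σ h2.1 h2.2).differentiableWithinAt)
  simp only at key
  have hv : ∀ s : ℝ, |s - x| = R → ‖∫ y in b₁..b₂, f (s + y * Complex.I)‖ ≤ ω R * |b₂ - b₁| := by
    intro s hs
    refine intervalIntegral.norm_integral_le_of_norm_le_const fun y hy => ?_
    rw [uIoc_of_le hb] at hy
    have := hfω (s + y * Complex.I) (by simpa using hy.1.le) (by simpa using hy.2)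
      (by simpa [hs] using hR)
    simpa [hs] using this
  have e : ∀ A B C D : ℂ, A - B + Complex.I • C - Complex.I • D = 0 →
      A - B = Complex.I * D - Complex.I * C := by
    intro A B C D h
    simp only [smul_eq_mul] at h
    linear_combination h
  rw [e _ _ _ _ key]
  refine (norm_sub_le _ _).trans ?_
  rw [norm_mul, norm_mul, Complex.norm_I, one_mul, one_mul, two_mul]
  have hR' : |R| = R := abs_of_nonneg (by linarith)
  exact add_le_add (hv _ (by simp [hR'])) (hv _ (by simp [hR']))

theorem integral_inv_line {s : ℝ} (hs : s ≠ 0) (x R : ℝ) :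
    ∫ t in (x - R)..(x + R), ((t : ℂ) - x - s * Complex.I)⁻¹ =
      2 * Real.arctan (R / s) * Complex.I := by
  have hpos : ∀ t : ℝ, 0 < (t - x) ^ 2 + s ^ 2 := fun t => by positivity
  have hne : ∀ t : ℝ, (t : ℂ) - x - s * Complex.I ≠ 0 := fun t h => by
    have := congrArg Complex.im h
    simp [hs] at this
  have h1 : ∀ t : ℝ, HasDerivAt (fun t : ℝ => ((1 / 2 * Real.log ((t - x) ^ 2 + s ^ 2) : ℝ) : ℂ) +
      ((Real.arctan ((t - x) / s) : ℝ) : ℂ) * Complex.I) ((t : ℂ) - x - s * Complex.I)⁻¹ t := by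
    intro t
    have e1 : HasDerivAt (fun t : ℝ => t - x) 1 t := (hasDerivAt_id t).sub_const x
    have e2 := (((e1.fun_pow 2).add_const (s ^ 2)).log (hpos t).ne').const_mul (1 / 2)
    have e3 := (e1.div_const s).arctan
    refine (e2.ofReal_comp.fun_add (e3.ofReal_comp.mul_const Complex.I)).congr_deriv ?_
    refine eq_inv_of_mul_eq_one_left ?_
    have h2 : ((t : ℂ) - x) ^ 2 + s ^ 2 ≠ 0 := by exact_mod_cast (hpos t).ne'
    have hs' : (s : ℂ) ≠ 0 := by exact_mod_cast hs
    have h3 : 1 + (((t : ℂ) - x) / s) ^ 2 ≠ 0 := by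
      have : 1 + ((t - x) / s) ^ 2 ≠ 0 := by positivity
      exact_mod_cast this
    have h4 : 1 + (((t : ℂ) - x) / s) ^ 2 = (((t : ℂ) - x) ^ 2 + s ^ 2) / s ^ 2 := by
      field_simp; ring
    push_cast
    rw [h4]
    field_simp
    ring_nf
    simp only [Complex.I_sq]
    ring
  rw [intervalIntegral.integral_eq_sub_of_hasDerivAt (fun t _ => h1 t)]
  · have e1 : (x + R - x) = R := by ring
    have e2 : (x - R - x) = -R := by ring
    rw [e1, e2, neg_div, Real.arctan_neg, neg_sq]
    push_cast
    ring
  · refine Continuous.intervalIntegrable ?_ _ _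
    exact Continuous.inv₀ (by fun_prop) hne

theorem tendsto_integral_inv_line_of_pos {s : ℝ} (hs : 0 < s) (x : ℝ) :
    Tendsto (fun R : ℝ => ∫ t in (x - R)..(x + R), ((t : ℂ) - x - s * Complex.I)⁻¹) atTop
      (𝓝 (Real.pi * Complex.I)) := by
  simp only [integral_inv_line hs.ne']
  have h := (tendsto_nhds_of_tendsto_nhdsWithin Real.tendsto_arctan_atTop).comp
    (tendsto_id.atTop_div_const hs)
  have := ((Complex.continuous_ofReal.tendsto _).comp h).const_mul (2 : ℂ) |>.mul_const Complex.I
  have e : 2 * ((Real.pi / 2 : ℝ) : ℂ) * Complex.I = Real.pi * Complex.I := by push_cast; ring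
  rw [e] at this
  exact this

theorem tendsto_integral_inv_line_of_neg {s : ℝ} (hs : s < 0) (x : ℝ) :
    Tendsto (fun R : ℝ => ∫ t in (x - R)..(x + R), ((t : ℂ) - x - s * Complex.I)⁻¹) atTop
      (𝓝 (-(Real.pi * Complex.I))) := by
  have h := (tendsto_integral_inv_line_of_pos (neg_pos.2 hs) x).neg
  simp only [integral_inv_line hs.ne, integral_inv_line (neg_pos.2 hs).ne', div_neg,
    Real.arctan_neg] at h ⊢
  simpa using h

theorem integrable_exp_neg_mul_abs {μ : ℝ} (hμ : 0 < μ) :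
    Integrable fun t : ℝ => Real.exp (-μ * |t|) := by
  rw [← integrableOn_univ, ← Iic_union_Ioi (a := (0 : ℝ))]
  refine IntegrableOn.union ?_ ?_
  · refine (integrableOn_exp_mul_Iic hμ 0).congr_fun (fun t ht => ?_) measurableSet_Iic
    simp [abs_of_nonpos (show t ≤ 0 from ht)]
  · refine (integrableOn_exp_mul_Ioi (neg_lt_zero.2 hμ) 0).congr_fun (fun t ht => ?_)
      measurableSet_Ioi
    simp [abs_of_pos (show 0 < t from ht)]

/-- The integrand of the `2πi`-periodic Cauchy transform along the line `Im σ = b`. -/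
noncomputable def lineIntegrand (b : ℝ) (j : ℂ → ℂ) (z : ℂ) (t : ℝ) : ℂ :=
  j (t + b * Complex.I) * (1 - Complex.exp (z - (t + b * Complex.I)))⁻¹

/-- The `2πi`-periodic Cauchy transform along the line `Im σ = b`. -/
noncomputable def lineTransform (b : ℝ) (j : ℂ → ℂ) (z : ℂ) : ℂ :=
  -(twoPiI⁻¹ * ∫ t : ℝ, lineIntegrand b j z t)

theorem lineTransform_add_twoPiI (b : ℝ) (j : ℂ → ℂ) (z : ℂ) :
    lineTransform b j (z + twoPiI) = lineTransform b j z := by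
  have : ∀ w : ℂ, Complex.exp (z + twoPiI - w) = Complex.exp (z - w) := fun w => by
    rw [add_sub_right_comm, Complex.exp_add, exp_twoPiI, mul_one]
  simp only [lineTransform, lineIntegrand, this]

theorem norm_lineIntegrand_le {b μ M : ℝ} {j : ℂ → ℂ} {z : ℂ} (hb : |b| < 1)
    (hj : ∀ σ : ℂ, |σ.im| < 1 → ‖j σ‖ ≤ M * Real.exp (-μ * |σ.re|))
    (hz : Real.cos (z.im - b) ≤ 9 / 10) (t : ℝ) :
    ‖lineIntegrand b j z t‖ ≤ 5 / 2 * (M * Real.exp (-μ * |t|)) := by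
  rw [lineIntegrand, norm_mul, mul_comm]
  have h1 := hj (t + b * Complex.I) (by simpa using hb)
  exact mul_le_mul (norm_inv_one_sub_exp_le (by simpa using hz)) (by simpa using h1)
    (norm_nonneg _) (by norm_num)

theorem continuous_lineIntegrand {b : ℝ} {j : ℂ → ℂ} {z : ℂ} (hb : |b| < 1)
    (hj : ContinuousOn j {σ | |σ.im| < 1}) (hz : Real.cos (z.im - b) ≤ 9 / 10) :
    Continuous (lineIntegrand b j z) := by
  refine Continuous.mul ?_ (Continuous.inv₀ (by fun_prop) fun t => one_sub_exp_ne_zero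
    (by simpa using hz))
  exact hj.comp_continuous (by fun_prop) fun t => by simpa using hb

theorem integrable_lineIntegrand {b μ M : ℝ} {j : ℂ → ℂ} {z : ℂ} (hμ : 0 < μ) (hb : |b| < 1)
    (hjc : ContinuousOn j {σ | |σ.im| < 1})
    (hj : ∀ σ : ℂ, |σ.im| < 1 → ‖j σ‖ ≤ M * Real.exp (-μ * |σ.re|))
    (hz : Real.cos (z.im - b) ≤ 9 / 10) : Integrable (lineIntegrand b j z) :=
  (((integrable_exp_neg_mul_abs hμ).const_mul M).const_mul (5 / 2)).mono'
    (continuous_lineIntegrand hb hjc hz).aestronglyMeasurable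
    (Eventually.of_forall (norm_lineIntegrand_le hb hj hz))

theorem tendsto_lineIntegrand {b μ M : ℝ} {j : ℂ → ℂ} {z : ℂ} (hμ : 0 < μ) (hb : |b| < 1)
    (hjc : ContinuousOn j {σ | |σ.im| < 1})
    (hj : ∀ σ : ℂ, |σ.im| < 1 → ‖j σ‖ ≤ M * Real.exp (-μ * |σ.re|))
    (hz : Real.cos (z.im - b) ≤ 9 / 10) (x : ℝ) :
    Tendsto (fun R => ∫ t in (x - R)..(x + R), lineIntegrand b j z t) atTop
      (𝓝 (∫ t, lineIntegrand b j z t)) :=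
  intervalIntegral_tendsto_integral (integrable_lineIntegrand hμ hb hjc hj hz)
    (tendsto_atBot_add_const_left _ x tendsto_neg_atTop_atBot)
    (tendsto_atTop_add_const_left _ x tendsto_id)

theorem tendsto_exp_decay {μ : ℝ} (hμ : 0 < μ) (M a : ℝ) :
    Tendsto (fun r : ℝ => M * Real.exp (-μ * (r - a))) atTop (𝓝 0) := by
  have : Tendsto (fun r : ℝ => -μ * (r - a)) atTop atBot :=
    (tendsto_atTop_add_const_right _ (-a) tendsto_id).const_mul_atTop_of_neg (neg_lt_zero.2 hμ)
  simpa using (Real.tendsto_exp_atBot.comp this).const_mul M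

theorem isOpen_strip : IsOpen {σ : ℂ | |σ.im| < 1} :=
  isOpen_lt Complex.continuous_im.abs continuous_const

/-- The two transforms agree where the kernel has no pole between the lines. -/
theorem lineTransform_eq {μ M : ℝ} {j : ℂ → ℂ} {z : ℂ} (hμ : 0 < μ)
    (hjd : DifferentiableOn ℂ j {σ | |σ.im| < 1})
    (hj : ∀ σ : ℂ, |σ.im| < 1 → ‖j σ‖ ≤ M * Real.exp (-μ * |σ.re|))
    (hz : ∀ b, |b| ≤ 1 / 2 → Real.cos (z.im - b) ≤ 9 / 10) :
    lineTransform (-(1 / 2)) j z = lineTransform (1 / 2) j z := by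
  have hc : ∀ σ : ℂ, |σ.im| ≤ 1 / 2 → Real.cos (z - σ).im ≤ 9 / 10 := fun σ hσ => by
    simpa using hz _ hσ
  have h0 := tendsto_integral_lines_sub (f := fun σ => j σ * (1 - Complex.exp (z - σ))⁻¹)
    (b₁ := -(1 / 2)) (b₂ := 1 / 2) (x := 0) (by norm_num) (fun σ h1 h2 => by
      have hσ : |σ.im| ≤ 1 / 2 := abs_le.2 ⟨h1, h2⟩
      refine (hjd.differentiableAt (isOpen_strip.mem_nhds (show |σ.im| < 1 by linarith))).mul ?_
      exact DifferentiableAt.inv (by fun_prop) (one_sub_exp_ne_zero (hc σ hσ)))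
    (by simpa using (tendsto_exp_decay hμ M 0).const_mul (5 / 2) :
      Tendsto (fun r => 5 / 2 * (M * Real.exp (-μ * r))) atTop (𝓝 0))
    (fun σ h1 h2 h3 => by
      have hσ : |σ.im| ≤ 1 / 2 := abs_le.2 ⟨h1, h2⟩
      rw [norm_mul, mul_comm, sub_zero]
      exact mul_le_mul (norm_inv_one_sub_exp_le (hc σ hσ)) (hj σ (by linarith))
        (norm_nonneg _) (by norm_num))
  have h1 := tendsto_lineIntegrand hμ (b := -(1 / 2)) (by norm_num [abs_lt]) hjd.continuousOn hj
    (hz _ (by norm_num [abs_le])) 0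
  have h2 := tendsto_lineIntegrand hμ (b := 1 / 2) (by norm_num [abs_lt]) hjd.continuousOn hj
    (hz _ (by norm_num [abs_le])) 0
  have h3 := tendsto_nhds_unique h0 ((h1.sub h2).congr fun R => rfl)
  rw [lineTransform, lineTransform, sub_eq_zero.1 h3.symm]

theorem exp_ne_one_of_abs_im {w : ℂ} (hw : w ≠ 0) (h : |w.im| < 2 * Real.pi) :
    Complex.exp w ≠ 1 := by
  intro he
  obtain ⟨n, hn⟩ := Complex.exp_eq_one_iff.1 he
  have hi : w.im = n * (2 * Real.pi) := by
    have := congrArg Complex.im hn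
    simpa using this
  have hn0 : n = 0 := by
    rw [hi, abs_mul, abs_of_pos Real.two_pi_pos] at h
    have h1 : |(n : ℝ)| < 1 := by
      by_contra! h1
      nlinarith [Real.two_pi_pos]
    exact Int.abs_lt_one_iff.1 (by exact_mod_cast h1)
  exact hw (by simp [hn, hn0])

/-- The two transforms differ by the residue where the pole of the kernel lies between the lines. -/
theorem lineTransform_sub {μ M : ℝ} {j : ℂ → ℂ} {z : ℂ} (hμ : 0 < μ)
    (hjd : DifferentiableOn ℂ j {σ | |σ.im| < 1})
    (hj : ∀ σ : ℂ, |σ.im| < 1 → ‖j σ‖ ≤ M * Real.exp (-μ * |σ.re|))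
    (hz : |z.im| ≤ 1 / 100) :
    lineTransform (-(1 / 2)) j z = lineTransform (1 / 2) j z - j z := by
  obtain ⟨hz1, hz2⟩ := abs_le.1 hz
  have hpi := Real.pi_gt_three
  let g : ℂ → ℂ := dslope (fun w => 1 - Complex.exp (-w)) 0
  have hg : ∀ w, w ≠ 0 → g w = w⁻¹ * (1 - Complex.exp (-w)) := fun w hw => by
    simp [g, dslope_of_ne _ hw, slope_def_field, div_eq_inv_mul]
  have hg0 : g 0 = 1 := by
    have : HasDerivAt (fun w : ℂ => 1 - Complex.exp (-w)) 1 0 := by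
      simpa using ((hasDerivAt_id (0 : ℂ)).fun_neg.cexp).const_sub 1
    simp [g, dslope_same, this.deriv]
  have hgd : Differentiable ℂ g := by
    rw [← differentiableOn_univ]
    exact (Complex.differentiableOn_dslope univ_mem).2 (Differentiable.differentiableOn (by fun_prop))
  have hgne : ∀ w : ℂ, |w.im| < 2 * Real.pi → g w ≠ 0 := fun w hw => by
    rcases eq_or_ne w 0 with rfl | h
    · simp [hg0]
    · rw [hg w h]
      exact mul_ne_zero (inv_ne_zero h) (sub_ne_zero.2
        (exp_ne_one_of_abs_im (neg_ne_zero.2 h) (by simpa using hw)).symm)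
  let F : ℂ → ℂ := fun σ => j σ * (g (σ - z))⁻¹
  have hzs : {σ : ℂ | |σ.im| < 1} ∈ 𝓝 z := isOpen_strip.mem_nhds (show |z.im| < 1 by linarith)
  have hF : DifferentiableOn ℂ F {σ | |σ.im| < 1} := by
    refine hjd.mul (DifferentiableOn.fun_inv ?_ fun σ hσ => hgne _ ?_)
    · exact (hgd.comp (by fun_prop : Differentiable ℂ fun σ : ℂ => σ - z)).differentiableOn
    · have := abs_sub σ.im z.im
      have hσ' : |σ.im| < 1 := hσ
      simp only [Complex.sub_im]
      linarith
  have hFz : F z = j z := by simp [F, hg0]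
  have hFne : ∀ σ, σ ≠ z → dslope F z σ =
      j σ * (1 - Complex.exp (z - σ))⁻¹ - j z * (σ - z)⁻¹ := fun σ hσ => by
    have h1 : σ - z ≠ 0 := sub_ne_zero.2 hσ
    rw [dslope_of_ne _ hσ, slope_def_field, hFz]
    simp only [F]
    rw [hg _ h1, neg_sub, mul_inv, inv_inv]
    field_simp
  have hd : DifferentiableOn ℂ (dslope F z) {σ | |σ.im| < 1} :=
    (Complex.differentiableOn_dslope hzs).2 hF
  have h0 := tendsto_integral_lines_sub (f := dslope F z)
    (b₁ := -(1 / 2)) (b₂ := 1 / 2) (x := z.re) (by norm_num) (fun σ h1 h2 => by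
      have hσ : |σ.im| ≤ 1 / 2 := abs_le.2 ⟨h1, h2⟩
      exact hd.differentiableAt (isOpen_strip.mem_nhds (show |σ.im| < 1 by linarith)))
    (ω := fun r => |M| * Real.exp (-μ * (r - |z.re|)) * 2 + ‖j z‖ * r⁻¹)
    (by
      have := ((tendsto_exp_decay hμ |M| |z.re|).mul_const 2).add
        (tendsto_inv_atTop_zero.const_mul ‖j z‖)
      simpa using this)
    (fun σ h1 h2 h3 => by
      have hσ : |σ.im| ≤ 1 / 2 := abs_le.2 ⟨h1, h2⟩
      have hne : σ ≠ z := fun h => by simp [h] at h3; linarith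
      rw [hFne σ hne]
      refine (norm_sub_le _ _).trans ?_
      rw [norm_mul, norm_mul]
      have e1 : ‖j σ‖ ≤ |M| * Real.exp (-μ * (|σ.re - z.re| - |z.re|)) := by
        refine (hj σ (by linarith)).trans ?_
        have : |σ.re - z.re| - |z.re| ≤ |σ.re| := by linarith [abs_sub σ.re z.re]
        refine mul_le_mul (le_abs_self M) (Real.exp_le_exp.2 ?_) (Real.exp_pos _).le (abs_nonneg _)
        nlinarith
      have e2 : ‖(1 - Complex.exp (z - σ))⁻¹‖ ≤ 2 :=
        norm_inv_one_sub_exp_le_of_abs_re (by rw [Complex.sub_re, abs_sub_comm]; exact h3)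
      have e3 : ‖(σ - z)⁻¹‖ ≤ |σ.re - z.re|⁻¹ := by
        rw [norm_inv]
        exact inv_anti₀ (by linarith) (by simpa using Complex.abs_re_le_norm (σ - z))
      gcongr)
  have c1 : Real.cos (z.im - -(1 / 2)) ≤ 9 / 10 :=
    Real.cos_le_nine_tenths (by linarith) (by linarith)
  have c2 : Real.cos (z.im - 1 / 2) ≤ 9 / 10 := by
    rw [← Real.cos_neg]
    exact Real.cos_le_nine_tenths (by linarith) (by linarith)
  have b1 : |(-(1 / 2) : ℝ)| < 1 := by norm_num [abs_lt]
  have b2 : |(1 / 2 : ℝ)| < 1 := by norm_num [abs_lt]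
  have h1 := tendsto_lineIntegrand hμ b1 hjd.continuousOn hj c1 z.re
  have h2 := tendsto_lineIntegrand hμ b2 hjd.continuousOn hj c2 z.re
  have h3 := tendsto_integral_inv_line_of_pos (s := z.im + 1 / 2) (by linarith) z.re
  have h4 := tendsto_integral_inv_line_of_neg (s := z.im - 1 / 2) (by linarith) z.re
  have key := (h1.sub (h3.const_mul (j z))).sub (h2.sub (h4.const_mul (j z)))
  have heq : ∀ b : ℝ, b ≠ z.im → |b| < 1 → Real.cos (z.im - b) ≤ 9 / 10 → ∀ R : ℝ,
      (∫ t in (z.re - R)..(z.re + R), dslope F z (t + b * Complex.I)) =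
      (∫ t in (z.re - R)..(z.re + R), lineIntegrand b j z t) -
      j z * ∫ t in (z.re - R)..(z.re + R),
        ((t : ℂ) - z.re - ((z.im - b : ℝ) : ℂ) * Complex.I)⁻¹ := by
    intro b hb hb1 hcb R
    have hne : ∀ t : ℝ, (t : ℂ) - z.re - ((z.im - b : ℝ) : ℂ) * Complex.I ≠ 0 := fun t h => by
      have := congrArg Complex.im h
      simp at this
      exact hb (by linarith)
    rw [← intervalIntegral.integral_const_mul, ← intervalIntegral.integral_sub]
    · refine intervalIntegral.integral_congr fun t _ => ?_
      have e : ((t : ℂ) + b * Complex.I) - z =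
          (t : ℂ) - z.re - ((z.im - b : ℝ) : ℂ) * Complex.I := by
        conv_lhs => rw [← Complex.re_add_im z]
        push_cast
        ring
      have hne' : (t : ℂ) + b * Complex.I ≠ z := fun h => hne t (by rw [← e, h, sub_self])
      simp only [lineIntegrand]
      rw [hFne _ hne', e]
    · exact (continuous_lineIntegrand hb1 hjd.continuousOn hcb).intervalIntegrable _ _
    · exact (continuous_const.mul (Continuous.inv₀ (by fun_prop) hne)).intervalIntegrable _ _
  have h5 := tendsto_nhds_unique h0 (key.congr fun R => by
    rw [heq _ (by linarith) b1 c1, heq _ (by linarith) b2 c2, sub_neg_eq_add])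
  have htp : twoPiI ≠ 0 := fun h => by
    have := congrArg Complex.im h
    simp [Real.pi_ne_zero] at this
  have h6 : twoPiI = Real.pi * Complex.I - -(Real.pi * Complex.I) := by
    rw [twoPiI]; push_cast; ring
  have h7 : (∫ t, lineIntegrand (-(1 / 2)) j z t) =
      (∫ t, lineIntegrand (1 / 2) j z t) + twoPiI * j z := by
    rw [h6]
    linear_combination -h5
  rw [lineTransform, lineTransform, h7]
  field_simp
  ring

/-- A solution `T` of the difference equation `T (z + 2πi) - T z = j z`, on a strip of width
greater than `2π`. -/
noncomputable def jumpSolution (j : ℂ → ℂ) (z : ℂ) : ℂ :=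
  if z.im < 0 then lineTransform (1 / 2) j z - j z
  else if z.im < Real.pi then lineTransform (-(1 / 2)) j z
  else if z.im < 2 * Real.pi then lineTransform (1 / 2) j z
  else lineTransform (-(1 / 2)) j z + j (z - twoPiI)

theorem cos_le_of_lower {y : ℝ} (h1 : -1 < y) (h2 : y < 1 / 100) :
    Real.cos (y - 1 / 2) ≤ 9 / 10 := by
  have hpi := Real.pi_gt_three
  rw [← Real.cos_neg]
  exact Real.cos_le_nine_tenths (by linarith) (by linarith)

theorem cos_le_of_lower_middle {y : ℝ} (h1 : -(1 / 100) < y) (h2 : y < Real.pi + 1 / 100) :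
    Real.cos (y - -(1 / 2)) ≤ 9 / 10 := by
  have hpi := Real.pi_gt_three
  exact Real.cos_le_nine_tenths (by linarith) (by linarith)

theorem cos_le_of_upper_middle {y : ℝ} (h1 : Real.pi - 1 / 100 < y)
    (h2 : y < 2 * Real.pi + 1 / 100) : Real.cos (y - 1 / 2) ≤ 9 / 10 := by
  have hpi := Real.pi_gt_three
  exact Real.cos_le_nine_tenths (by linarith) (by linarith)

theorem cos_le_of_upper {y : ℝ} (h1 : 2 * Real.pi - 1 / 100 < y) (h2 : y < 2 * Real.pi + 1) :
    Real.cos (y - -(1 / 2)) ≤ 9 / 10 := by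
  have hpi := Real.pi_gt_three
  rw [← Real.cos_sub_two_pi]
  exact Real.cos_le_nine_tenths (by linarith) (by linarith)

section

variable {μ M : ℝ} {j : ℂ → ℂ} {z : ℂ}

theorem lineTransform_eq_of_abs_sub_pi (hμ : 0 < μ)
    (hjd : DifferentiableOn ℂ j {σ | |σ.im| < 1})
    (hj : ∀ σ : ℂ, |σ.im| < 1 → ‖j σ‖ ≤ M * Real.exp (-μ * |σ.re|))
    (h1 : Real.pi - 1 / 100 < z.im) (h2 : z.im < Real.pi + 1 / 100) :
    lineTransform (-(1 / 2)) j z = lineTransform (1 / 2) j z := by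
  have hpi := Real.pi_gt_three
  refine lineTransform_eq hμ hjd hj fun b hb => ?_
  obtain ⟨hb1, hb2⟩ := abs_le.1 hb
  exact Real.cos_le_nine_tenths (by linarith) (by linarith)

theorem jumpSolution_eq_of_lower (hμ : 0 < μ)
    (hjd : DifferentiableOn ℂ j {σ | |σ.im| < 1})
    (hj : ∀ σ : ℂ, |σ.im| < 1 → ‖j σ‖ ≤ M * Real.exp (-μ * |σ.re|)) (h2 : z.im < 1 / 100) :
    jumpSolution j z = lineTransform (1 / 2) j z - j z := by
  have hpi := Real.pi_gt_three
  rcases lt_or_ge z.im 0 with h | h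
  · rw [jumpSolution, if_pos h]
  · rw [jumpSolution, if_neg (not_lt.2 h), if_pos (by linarith),
      lineTransform_sub hμ hjd hj (abs_le.2 ⟨by linarith, by linarith⟩)]

theorem jumpSolution_eq_of_lower_middle (hμ : 0 < μ)
    (hjd : DifferentiableOn ℂ j {σ | |σ.im| < 1})
    (hj : ∀ σ : ℂ, |σ.im| < 1 → ‖j σ‖ ≤ M * Real.exp (-μ * |σ.re|))
    (h1 : -(1 / 100) < z.im) (h2 : z.im < Real.pi + 1 / 100) :
    jumpSolution j z = lineTransform (-(1 / 2)) j z := by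
  have hpi := Real.pi_gt_three
  rcases lt_or_ge z.im 0 with h | h
  · rw [jumpSolution, if_pos h,
      lineTransform_sub hμ hjd hj (abs_le.2 ⟨by linarith, by linarith⟩)]
  · rcases lt_or_ge z.im Real.pi with h' | h'
    · rw [jumpSolution, if_neg (not_lt.2 h), if_pos h']
    · rw [jumpSolution, if_neg (not_lt.2 h), if_neg (not_lt.2 h'), if_pos (by linarith),
        lineTransform_eq_of_abs_sub_pi hμ hjd hj (by linarith) h2]

theorem jumpSolution_eq_of_upper_middle (hμ : 0 < μ)
    (hjd : DifferentiableOn ℂ j {σ | |σ.im| < 1})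
    (hj : ∀ σ : ℂ, |σ.im| < 1 → ‖j σ‖ ≤ M * Real.exp (-μ * |σ.re|))
    (h1 : Real.pi - 1 / 100 < z.im) (h2 : z.im < 2 * Real.pi + 1 / 100) :
    jumpSolution j z = lineTransform (1 / 2) j z := by
  have hpi := Real.pi_gt_three
  have h0 : ¬ z.im < 0 := by linarith
  rcases lt_or_ge z.im Real.pi with h | h
  · rw [jumpSolution, if_neg h0, if_pos h,
      lineTransform_eq_of_abs_sub_pi hμ hjd hj h1 (by linarith)]
  · rcases lt_or_ge z.im (2 * Real.pi) with h' | h'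
    · rw [jumpSolution, if_neg h0, if_neg (not_lt.2 h), if_pos h']
    · rw [jumpSolution, if_neg h0, if_neg (not_lt.2 h), if_neg (not_lt.2 h')]
      have h3 := lineTransform_sub (z := z - twoPiI) hμ hjd hj
        (abs_le.2 ⟨by simp; linarith, by simp; linarith⟩)
      rw [← lineTransform_add_twoPiI, ← lineTransform_add_twoPiI (1 / 2), sub_add_cancel] at h3
      rw [h3, sub_add_cancel]

theorem jumpSolution_eq_of_upper (hμ : 0 < μ)
    (hjd : DifferentiableOn ℂ j {σ | |σ.im| < 1})
    (hj : ∀ σ : ℂ, |σ.im| < 1 → ‖j σ‖ ≤ M * Real.exp (-μ * |σ.re|))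
    (h1 : 2 * Real.pi - 1 / 100 < z.im) :
    jumpSolution j z = lineTransform (-(1 / 2)) j z + j (z - twoPiI) := by
  have hpi := Real.pi_gt_three
  rcases lt_or_ge z.im (2 * Real.pi) with h | h
  · rw [jumpSolution, if_neg (by linarith), if_neg (by linarith), if_pos h]
    have h3 := lineTransform_sub (z := z - twoPiI) hμ hjd hj
      (abs_le.2 ⟨by simp; linarith, by simp; linarith⟩)
    rw [← lineTransform_add_twoPiI, ← lineTransform_add_twoPiI (1 / 2), sub_add_cancel] at h3
    rw [h3, sub_add_cancel]
  · rw [jumpSolution, if_neg (by linarith), if_neg (by linarith), if_neg (not_lt.2 h)]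

theorem jumpSolution_add_twoPiI (j : ℂ → ℂ) (h1 : -1 < z.im) (h2 : z.im < 1) :
    jumpSolution j (z + twoPiI) = jumpSolution j z + j z := by
  have hpi := Real.pi_gt_three
  have him : (z + twoPiI).im = z.im + 2 * Real.pi := by simp
  rw [jumpSolution, jumpSolution, him, if_neg (by linarith), if_neg (by linarith)]
  rcases lt_or_ge z.im 0 with h | h
  · rw [if_pos (by linarith), if_pos h, lineTransform_add_twoPiI, sub_add_cancel]
  · rw [if_neg (by linarith), if_neg (by linarith), if_pos (by linarith),
      lineTransform_add_twoPiI, add_sub_cancel_right]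

/-- The norm bound of the operator `jumpSolution`. -/
noncomputable def jumpBound (μ : ℝ) : ℝ :=
  ‖twoPiI⁻¹‖ * (5 / 2 * ∫ t : ℝ, Real.exp (-μ * |t|)) + 1

theorem jumpBound_pos (μ : ℝ) : 0 < jumpBound μ := by
  have : 0 ≤ ∫ t : ℝ, Real.exp (-μ * |t|) := integral_nonneg fun t => (Real.exp_pos _).le
  rw [jumpBound]
  positivity

theorem norm_lineTransform_le {b : ℝ} (hμ : 0 < μ) (hb : |b| < 1)
    (hj : ∀ σ : ℂ, |σ.im| < 1 → ‖j σ‖ ≤ M * Real.exp (-μ * |σ.re|))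
    (hz : Real.cos (z.im - b) ≤ 9 / 10) : ‖lineTransform b j z‖ ≤ (jumpBound μ - 1) * M := by
  have h := norm_integral_le_of_norm_le
    (((integrable_exp_neg_mul_abs hμ).const_mul M).const_mul (5 / 2))
    (Eventually.of_forall (norm_lineIntegrand_le hb hj hz))
  rw [integral_const_mul, integral_const_mul] at h
  rw [lineTransform, norm_neg, norm_mul, jumpBound, add_sub_cancel_right, mul_assoc]
  refine mul_le_mul_of_nonneg_left (h.trans (le_of_eq ?_)) (norm_nonneg _)
  ring

theorem norm_jumpSolution_le (hμ : 0 < μ) (hM : 0 ≤ M)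
    (hj : ∀ σ : ℂ, |σ.im| < 1 → ‖j σ‖ ≤ M * Real.exp (-μ * |σ.re|)) (h1 : -1 < z.im)
    (h2 : z.im < 2 * Real.pi + 1) : ‖jumpSolution j z‖ ≤ jumpBound μ * M := by
  have hpi := Real.pi_gt_three
  have b1 : |(-(1 / 2) : ℝ)| < 1 := by norm_num [abs_lt]
  have b2 : |(1 / 2 : ℝ)| < 1 := by norm_num [abs_lt]
  have hj' : ∀ σ : ℂ, |σ.im| < 1 → ‖j σ‖ ≤ M := fun σ hσ => by
    refine (hj σ hσ).trans (mul_le_of_le_one_right hM (Real.exp_le_one_iff.2 ?_))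
    nlinarith [abs_nonneg σ.re]
  rw [jumpSolution]
  split_ifs with h3 h4 h5
  · have := norm_lineTransform_le (z := z) hμ b2 hj (cos_le_of_lower h1 (by linarith))
    linarith [norm_sub_le (lineTransform (1 / 2) j z) (j z), hj' z (abs_lt.2 ⟨h1, by linarith⟩)]
  · have := norm_lineTransform_le (z := z) hμ b1 hj
      (cos_le_of_lower_middle (by linarith) (by linarith))
    linarith
  · have := norm_lineTransform_le (z := z) hμ b2 hj
      (cos_le_of_upper_middle (by linarith) (by linarith))
    linarith
  · have := norm_lineTransform_le (z := z) hμ b1 hj (cos_le_of_upper (by linarith) (by linarith))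
    linarith [norm_add_le (lineTransform (-(1 / 2)) j z) (j (z - twoPiI)),
      hj' (z - twoPiI) (abs_lt.2 ⟨by simp; linarith, by simp; linarith⟩)]

end

theorem lineTransform_sub_apply {b μ M M' : ℝ} {j k : ℂ → ℂ} {z : ℂ} (hμ : 0 < μ) (hb : |b| < 1)
    (hjc : ContinuousOn j {σ | |σ.im| < 1})
    (hj : ∀ σ : ℂ, |σ.im| < 1 → ‖j σ‖ ≤ M * Real.exp (-μ * |σ.re|))
    (hkc : ContinuousOn k {σ | |σ.im| < 1})
    (hk : ∀ σ : ℂ, |σ.im| < 1 → ‖k σ‖ ≤ M' * Real.exp (-μ * |σ.re|))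
    (hz : Real.cos (z.im - b) ≤ 9 / 10) :
    lineTransform b j z - lineTransform b k z = lineTransform b (j - k) z := by
  have := integral_sub (integrable_lineIntegrand hμ hb hjc hj hz)
    (integrable_lineIntegrand hμ hb hkc hk hz)
  have e : ∀ t, lineIntegrand b (j - k) z t = lineIntegrand b j z t - lineIntegrand b k z t :=
    fun t => by simp only [lineIntegrand, Pi.sub_apply]; ring
  simp only [lineTransform, e, this]
  ring

theorem norm_jumpSolution_sub_le {μ M M' d : ℝ} {j k : ℂ → ℂ} {z : ℂ} (hμ : 0 < μ) (hd : 0 ≤ d)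
    (hjc : ContinuousOn j {σ | |σ.im| < 1})
    (hj : ∀ σ : ℂ, |σ.im| < 1 → ‖j σ‖ ≤ M * Real.exp (-μ * |σ.re|))
    (hkc : ContinuousOn k {σ | |σ.im| < 1})
    (hk : ∀ σ : ℂ, |σ.im| < 1 → ‖k σ‖ ≤ M' * Real.exp (-μ * |σ.re|))
    (hjk : ∀ σ : ℂ, |σ.im| < 1 → ‖j σ - k σ‖ ≤ d * Real.exp (-μ * |σ.re|)) (h1 : -1 < z.im)
    (h2 : z.im < 2 * Real.pi + 1) :
    ‖jumpSolution j z - jumpSolution k z‖ ≤ jumpBound μ * d := by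
  have b1 : |(-(1 / 2) : ℝ)| < 1 := by norm_num [abs_lt]
  have b2 : |(1 / 2 : ℝ)| < 1 := by norm_num [abs_lt]
  have hpi := Real.pi_gt_three
  have e : jumpSolution j z - jumpSolution k z = jumpSolution (j - k) z := by
    simp only [jumpSolution]
    split_ifs with h3 h4 h5
    · rw [← lineTransform_sub_apply hμ b2 hjc hj hkc hk (cos_le_of_lower h1 (by linarith))]
      simp only [Pi.sub_apply]; ring
    · exact lineTransform_sub_apply hμ b1 hjc hj hkc hk
        (cos_le_of_lower_middle (by linarith) (by linarith))
    · exact lineTransform_sub_apply hμ b2 hjc hj hkc hk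
        (cos_le_of_upper_middle (by linarith) (by linarith))
    · rw [← lineTransform_sub_apply hμ b1 hjc hj hkc hk (cos_le_of_upper (by linarith) h2)]
      simp only [Pi.sub_apply]; ring
  rw [e]
  exact norm_jumpSolution_le hμ hd hjk h1 h2

theorem exists_jumpSolution_decay {μ : ℝ} (hμ : 0 < μ) : ∃ ψ : ℝ → ℝ, Tendsto ψ atTop (𝓝 0) ∧
    ∀ (M : ℝ) (j : ℂ → ℂ), (∀ σ : ℂ, |σ.im| < 1 → ‖j σ‖ ≤ M * Real.exp (-μ * |σ.re|)) →
      ∀ R : ℝ, ‖jumpSolution j (R + Real.pi * Complex.I)‖ ≤ M * ψ R := by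
  have hpi := Real.pi_gt_three
  have b2 : |(1 / 2 : ℝ)| < 1 := by norm_num [abs_lt]
  let k : ℝ → ℝ → ℂ := fun R t =>
    (1 - Complex.exp (R + Real.pi * Complex.I - (t + ((1 / 2 : ℝ) : ℂ) * Complex.I)))⁻¹
  have him : ∀ R t : ℝ, (R + Real.pi * Complex.I - (t + ((1 / 2 : ℝ) : ℂ) * Complex.I)).im =
      Real.pi - 1 / 2 := fun R t => by simp
  have hcos : Real.cos (Real.pi - 1 / 2) ≤ 9 / 10 :=
    cos_le_of_upper_middle (by linarith) (by linarith)
  have hk : ∀ R t, ‖k R t‖ ≤ 5 / 2 := fun R t => norm_inv_one_sub_exp_le (by rw [him]; exact hcos)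
  have hkc : ∀ R, Continuous (k R) := fun R =>
    Continuous.inv₀ (by fun_prop) fun t => one_sub_exp_ne_zero (by rw [him]; exact hcos)
  have hE := integrable_exp_neg_mul_abs hμ
  have hEc : Continuous fun t : ℝ => Real.exp (-μ * |t|) := by fun_prop
  have hdom : ∀ R t, ‖Real.exp (-μ * |t|) * ‖k R t‖‖ ≤ Real.exp (-μ * |t|) * (5 / 2) :=
    fun R t => by
      rw [norm_mul, norm_norm, Real.norm_of_nonneg (Real.exp_pos _).le]
      exact mul_le_mul_of_nonneg_left (hk R t) (Real.exp_pos _).le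
  have hm : ∀ R, AEStronglyMeasurable (fun t => Real.exp (-μ * |t|) * ‖k R t‖) volume := fun R =>
    (hEc.mul (hkc R).norm).aestronglyMeasurable
  refine ⟨fun R => ‖twoPiI⁻¹‖ * ∫ t : ℝ, Real.exp (-μ * |t|) * ‖k R t‖, ?_, ?_⟩
  · have h := tendsto_integral_filter_of_dominated_convergence (l := atTop)
      (F := fun R t => Real.exp (-μ * |t|) * ‖k R t‖) (f := fun _ => (0 : ℝ))
      (fun t => Real.exp (-μ * |t|) * (5 / 2)) (Eventually.of_forall hm)
      (Eventually.of_forall fun R => Eventually.of_forall (hdom R)) (hE.mul_const _)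
      (Eventually.of_forall fun t => by
        have h1 : Tendsto (fun R : ℝ => Real.exp (R - t) - 1) atTop atTop :=
          tendsto_atTop_add_const_right _ (-1) (Real.tendsto_exp_atTop.comp
            (tendsto_atTop_add_const_right _ (-t) tendsto_id))
        have h2 : Tendsto (fun R : ℝ => ‖1 - Complex.exp (R + Real.pi * Complex.I -
            (t + ((1 / 2 : ℝ) : ℂ) * Complex.I))‖) atTop atTop := by
          refine tendsto_atTop_mono (fun R => ?_) h1
          have := norm_sub_norm_le (Complex.exp (R + Real.pi * Complex.I -
            (t + ((1 / 2 : ℝ) : ℂ) * Complex.I))) 1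
          rw [norm_one, norm_sub_rev, Complex.norm_exp] at this
          simpa using this
        have h3 := (tendsto_inv_atTop_zero.comp h2).const_mul (Real.exp (-μ * |t|))
        simpa [k] using h3)
    simpa using h.const_mul ‖twoPiI⁻¹‖
  · intro M j hj R
    have e : jumpSolution j (R + Real.pi * Complex.I) =
        lineTransform (1 / 2) j (R + Real.pi * Complex.I) := by
      have hi : ((R : ℂ) + Real.pi * Complex.I).im = Real.pi := by simp
      rw [jumpSolution, hi, if_neg (by linarith), if_neg (by linarith), if_pos (by linarith)]
    have h := norm_integral_le_of_norm_le (μ := volume)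
      (f := lineIntegrand (1 / 2) j (R + Real.pi * Complex.I))
      (g := fun t => M * (Real.exp (-μ * |t|) * ‖k R t‖))
      (((hE.mul_const (5 / 2)).mono' (hm R) (Eventually.of_forall (hdom R))).const_mul M)
      (Eventually.of_forall fun t => by
        rw [lineIntegrand, norm_mul, ← mul_assoc]
        have hjt := hj (t + ((1 / 2 : ℝ) : ℂ) * Complex.I) (by simpa using b2)
        refine mul_le_mul_of_nonneg_right (hjt.trans (le_of_eq ?_)) (norm_nonneg _)
        simp)
    rw [integral_const_mul] at h
    rw [e, lineTransform, norm_neg, norm_mul]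
    refine (mul_le_mul_of_nonneg_left h (norm_nonneg _)).trans (le_of_eq ?_)
    ring

/-- The product of a strip slightly wider than a period and a disc. -/
def wideStrip (r : ℝ) : Set (ℂ × ℂ) :=
  {p | -1 < p.1.im ∧ p.1.im < 2 * Real.pi + 1 ∧ ‖p.2‖ < r}

theorem isOpen_im_between (r a b : ℝ) :
    IsOpen {p : ℂ × ℂ | a < p.1.im ∧ p.1.im < b ∧ ‖p.2‖ < r} := by
  have h1 : Continuous fun p : ℂ × ℂ => p.1.im := Complex.continuous_im.comp continuous_fst
  have h2 : Continuous fun p : ℂ × ℂ => ‖p.2‖ := continuous_snd.norm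
  exact (isOpen_lt continuous_const h1).inter
    ((isOpen_lt h1 continuous_const).inter (isOpen_lt h2 continuous_const))

theorem isOpen_wideStrip (r : ℝ) : IsOpen (wideStrip r) := isOpen_im_between r _ _

section

variable {μ M r : ℝ} {J : ℂ × ℂ → ℂ}

theorem differentiableOn_lineTransform {a b c : ℝ} (hμ : 0 < μ) (hc : |c| < 1)
    (hJd : DifferentiableOn ℂ J {p | |p.1.im| < 1 ∧ ‖p.2‖ < r})
    (hJ : ∀ y, ‖y‖ < r → ∀ σ : ℂ, |σ.im| < 1 → ‖J (σ, y)‖ ≤ M * Real.exp (-μ * |σ.re|))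
    (hcos : ∀ y : ℝ, a < y → y < b → Real.cos (y - c) ≤ 9 / 10) :
    DifferentiableOn ℂ (fun p => lineTransform c (fun σ => J (σ, p.2)) p.1)
      {p : ℂ × ℂ | a < p.1.im ∧ p.1.im < b ∧ ‖p.2‖ < r} := by
  have hU := isOpen_im_between r a b
  refine (DifferentiableOn.const_mul (differentiableOn_integral_of_dominated_prod hU ?_ ?_ ?_)
    _).neg
  · intro p hp
    refine (continuous_lineIntegrand hc ?_ (hcos _ hp.1 hp.2.1)).aestronglyMeasurable
    exact hJd.continuousOn.comp (by fun_prop) fun σ hσ => ⟨hσ, hp.2.2⟩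
  · intro p hp
    refine ⟨_, hU.mem_nhds hp, fun t => 5 / 2 * (M * Real.exp (-μ * |t|)),
      ((integrable_exp_neg_mul_abs hμ).const_mul M).const_mul (5 / 2),
      Eventually.of_forall fun t q hq => ?_⟩
    exact norm_lineIntegrand_le hc (hJ q.2 hq.2.2) (hcos _ hq.1 hq.2.1) t
  · refine Eventually.of_forall fun t => DifferentiableOn.mul ?_ (DifferentiableOn.fun_inv
      (DifferentiableOn.const_sub (DifferentiableOn.cexp (by fun_prop)) _) fun p hp =>
        one_sub_exp_ne_zero (by simpa using hcos _ hp.1 hp.2.1))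
    exact hJd.comp (f := fun p : ℂ × ℂ => ((t : ℂ) + c * Complex.I, p.2)) (by fun_prop)
      fun p hp => ⟨by simpa using hc, hp.2.2⟩

theorem differentiableOn_jumpSolution (hμ : 0 < μ)
    (hJd : DifferentiableOn ℂ J {p | |p.1.im| < 1 ∧ ‖p.2‖ < r})
    (hJ : ∀ y, ‖y‖ < r → ∀ σ : ℂ, |σ.im| < 1 → ‖J (σ, y)‖ ≤ M * Real.exp (-μ * |σ.re|)) :
    DifferentiableOn ℂ (fun p => jumpSolution (fun σ => J (σ, p.2)) p.1) (wideStrip r) := by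
  have hpi := Real.pi_gt_three
  have b1 : |(-(1 / 2) : ℝ)| < 1 := by norm_num [abs_lt]
  have b2 : |(1 / 2 : ℝ)| < 1 := by norm_num [abs_lt]
  have hd : ∀ y, ‖y‖ < r → DifferentiableOn ℂ (fun σ => J (σ, y)) {σ | |σ.im| < 1} := fun y hy =>
    hJd.comp (f := fun σ : ℂ => (σ, y)) (by fun_prop) fun σ hσ => ⟨hσ, hy⟩
  have glue : ∀ (a b : ℝ) (f : ℂ × ℂ → ℂ) (p : ℂ × ℂ), a < p.1.im → p.1.im < b → ‖p.2‖ < r →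
      DifferentiableOn ℂ f {p : ℂ × ℂ | a < p.1.im ∧ p.1.im < b ∧ ‖p.2‖ < r} →
      (∀ q : ℂ × ℂ, a < q.1.im → q.1.im < b → ‖q.2‖ < r →
        jumpSolution (fun σ => J (σ, q.2)) q.1 = f q) →
      DifferentiableWithinAt ℂ (fun p => jumpSolution (fun σ => J (σ, p.2)) p.1)
        (wideStrip r) p := by
    intro a b f p h1 h2 h3 hf he
    have hn := (isOpen_im_between r a b).mem_nhds (show p ∈ _ from ⟨h1, h2, h3⟩)
    refine ((hf.differentiableAt hn).congr_of_eventuallyEq ?_).differentiableWithinAt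
    filter_upwards [hn] with q hq using he q hq.1 hq.2.1 hq.2.2
  rintro p ⟨h1, h2, h3⟩
  rcases lt_or_ge p.1.im 0 with h | h
  · refine glue (-1) (1 / 100) _ p h1 (by linarith) h3
      ((differentiableOn_lineTransform hμ b2 hJd hJ fun y => cos_le_of_lower).sub
        (hJd.mono fun q hq => ⟨abs_lt.2 ⟨hq.1, by linarith [hq.2.1]⟩, hq.2.2⟩))
      fun q hq1 hq2 hq3 => ?_
    exact jumpSolution_eq_of_lower hμ (hd _ hq3) (hJ _ hq3) hq2
  rcases lt_or_ge p.1.im Real.pi with h' | h'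
  · refine glue (-(1 / 100)) (Real.pi + 1 / 100) _ p (by linarith) (by linarith) h3
      (differentiableOn_lineTransform hμ b1 hJd hJ fun y => cos_le_of_lower_middle)
      fun q hq1 hq2 hq3 => ?_
    exact jumpSolution_eq_of_lower_middle hμ (hd _ hq3) (hJ _ hq3) hq1 hq2
  rcases lt_or_ge p.1.im (2 * Real.pi) with h'' | h''
  · refine glue (Real.pi - 1 / 100) (2 * Real.pi + 1 / 100) _ p (by linarith) (by linarith) h3
      (differentiableOn_lineTransform hμ b2 hJd hJ fun y => cos_le_of_upper_middle)
      fun q hq1 hq2 hq3 => ?_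
    exact jumpSolution_eq_of_upper_middle hμ (hd _ hq3) (hJ _ hq3) hq1 hq2
  · refine glue (2 * Real.pi - 1 / 100) (2 * Real.pi + 1) _ p (by linarith) h2 h3
      ((differentiableOn_lineTransform hμ b1 hJd hJ fun y => cos_le_of_upper).add
        (hJd.comp (f := fun q : ℂ × ℂ => (q.1 - twoPiI, q.2)) (by fun_prop)
          fun q hq => ⟨abs_lt.2 ⟨?_, ?_⟩, hq.2.2⟩)) fun q hq1 hq2 hq3 => ?_
    · have := hq.1
      simp; linarith
    · have := hq.2.1
      simp; linarith
    · exact jumpSolution_eq_of_upper hμ (hd _ hq3) (hJ _ hq3) hq1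

end

/-- The first integral factor of the model saddle in the logarithmic coordinate. -/
noncomputable def modelFactor (μ : ℝ) (z : ℂ) : ℂ := Complex.exp (μ * (z - Complex.exp z))

theorem differentiable_modelFactor (μ : ℝ) : Differentiable ℂ (modelFactor μ) := by
  unfold modelFactor
  fun_prop

theorem norm_modelFactor_le {μ : ℝ} (hμ : 0 < μ) {z : ℂ} (hz : |z.im| < 1) :
    ‖modelFactor μ z‖ ≤ Real.exp (2 * μ) * Real.exp (-μ * |z.re|) := by
  have h1 : 1 / 2 ≤ Real.cos z.im := by
    have := Real.one_sub_sq_div_two_le_cos (x := z.im)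
    have : z.im ^ 2 < 1 := (sq_lt_one_iff_abs_lt_one _).2 hz
    linarith
  have h2 : z.re - Real.exp z.re * Real.cos z.im ≤ 2 - |z.re| := by
    have h3 := Real.exp_pos z.re
    have h4 : Real.exp z.re * (1 / 2) ≤ Real.exp z.re * Real.cos z.im :=
      mul_le_mul_of_nonneg_left h1 h3.le
    rcases le_total z.re 0 with h | h
    · rw [abs_of_nonpos h]; linarith
    · rw [abs_of_nonneg h]
      have h5 : 4 * (z.re - 1) ≤ Real.exp z.re := by
        rcases le_total z.re 1 with h' | h'
        · linarith
        · have e : Real.exp z.re = Real.exp 1 * Real.exp 1 * Real.exp (z.re - 2) := by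
            rw [← Real.exp_add, ← Real.exp_add]; congr 1; ring
          have e1 : 2 ≤ Real.exp 1 := by linarith [Real.add_one_le_exp (1 : ℝ)]
          have e2 : z.re - 1 ≤ Real.exp (z.re - 2) := by linarith [Real.add_one_le_exp (z.re - 2)]
          rw [e]
          exact mul_le_mul (by nlinarith) e2 (by linarith) (by positivity)
      linarith
  rw [modelFactor, Complex.norm_exp, ← Real.exp_add, Real.exp_le_exp]
  simp only [Complex.mul_re, Complex.ofReal_re, Complex.ofReal_im, Complex.sub_re, Complex.exp_re,
    zero_mul, sub_zero]
  nlinarith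

theorem exists_jump_fixedPoint {μ ρ A r : ℝ} (hμ : 0 < μ) (hA : 0 ≤ A) (hr : 0 < r)
    {a : ℂ → ℂ} (had : DifferentiableOn ℂ a (ball 0 ρ)) (ha0 : a 0 = 0)
    (hal : ∀ c ∈ ball (0 : ℂ) ρ, ∀ c' ∈ ball (0 : ℂ) ρ, ‖a c - a c'‖ ≤ A * ‖c - c'‖)
    (hrρ : r * Real.exp (1 + 2 * μ) ≤ ρ)
    (hrA : jumpBound μ * (A * (r * Real.exp (1 + 2 * μ))) ≤ 1 / 2) :
    ∃ (v : ℂ × ℂ → ℂ) (ψ : ℝ → ℝ), DifferentiableOn ℂ v (wideStrip r) ∧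
      (∀ p ∈ wideStrip r, ‖v p‖ ≤ 1) ∧ (∀ z, (z, 0) ∈ wideStrip r → v (z, 0) = 0) ∧
      (∀ z y : ℂ, |z.im| < 1 → ‖y‖ < r →
        ‖y * Complex.exp (v (z, y)) * modelFactor μ z‖ < ρ ∧
        v (z + twoPiI, y) = v (z, y) + a (y * Complex.exp (v (z, y)) * modelFactor μ z)) ∧
      Tendsto ψ atTop (𝓝 0) ∧
      ∀ (R : ℝ) (y : ℂ), ‖y‖ < r → ‖v (R + Real.pi * Complex.I, y)‖ ≤ ψ R := by
  have hpi := Real.pi_gt_three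
  set B := Real.exp (1 + 2 * μ) with hB
  have hB' : B = Real.exp 1 * Real.exp (2 * μ) := by rw [hB, Real.exp_add]
  have hBpos : 0 < B := Real.exp_pos _
  have hρ : 0 < ρ := lt_of_lt_of_le (by positivity) hrρ
  let c : (ℂ × ℂ → ℂ) → ℂ × ℂ → ℂ := fun v p => p.2 * Complex.exp (v p) * modelFactor μ p.1
  let J : (ℂ × ℂ → ℂ) → ℂ × ℂ → ℂ := fun v p => a (c v p)
  let G : (ℂ × ℂ → ℂ) → ℂ × ℂ → ℂ := fun v p => jumpSolution (fun σ => J v (σ, p.2)) p.1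
  have hsub : {p : ℂ × ℂ | |p.1.im| < 1 ∧ ‖p.2‖ < r} ⊆ wideStrip r := fun p hp =>
    ⟨(abs_lt.1 hp.1).1, by linarith [(abs_lt.1 hp.1).2], hp.2⟩
  have hc1 : ∀ v : ℂ × ℂ → ℂ, (∀ p ∈ wideStrip r, ‖v p‖ ≤ 1) → ∀ p : ℂ × ℂ, |p.1.im| < 1 →
      ‖p.2‖ < r → ‖c v p‖ ≤ ‖p.2‖ * B * Real.exp (-μ * |p.1.re|) := by
    intro v hv p hp1 hp2
    simp only [c, norm_mul]
    rw [hB', ← mul_assoc, mul_assoc (‖p.2‖ * Real.exp 1)]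
    have h1 : ‖Complex.exp (v p)‖ ≤ Real.exp 1 := by
      rw [Complex.norm_exp, Real.exp_le_exp]
      exact (Complex.re_le_norm _).trans (hv p (hsub ⟨hp1, hp2⟩))
    have h2 := norm_modelFactor_le hμ hp1
    gcongr
  have hexp1 : ∀ x : ℝ, Real.exp (-μ * |x|) ≤ 1 := fun x =>
    Real.exp_le_one_iff.2 (by nlinarith [abs_nonneg x])
  have hc2 : ∀ v : ℂ × ℂ → ℂ, (∀ p ∈ wideStrip r, ‖v p‖ ≤ 1) → ∀ p : ℂ × ℂ, |p.1.im| < 1 →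
      ‖p.2‖ < r → ‖c v p‖ < ρ := by
    intro v hv p hp1 hp2
    calc ‖c v p‖ ≤ ‖p.2‖ * B * Real.exp (-μ * |p.1.re|) := hc1 v hv p hp1 hp2
      _ ≤ ‖p.2‖ * B := mul_le_of_le_one_right (by positivity) (hexp1 _)
      _ < r * B := by gcongr
      _ ≤ ρ := hrρ
  have hJb : ∀ v : ℂ × ℂ → ℂ, (∀ p ∈ wideStrip r, ‖v p‖ ≤ 1) → ∀ y : ℂ, ‖y‖ < r → ∀ σ : ℂ,
      |σ.im| < 1 → ‖J v (σ, y)‖ ≤ A * (r * B) * Real.exp (-μ * |σ.re|) := by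
    intro v hv y hy σ hσ
    have h1 := hal _ (mem_ball_zero_iff.2 (hc2 v hv (σ, y) hσ hy)) 0 (mem_ball_self hρ)
    rw [ha0, sub_zero, sub_zero] at h1
    refine h1.trans ?_
    rw [mul_assoc]
    refine mul_le_mul_of_nonneg_left ((hc1 v hv (σ, y) hσ hy).trans ?_) hA
    gcongr
  have hJd : ∀ v : ℂ × ℂ → ℂ, DifferentiableOn ℂ v (wideStrip r) →
      (∀ p ∈ wideStrip r, ‖v p‖ ≤ 1) →
      DifferentiableOn ℂ (J v) {p | |p.1.im| < 1 ∧ ‖p.2‖ < r} := by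
    intro v hvd hv
    refine had.comp ?_ fun p hp => mem_ball_zero_iff.2 (hc2 v hv p hp.1 hp.2)
    have e1 : DifferentiableOn ℂ (fun p : ℂ × ℂ => p.2) {p | |p.1.im| < 1 ∧ ‖p.2‖ < r} := by
      fun_prop
    exact (e1.mul (hvd.mono hsub).cexp).mul
      ((differentiable_modelFactor μ).comp differentiable_fst).differentiableOn
  have hcont : ∀ v : ℂ × ℂ → ℂ, DifferentiableOn ℂ v (wideStrip r) →
      (∀ p ∈ wideStrip r, ‖v p‖ ≤ 1) → ∀ y : ℂ, ‖y‖ < r →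
      ContinuousOn (fun σ => J v (σ, y)) {σ | |σ.im| < 1} := fun v hvd hv y hy =>
    (hJd v hvd hv).continuousOn.comp (by fun_prop) fun σ hσ => ⟨hσ, hy⟩
  have hM0 : 0 ≤ A * (r * B) := by positivity
  obtain ⟨v, hvd, hvb, hve⟩ := exists_fixedPoint_of_half_lipschitz (Ω := wideStrip r)
    (H := {f : ℂ × ℂ → ℂ | DifferentiableOn ℂ f (wideStrip r)}) (differentiableOn_const (0 : ℂ))
    (fun F f hF hu => hu.differentiableOn_prod (isOpen_wideStrip r) hF) zero_le_one (G := G)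
    (fun f hf hfb => ⟨differentiableOn_jumpSolution hμ (hJd f hf hfb) (hJb f hfb), fun p hp => by
      have := norm_jumpSolution_le (z := p.1) hμ hM0 (hJb f hfb p.2 hp.2.2) hp.1 hp.2.1
      exact this.trans (hrA.trans (by norm_num))⟩)
    (fun f hf g hg hfb hgb d hfg p hp => by
      have hd0 : 0 ≤ d := (norm_nonneg _).trans (hfg p hp)
      have key := norm_jumpSolution_sub_le (z := p.1) hμ (d := A * (r * B) * d) (by positivity)
        (hcont f hf hfb p.2 hp.2.2) (hJb f hfb p.2 hp.2.2)
        (hcont g hg hgb p.2 hp.2.2) (hJb g hgb p.2 hp.2.2) (fun σ hσ => by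
          have hq : (σ, p.2) ∈ wideStrip r := hsub ⟨hσ, hp.2.2⟩
          refine (hal _ (mem_ball_zero_iff.2 (hc2 f hfb (σ, p.2) hσ hp.2.2)) _
            (mem_ball_zero_iff.2 (hc2 g hgb (σ, p.2) hσ hp.2.2))).trans ?_
          have e : c f (σ, p.2) - c g (σ, p.2) = p.2 * (Complex.exp (f (σ, p.2)) -
            Complex.exp (g (σ, p.2))) * modelFactor μ σ := by simp only [c]; ring
          have e1 := norm_exp_sub_exp_le (hfb _ hq) (hgb _ hq)
          have e2 := norm_modelFactor_le hμ hσ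
          have e3 := hfg _ hq
          rw [e, norm_mul, norm_mul, mul_assoc A, mul_assoc A, hB']
          refine mul_le_mul_of_nonneg_left ?_ hA
          calc ‖p.2‖ * ‖Complex.exp (f (σ, p.2)) - Complex.exp (g (σ, p.2))‖ * ‖modelFactor μ σ‖
              ≤ r * (Real.exp 1 * d) * (Real.exp (2 * μ) * Real.exp (-μ * |σ.re|)) := by
                have := hp.2.2.le
                have h5 := e1.trans (mul_le_mul_of_nonneg_left e3 (Real.exp_pos 1).le)
                exact mul_le_mul (mul_le_mul this h5 (norm_nonneg _) hr.le) e2 (norm_nonneg _)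
                  (by positivity)
            _ = r * (Real.exp 1 * Real.exp (2 * μ)) * d * Real.exp (-μ * |σ.re|) := by ring)
        hp.1 hp.2.1
      refine key.trans ?_
      calc jumpBound μ * (A * (r * B) * d) = jumpBound μ * (A * (r * B)) * d := by ring
        _ ≤ 1 / 2 * d := by gcongr
        _ = d / 2 := by ring)
  obtain ⟨ψ, hψ, hψb⟩ := exists_jumpSolution_decay hμ
  refine ⟨v, fun R => A * (r * B) * ψ R, hvd, hvb, fun z hz => ?_, fun z y hz hy => ⟨hc2 v hvb (z, y) hz hy, ?_⟩,
    by simpa using hψ.const_mul (A * (r * B)), fun R y hy => ?_⟩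
  · have h := norm_jumpSolution_le (j := fun σ => J v (σ, 0)) (z := z) hμ le_rfl
      (fun σ _ => by simp [J, c, ha0]) hz.1 hz.2.1
    rw [mul_zero] at h
    rw [← hve _ hz]
    exact norm_le_zero_iff.1 h
  · obtain ⟨hz1, hz2⟩ := abs_lt.1 hz
    have m1 : (z, y) ∈ wideStrip r := hsub ⟨hz, hy⟩
    have m2 : (z + twoPiI, y) ∈ wideStrip r := by
      refine ⟨?_, ?_, hy⟩ <;> simp <;> linarith
    have e1 := hve _ m1
    rw [← hve _ m2]
    simp only [G] at e1 ⊢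
    rw [jumpSolution_add_twoPiI _ hz1 hz2, e1]
  · have m : ((R : ℂ) + Real.pi * Complex.I, y) ∈ wideStrip r := by
      refine ⟨?_, ?_, hy⟩ <;> simp <;> linarith
    rw [← hve _ m]
    exact hψb _ _ (hJb v hvb y hy) R

theorem twoPiI_eq : twoPiI = 2 * Real.pi * Complex.I := by
  rw [twoPiI]; push_cast; ring

/-- A `2πi`-periodic function of `z` is a function of `x = -exp z`. -/
theorem exists_descent {S D : Set ℂ} (hS : IsOpen S) (hD : IsOpen D) {F : ℂ × ℂ → ℂ}
    (hF : DifferentiableOn ℂ F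
      {p | -1 < p.1.im ∧ p.1.im < 2 * Real.pi + 1 ∧ -Complex.exp p.1 ∈ S ∧ p.2 ∈ D})
    (hper : ∀ z y : ℂ, |z.im| < 1 → -Complex.exp z ∈ S → y ∈ D → F (z + twoPiI, y) = F (z, y)) :
    ∃ G : ℂ × ℂ → ℂ, DifferentiableOn ℂ G ((S \ {0}) ×ˢ D) ∧
      ∀ z y : ℂ, -1 < z.im → z.im < 2 * Real.pi + 1 → -Complex.exp z ∈ S → y ∈ D →
        G (-Complex.exp z, y) = F (z, y) := by
  have hpi := Real.pi_gt_three
  have hopen : IsOpen {p : ℂ × ℂ | -1 < p.1.im ∧ p.1.im < 2 * Real.pi + 1 ∧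
      -Complex.exp p.1 ∈ S ∧ p.2 ∈ D} := by
    have h1 : Continuous fun p : ℂ × ℂ => p.1.im := Complex.continuous_im.comp continuous_fst
    have h2 : Continuous fun p : ℂ × ℂ => -Complex.exp p.1 :=
      (Complex.continuous_exp.comp continuous_fst).neg
    exact (isOpen_lt continuous_const h1).inter ((isOpen_lt h1 continuous_const).inter
      ((hS.preimage h2).inter (hD.preimage continuous_snd)))
  let ℓ : ℂ → ℂ := fun x => Complex.log x + Real.pi * Complex.I
  have hℓe : ∀ x, x ≠ 0 → Complex.exp (ℓ x) = -x := fun x hx => by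
    simp only [ℓ]
    rw [Complex.exp_add, Complex.exp_log hx, Complex.exp_pi_mul_I, mul_neg_one]
  have hℓ1 : ∀ x, 0 < (ℓ x).im := fun x => by
    have := Complex.neg_pi_lt_log_im x
    simp [ℓ]; linarith
  have hℓ2 : ∀ x, (ℓ x).im ≤ 2 * Real.pi := fun x => by
    have := Complex.log_im_le_pi x
    simp [ℓ]; linarith
  have key : ∀ z y : ℂ, -1 < z.im → z.im < 2 * Real.pi + 1 → -Complex.exp z ∈ S → y ∈ D →
      F (ℓ (-Complex.exp z), y) = F (z, y) := by
    intro z y h1 h2 h3 h4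
    set w := ℓ (-Complex.exp z) with hw
    have hwe : Complex.exp w = Complex.exp z := by
      rw [hw, hℓe _ (neg_ne_zero.2 (Complex.exp_ne_zero z)), neg_neg]
    obtain ⟨n, hn⟩ := Complex.exp_eq_exp_iff_exists_int.1 hwe
    rw [← twoPiI_eq] at hn
    have hi : w.im = z.im + n * (2 * Real.pi) := by
      rw [hn]; simp
    have w1 : 0 < w.im := hℓ1 _
    have w2 : w.im ≤ 2 * Real.pi := hℓ2 _
    have n1 : n < 2 := by
      have : (n : ℝ) < 2 := by by_contra! h; nlinarith
      exact_mod_cast this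
    have n2 : -2 < n := by
      have : (-2 : ℝ) < n := by by_contra! h; nlinarith
      exact_mod_cast this
    have hcases : n = -1 ∨ n = 0 ∨ n = 1 := by omega
    rcases hcases with rfl | rfl | rfl
    · have e : z = w + twoPiI := by rw [hn]; push_cast; ring
      rw [e]
      refine (hper w y (abs_lt.2 ⟨by linarith, ?_⟩) (by rw [hwe]; exact h3) h4).symm
      push_cast at hi
      linarith
    · have e : w = z := by rw [hn]; simp
      rw [e]
    · have e : w = z + twoPiI := by rw [hn]; simp
      rw [e]
      refine hper z y (abs_lt.2 ⟨h1, ?_⟩) h3 h4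
      push_cast at hi
      linarith
  refine ⟨fun p => F (ℓ p.1, p.2), ?_, key⟩
  rintro ⟨x, y⟩ ⟨⟨hxS, hx0⟩, hy⟩
  have hx0 : x ≠ 0 := hx0
  refine DifferentiableAt.differentiableWithinAt ?_
  by_cases hx : x ∈ Complex.slitPlane
  · have hm : (ℓ x, y) ∈ {p : ℂ × ℂ | -1 < p.1.im ∧ p.1.im < 2 * Real.pi + 1 ∧
        -Complex.exp p.1 ∈ S ∧ p.2 ∈ D} :=
      ⟨by linarith [hℓ1 x], by linarith [hℓ2 x], by rw [hℓe x hx0, neg_neg]; exact hxS, hy⟩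
    refine DifferentiableAt.comp (f := fun p : ℂ × ℂ => (ℓ p.1, p.2)) (x, y)
      (hF.differentiableAt (hopen.mem_nhds hm)) ?_
    exact ((differentiableAt_fst.clog hx).add_const _).prodMk differentiableAt_snd
  · have hx' : -x ∈ Complex.slitPlane := by
      rw [Complex.mem_slitPlane_iff_not_le_zero, not_not] at hx
      rw [Complex.mem_slitPlane_iff]
      left
      have h1 := (Complex.le_def.1 hx).1
      have h2 := (Complex.le_def.1 hx).2
      simp only [Complex.zero_re, Complex.zero_im] at h1 h2
      rcases h1.lt_or_eq with h | h
      · simpa using h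
      · exact absurd (Complex.ext h h2) hx0
    have him : (Complex.log (-x)).im = 0 := by
      rw [Complex.mem_slitPlane_iff_not_le_zero, not_not] at hx
      have h2 := (Complex.le_def.1 hx).2
      have h1 := (Complex.le_def.1 hx).1
      rw [Complex.log_im, Complex.arg_eq_zero_iff]
      simp only [Complex.zero_re, Complex.zero_im] at h1 h2
      exact ⟨by simpa using h1, by simpa using h2⟩
    have hle : ∀ w : ℂ, w ≠ 0 → -Complex.exp (Complex.log (-w)) = w := fun w hw => by
      rw [Complex.exp_log (neg_ne_zero.2 hw), neg_neg]
    have hm : (Complex.log (-x), y) ∈ {p : ℂ × ℂ | -1 < p.1.im ∧ p.1.im < 2 * Real.pi + 1 ∧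
        -Complex.exp p.1 ∈ S ∧ p.2 ∈ D} :=
      ⟨by rw [him]; norm_num, by rw [him]; linarith, by rw [hle x hx0]; exact hxS, hy⟩
    have hdl : DifferentiableAt ℂ (fun p : ℂ × ℂ => (Complex.log (-p.1), p.2)) (x, y) :=
      (differentiableAt_fst.fun_neg.clog hx').prodMk differentiableAt_snd
    have hcomp := DifferentiableAt.comp (f := fun p : ℂ × ℂ => (Complex.log (-p.1), p.2)) (x, y)
      (hF.differentiableAt (hopen.mem_nhds hm)) hdl
    refine hcomp.congr_of_eventuallyEq ?_
    have hne : ∀ᶠ p : ℂ × ℂ in 𝓝 (x, y), p.1 ≠ 0 :=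
      (continuous_fst.tendsto (x, y)).eventually (isOpen_ne.mem_nhds hx0)
    filter_upwards [hne, hdl.continuousAt.eventually (hopen.mem_nhds hm)] with p hp1 hp2
    have := key (Complex.log (-p.1)) p.2 hp2.1 hp2.2.1 hp2.2.2.1 hp2.2.2.2
    rw [hle _ hp1] at this
    exact this

theorem eq_const_of_periodic {F : ℂ → ℂ} {C : ℝ}
    (hF : DifferentiableOn ℂ F {z | -1 < z.im ∧ z.im < 2 * Real.pi + 1})
    (hper : ∀ z : ℂ, |z.im| < 1 → F (z + twoPiI) = F z)
    (hb : ∀ z : ℂ, 0 < z.im → z.im ≤ 2 * Real.pi → ‖F z‖ ≤ C * (1 + ‖Complex.exp z‖))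
    (hlim : Tendsto (fun R : ℝ => F (R + Real.pi * Complex.I) * Complex.exp (-R)) atTop (𝓝 0)) :
    ∃ k, ∀ z : ℂ, -1 < z.im → z.im < 2 * Real.pi + 1 → F z = k := by
  have hpi := Real.pi_gt_three
  obtain ⟨G, hGd, hGe⟩ := exists_descent (S := univ) (D := univ) isOpen_univ isOpen_univ
    (F := fun p => F p.1) (hF.comp differentiableOn_fst fun p hp => ⟨hp.1, hp.2.1⟩)
    (fun z y hz _ _ => hper z hz)
  let g : ℂ → ℂ := fun x => G (x, 0)
  have hge : ∀ z : ℂ, -1 < z.im → z.im < 2 * Real.pi + 1 → g (-Complex.exp z) = F z :=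
    fun z h1 h2 => hGe z 0 h1 h2 trivial trivial
  have hgd : ∀ x, x ≠ 0 → DifferentiableAt ℂ g x := fun x hx => by
    have h1 : DifferentiableOn ℂ g {0}ᶜ :=
      hGd.comp (f := fun x : ℂ => (x, (0 : ℂ))) (by fun_prop) fun x hx => ⟨⟨trivial, hx⟩, trivial⟩
    exact h1.differentiableAt (isOpen_compl_singleton.mem_nhds hx)
  have hgb : ∀ x, x ≠ 0 → ‖g x‖ ≤ C * (1 + ‖x‖) := fun x hx => by
    have e : Complex.exp (Complex.log x + Real.pi * Complex.I) = -x := by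
      rw [Complex.exp_add, Complex.exp_log hx, Complex.exp_pi_mul_I, mul_neg_one]
    have h1 := Complex.neg_pi_lt_log_im x
    have h2 := Complex.log_im_le_pi x
    have hi : (Complex.log x + Real.pi * Complex.I).im = (Complex.log x).im + Real.pi := by simp
    have h3 := hge (Complex.log x + Real.pi * Complex.I) (by rw [hi]; linarith)
      (by rw [hi]; linarith)
    have h4 := hb (Complex.log x + Real.pi * Complex.I) (by rw [hi]; linarith)
      (by rw [hi]; linarith)
    rw [e, neg_neg] at h3
    rwa [← h3, e, norm_neg] at h4
  have hC : 0 ≤ C := by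
    have := (norm_nonneg _).trans (hgb 1 one_ne_zero)
    rw [norm_one] at this
    linarith
  let k := limUnder (𝓝[≠] (0 : ℂ)) g
  let g' := Function.update g 0 k
  have hg'e : ∀ x, x ≠ 0 → g' x = g x := fun x hx => Function.update_of_ne hx _ _
  have hg'd : Differentiable ℂ g' := by
    intro x
    by_cases hx : x = 0
    · subst hx
      have h1 := Complex.differentiableOn_update_limUnder_of_bddAbove
        (ball_mem_nhds (0 : ℂ) one_pos)
        (fun x hx => (hgd x hx.2).differentiableWithinAt) (by
          refine ⟨C * (1 + 1), ?_⟩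
          rintro _ ⟨x, hx, rfl⟩
          refine (hgb x hx.2).trans ?_
          have := (mem_ball_zero_iff.1 hx.1).le
          gcongr)
      exact h1.differentiableAt (ball_mem_nhds (0 : ℂ) one_pos)
    · refine (hgd x hx).congr_of_eventuallyEq ?_
      filter_upwards [isOpen_ne.mem_nhds hx] with w hw using hg'e w hw
  have hsd : Differentiable ℂ (dslope g' 0) := by
    rw [← differentiableOn_univ]
    exact (Complex.differentiableOn_dslope univ_mem).2 hg'd.differentiableOn
  have hsne : ∀ x, x ≠ 0 → dslope g' 0 x = (g x - g' 0) * x⁻¹ := fun x hx => by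
    rw [dslope_of_ne _ hx, slope_def_field, hg'e x hx, sub_zero, div_eq_mul_inv]
  have hbdd : Bornology.IsBounded (range (dslope g' 0)) := by
    obtain ⟨B, hB⟩ := (isCompact_closedBall (0 : ℂ) 1).exists_bound_of_continuousOn
      hsd.continuous.continuousOn
    refine (isBounded_iff_forall_norm_le).2 ⟨max B (2 * C + ‖g' 0‖), ?_⟩
    rintro _ ⟨x, rfl⟩
    rcases le_or_gt ‖x‖ 1 with h | h
    · exact (hB x (mem_closedBall_zero_iff.2 h)).trans (le_max_left _ _)
    · refine le_trans ?_ (le_max_right _ _)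
      have hx : x ≠ 0 := fun h0 => by rw [h0, norm_zero] at h; linarith
      rw [hsne x hx, norm_mul, norm_inv, ← div_eq_mul_inv, div_le_iff₀ (by linarith)]
      have h1 := norm_sub_le (g x) (g' 0)
      have h2 := hgb x hx
      nlinarith [norm_nonneg (g' 0)]
  have hconst : ∀ x, dslope g' 0 x = 0 := by
    intro x
    have h1 : Tendsto (fun R : ℝ => dslope g' 0 (Complex.exp R)) atTop (𝓝 0) := by
      have h2 : Tendsto (fun R : ℝ => Complex.exp (-R)) atTop (𝓝 0) := by
        rw [tendsto_zero_iff_norm_tendsto_zero]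
        have : ∀ R : ℝ, ‖Complex.exp (-R)‖ = Real.exp (-R) := fun R => by
          rw [Complex.norm_exp]; simp
        simp only [this]
        exact Real.tendsto_exp_neg_atTop_nhds_zero
      have h3 := hlim.sub (h2.const_mul (g' 0))
      rw [mul_zero, sub_zero] at h3
      refine h3.congr fun R => ?_
      have e : -Complex.exp (R + Real.pi * Complex.I) = Complex.exp R := by
        rw [Complex.exp_add, Complex.exp_pi_mul_I, mul_neg_one, neg_neg]
      have h4 := hge (R + Real.pi * Complex.I) (by simp; linarith) (by simp; linarith)
      rw [e] at h4
      rw [hsne _ (Complex.exp_ne_zero _), h4, Complex.exp_neg]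
      ring
    have h2 : ∀ R : ℝ, dslope g' 0 (Complex.exp R) = dslope g' 0 x := fun R =>
      hsd.apply_eq_apply_of_bounded hbdd _ _
    simp only [h2] at h1
    exact tendsto_nhds_unique tendsto_const_nhds h1
  refine ⟨g' 0, fun z h1 h2 => ?_⟩
  have h3 := hconst (-Complex.exp z)
  have hne : -Complex.exp z ≠ 0 := neg_ne_zero.2 (Complex.exp_ne_zero z)
  rw [hsne _ hne, mul_eq_zero] at h3
  rcases h3 with h | h
  · rw [← hge z h1 h2]
    exact sub_eq_zero.1 h
  · exact absurd h (inv_ne_zero hne)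

theorem DifferentiableAt.hasDerivAt_fst {v : ℂ × ℂ → ℂ} {z y : ℂ}
    (hv : DifferentiableAt ℂ v (z, y)) :
    HasDerivAt (fun z => v (z, y)) (fderiv ℂ v (z, y) (1, 0)) z :=
  HasFDerivAt.comp_hasDerivAt (f := fun z : ℂ => (z, y)) z hv.hasFDerivAt
    ((hasDerivAt_id z).prodMk (hasDerivAt_const z y))

theorem DifferentiableAt.hasDerivAt_snd {v : ℂ × ℂ → ℂ} {z y : ℂ}
    (hv : DifferentiableAt ℂ v (z, y)) :
    HasDerivAt (fun y => v (z, y)) (fderiv ℂ v (z, y) (0, 1)) y :=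
  HasFDerivAt.comp_hasDerivAt (f := fun y : ℂ => (z, y)) y hv.hasFDerivAt
    ((hasDerivAt_const y z).prodMk (hasDerivAt_id y))

theorem DifferentiableOn.fderiv_prod_apply {U : Set (ℂ × ℂ)} (hU : IsOpen U) {v : ℂ × ℂ → ℂ}
    (hv : DifferentiableOn ℂ v U) (w : ℂ × ℂ) :
    DifferentiableOn ℂ (fun p => fderiv ℂ v p w) U :=
  ((hv.analyticOnNhd_prod hU).fderiv.differentiableOn).clm_apply (differentiableOn_const w)

theorem hasDerivAt_modelFactor (μ : ℝ) (z : ℂ) :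
    HasDerivAt (modelFactor μ) (modelFactor μ z * (μ * (1 - Complex.exp z))) z :=
  (((hasDerivAt_id z).sub (Complex.hasDerivAt_exp z)).const_mul (μ : ℂ)).cexp

/-- The logarithmic derivatives of the first integral `y * exp v * modelFactor` in the two
variables are multiplied by the same factor along a `2πi`-translation. -/
theorem exists_deriv_monodromy {μ ρ r : ℝ} {a : ℂ → ℂ}
    (had : DifferentiableOn ℂ a (ball 0 ρ)) {v : ℂ × ℂ → ℂ} (hv : DifferentiableOn ℂ v (wideStrip r))
    (hvp : ∀ z y : ℂ, |z.im| < 1 → ‖y‖ < r →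
        ‖y * Complex.exp (v (z, y)) * modelFactor μ z‖ < ρ ∧
        v (z + twoPiI, y) = v (z, y) + a (y * Complex.exp (v (z, y)) * modelFactor μ z))
    {z y : ℂ} (hz : |z.im| < 1) (hy : ‖y‖ < r) :
    ∃ k, fderiv ℂ v (z + twoPiI, y) (1, 0) + μ * (1 - Complex.exp z) =
        (fderiv ℂ v (z, y) (1, 0) + μ * (1 - Complex.exp z)) * k ∧
      1 + y * fderiv ℂ v (z + twoPiI, y) (0, 1) = (1 + y * fderiv ℂ v (z, y) (0, 1)) * k := by
  have hpi := Real.pi_gt_three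
  have hz1 := (abs_lt.1 hz).1
  have hz2 := (abs_lt.1 hz).2
  have hd : ∀ z' : ℂ, -1 < z'.im → z'.im < 2 * Real.pi + 1 → DifferentiableAt ℂ v (z', y) :=
    fun z' h1 h2 => hv.differentiableAt ((isOpen_wideStrip r).mem_nhds ⟨h1, h2, hy⟩)
  have hd0 := hd z hz1 (by linarith)
  have hd1 := hd (z + twoPiI) (by simp; linarith) (by simp; linarith)
  set c := y * Complex.exp (v (z, y)) * modelFactor μ z with hc
  have ha : HasDerivAt a (deriv a c) c :=
    (had.differentiableAt (isOpen_ball.mem_nhds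
      (mem_ball_zero_iff.2 (hvp z y hz hy).1))).hasDerivAt
  refine ⟨1 + deriv a c * c, ?_, ?_⟩
  · have hcz : HasDerivAt (fun z => y * Complex.exp (v (z, y)) * modelFactor μ z)
        (c * (fderiv ℂ v (z, y) (1, 0) + μ * (1 - Complex.exp z))) z :=
      ((hd0.hasDerivAt_fst.cexp.const_mul y).fun_mul (hasDerivAt_modelFactor μ z)).congr_deriv (by
        rw [hc]; ring)
    have h1 : HasDerivAt (fun z => v (z + twoPiI, y)) (fderiv ℂ v (z + twoPiI, y) (1, 0)) z :=
      hd1.hasDerivAt_fst.comp_add_const z twoPiI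
    have h2 := hd0.hasDerivAt_fst.fun_add (HasDerivAt.comp (h₂ := a)
      (h := fun z => y * Complex.exp (v (z, y)) * modelFactor μ z) z ha hcz)
    have hev : (fun z => v (z + twoPiI, y)) =ᶠ[𝓝 z] fun z => v (z, y) +
        (a ∘ fun z => y * Complex.exp (v (z, y)) * modelFactor μ z) z := by
      filter_upwards [(isOpen_lt (continuous_abs.comp Complex.continuous_im)
        continuous_const).mem_nhds hz] with w hw using (hvp w y hw hy).2
    rw [h1.unique (h2.congr_of_eventuallyEq hev)]
    ring
  · have hcy : HasDerivAt (fun y => y * Complex.exp (v (z, y)) * modelFactor μ z)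
        (Complex.exp (v (z, y)) * modelFactor μ z * (1 + y * fderiv ℂ v (z, y) (0, 1))) y :=
      (((hasDerivAt_id y).fun_mul hd0.hasDerivAt_snd.cexp).mul_const (modelFactor μ z)).congr_deriv
        (by simp only [id]; ring)
    have h1 := hd1.hasDerivAt_snd
    have h2 := hd0.hasDerivAt_snd.fun_add (HasDerivAt.comp (h₂ := a)
      (h := fun y => y * Complex.exp (v (z, y)) * modelFactor μ z) y ha hcy)
    have hev : (fun y => v (z + twoPiI, y)) =ᶠ[𝓝 y] fun y => v (z, y) +
        (a ∘ fun y => y * Complex.exp (v (z, y)) * modelFactor μ z) y := by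
      filter_upwards [(isOpen_lt continuous_norm continuous_const).mem_nhds hy] with w hw
        using (hvp z w hz hw).2
    rw [h1.unique (h2.congr_of_eventuallyEq hev), hc]
    ring

theorem norm_fderiv_fst_le {r : ℝ} {v : ℂ × ℂ → ℂ} (hv : DifferentiableOn ℂ v (wideStrip r))
    (hvb : ∀ p ∈ wideStrip r, ‖v p‖ ≤ 1) {z y : ℂ} (hz : 0 < z.im) (hz' : z.im ≤ 2 * Real.pi)
    (hy : ‖y‖ < r) : ‖fderiv ℂ v (z, y) (1, 0)‖ ≤ 2 := by
  have hmem : ∀ w ∈ closedBall z (1 / 2), (w, y) ∈ wideStrip r := fun w hw => by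
    have h1 := (Complex.abs_im_le_norm (w - z)).trans (mem_closedBall_iff_norm.1 hw)
    rw [Complex.sub_im, abs_le] at h1
    exact ⟨by simp only; linarith [h1.1], by simp only; linarith [h1.2], hy⟩
  have hd : ∀ w ∈ closedBall z (1 / 2), DifferentiableAt ℂ (fun z => v (z, y)) w := fun w hw =>
    (hv.differentiableAt ((isOpen_wideStrip r).mem_nhds (hmem w hw))).hasDerivAt_fst.differentiableAt
  have hz0 : z ∈ closedBall z (1 / 2) := mem_closedBall_self (by norm_num)
  have hD := (hv.differentiableAt ((isOpen_wideStrip r).mem_nhds (hmem z hz0))).hasDerivAt_fst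
  have hcl : DifferentiableOn ℂ (fun z => v (z, y)) (closure (ball z (1 / 2))) := by
    rw [closure_ball z (by norm_num : (1 / 2 : ℝ) ≠ 0)]
    exact fun w hw => (hd w hw).differentiableWithinAt
  have := Complex.norm_deriv_le_of_forall_mem_sphere_norm_le (C := 1) (by norm_num)
    hcl.diffContOnCl fun w hw => hvb _ (hmem w (sphere_subset_closedBall hw))
  rw [hD.deriv] at this
  linarith

theorem norm_fderiv_snd_le {r C : ℝ} (hr : 0 < r) {v : ℂ × ℂ → ℂ}
    (hv : DifferentiableOn ℂ v (wideStrip r)) {z y : ℂ} (hz : -1 < z.im)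
    (hz' : z.im < 2 * Real.pi + 1) (hy : ‖y‖ < r / 4) (hvb : ∀ w, ‖w‖ < r → ‖v (z, w)‖ ≤ C) :
    ‖fderiv ℂ v (z, y) (0, 1)‖ ≤ C / (r / 2) := by
  have hmem : ∀ w ∈ closedBall y (r / 2), ‖w‖ < r := fun w hw => by
    have h1 := mem_closedBall_iff_norm.1 hw
    have h2 := norm_add_le (w - y) y
    rw [sub_add_cancel] at h2
    linarith
  have hD : ∀ w ∈ closedBall y (r / 2),
      HasDerivAt (fun y => v (z, y)) (fderiv ℂ v (z, w) (0, 1)) w := fun w hw =>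
    (hv.differentiableAt ((isOpen_wideStrip r).mem_nhds ⟨hz, hz', hmem w hw⟩)).hasDerivAt_snd
  have hcl : DifferentiableOn ℂ (fun y => v (z, y)) (closure (ball y (r / 2))) := by
    rw [closure_ball y (by positivity : r / 2 ≠ 0)]
    exact fun w hw => (hD w hw).differentiableAt.differentiableWithinAt
  have := Complex.norm_deriv_le_of_forall_mem_sphere_norm_le (C := C) (by positivity : 0 < r / 2)
    hcl.diffContOnCl fun w hw => hvb _ (hmem w (sphere_subset_closedBall hw))
  rwa [(hD y (mem_closedBall_self (by positivity))).deriv] at this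

/-- The function `f` of the normal form, obtained from the logarithmic derivatives of a
multivalued first integral. -/
theorem exists_normal_form_function {μ ρ r : ℝ} (hμ : 0 < μ) (hr : 0 < r) {a : ℂ → ℂ}
    (had : DifferentiableOn ℂ a (ball 0 ρ)) {v : ℂ × ℂ → ℂ} {ψ : ℝ → ℝ}
    (hv : DifferentiableOn ℂ v (wideStrip r)) (hvb : ∀ p ∈ wideStrip r, ‖v p‖ ≤ 1)
    (hv0 : ∀ z, (z, 0) ∈ wideStrip r → v (z, 0) = 0)
    (hvp : ∀ z y : ℂ, |z.im| < 1 → ‖y‖ < r →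
        ‖y * Complex.exp (v (z, y)) * modelFactor μ z‖ < ρ ∧
        v (z + twoPiI, y) = v (z, y) + a (y * Complex.exp (v (z, y)) * modelFactor μ z))
    (hψ : Tendsto ψ atTop (𝓝 0))
    (hvψ : ∀ (R : ℝ) (y : ℂ), ‖y‖ < r → ‖v (R + Real.pi * Complex.I, y)‖ ≤ ψ R) :
    ∃ f : ℂ → ℂ, DifferentiableOn ℂ f (ball 0 (r / 4)) ∧ f 0 = 1 ∧
      ∀ z y : ℂ, -1 < z.im → z.im < 2 * Real.pi + 1 → ‖y‖ < r / 4 →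
        fderiv ℂ v (z, y) (1, 0) + μ * (1 - Complex.exp z) =
          μ * (f y - Complex.exp z) * (1 + y * fderiv ℂ v (z, y) (0, 1)) := by
  have hpi := Real.pi_gt_three
  set N : ℂ × ℂ → ℂ := fun p => fderiv ℂ v p (1, 0) + μ * (1 - Complex.exp p.1) with hN
  set M : ℂ × ℂ → ℂ := fun p => 1 + p.2 * fderiv ℂ v p (0, 1) with hM
  have hWo := isOpen_wideStrip r
  have hNd : DifferentiableOn ℂ N (wideStrip r) := by
    refine (hv.fderiv_prod_apply hWo _).fun_add (Differentiable.differentiableOn ?_)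
    exact (differentiable_fst.cexp.const_sub 1).const_mul _
  have hMd : DifferentiableOn ℂ M (wideStrip r) :=
    (differentiableOn_snd.fun_mul (hv.fderiv_prod_apply hWo _)).const_add 1
  have hMe : ∀ z y : ℂ, -1 < z.im → z.im < 2 * Real.pi + 1 → ‖y‖ < r / 4 →
      ‖y * fderiv ℂ v (z, y) (0, 1)‖ ≤ 1 / 2 := by
    intro z y h1 h2 h3
    have := norm_fderiv_snd_le hr hv h1 h2 h3 fun w hw => hvb _ ⟨h1, h2, hw⟩
    rw [norm_mul]
    calc _ ≤ r / 4 * (1 / (r / 2)) := by gcongr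
      _ = 1 / 2 := by field_simp; norm_num
  have hM1 : ∀ z y : ℂ, -1 < z.im → z.im < 2 * Real.pi + 1 → ‖y‖ < r / 4 →
      1 / 2 ≤ ‖M (z, y)‖ := by
    intro z y h1 h2 h3
    have := norm_sub_norm_le (1 : ℂ) (-(y * fderiv ℂ v (z, y) (0, 1)))
    rw [sub_neg_eq_add, norm_neg, norm_one] at this
    have h4 := hMe z y h1 h2 h3
    simp only [hM]
    linarith
  have hM0 : ∀ z y : ℂ, -1 < z.im → z.im < 2 * Real.pi + 1 → ‖y‖ < r / 4 → M (z, y) ≠ 0 :=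
    fun z y h1 h2 h3 => norm_pos_iff.1 (lt_of_lt_of_le (by norm_num) (hM1 z y h1 h2 h3))
  set F : ℂ × ℂ → ℂ := fun p => N p * (M p)⁻¹ + μ * Complex.exp p.1 with hF
  have hFd : DifferentiableOn ℂ F (wideStrip (r / 4)) := by
    have hsub : wideStrip (r / 4) ⊆ wideStrip r := fun p hp =>
      ⟨hp.1, hp.2.1, hp.2.2.trans (by linarith)⟩
    refine ((hNd.mono hsub).fun_mul ((hMd.mono hsub).fun_inv fun p hp => ?_)).fun_add
      (Differentiable.differentiableOn ?_)
    · exact hM0 p.1 p.2 hp.1 hp.2.1 hp.2.2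
    · exact differentiable_fst.cexp.const_mul _
  have hNb : ∀ z y : ℂ, 0 < z.im → z.im ≤ 2 * Real.pi → ‖y‖ < r / 4 →
      ‖N (z, y)‖ ≤ 2 + μ * (1 + ‖Complex.exp z‖) := by
    intro z y h1 h2 h3
    have hvz := norm_fderiv_fst_le hv hvb h1 h2 (h3.trans (by linarith : r / 4 < r))
    have he : ‖(μ : ℂ) * (1 - Complex.exp z)‖ ≤ μ * (1 + ‖Complex.exp z‖) := by
      rw [norm_mul, Complex.norm_real, Real.norm_of_nonneg hμ.le]
      gcongr
      exact (norm_sub_le _ _).trans (by rw [norm_one])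
    exact (norm_add_le _ _).trans (by gcongr)
  have hconst : ∀ y : ℂ, ‖y‖ < r / 4 → ∃ k, ∀ z : ℂ, -1 < z.im → z.im < 2 * Real.pi + 1 →
      F (z, y) = k := by
    intro y hy
    have hyr : ‖y‖ < r := hy.trans (by linarith)
    refine eq_const_of_periodic (C := 4 + 3 * μ) ?_ ?_ ?_ ?_
    · exact hFd.comp (f := fun z : ℂ => (z, y)) (by fun_prop) fun z hz => ⟨hz.1, hz.2, hy⟩
    · intro z hz
      have hz1 := (abs_lt.1 hz).1
      have hz2 := (abs_lt.1 hz).2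
      obtain ⟨k, hk1, hk2⟩ := exists_deriv_monodromy had hv hvp hz hyr
      have e : Complex.exp (z + twoPiI) = Complex.exp z := by
        rw [Complex.exp_add, exp_twoPiI, mul_one]
      have hN' : N (z + twoPiI, y) = N (z, y) * k := by
        simp only [hN, e]
        exact hk1
      have hM' : M (z + twoPiI, y) = M (z, y) * k := hk2
      have h0 := hM0 (z + twoPiI) y (by simp; linarith) (by simp; linarith) hy
      have h1 := hM0 z y hz1 (by linarith) hy
      have hk : k ≠ 0 := fun h => h0 (by rw [hM', h, mul_zero])
      simp only [hF, e, hN', hM']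
      field_simp
    · intro z h1 h2
      have hb := hNb z y h1 h2 hy
      have hm := hM1 z y (by linarith) (by linarith) hy
      have hmi : ‖(M (z, y))⁻¹‖ ≤ 2 := by
        rw [norm_inv]
        exact inv_le_of_inv_le₀ two_pos (by linarith)
      have hE := norm_nonneg (Complex.exp z)
      calc ‖F (z, y)‖ ≤ ‖N (z, y)‖ * ‖(M (z, y))⁻¹‖ + μ * ‖Complex.exp z‖ := by
            refine (norm_add_le _ _).trans (le_of_eq ?_)
            rw [norm_mul, norm_mul, Complex.norm_real, Real.norm_of_nonneg hμ.le]
        _ ≤ (2 + μ * (1 + ‖Complex.exp z‖)) * 2 + μ * ‖Complex.exp z‖ := by gcongr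
        _ ≤ _ := by nlinarith [mul_nonneg hμ.le hE]
    · have hexp : Tendsto (fun R : ℝ => Complex.exp (-R)) atTop (𝓝 0) := by
        rw [tendsto_zero_iff_norm_tendsto_zero]
        have : ∀ R : ℝ, ‖Complex.exp (-R)‖ = Real.exp (-R) := fun R => by
          rw [Complex.norm_exp]; simp
        simp only [this]
        exact Real.tendsto_exp_neg_atTop_nhds_zero
      have him : ∀ R : ℝ, ((R : ℂ) + Real.pi * Complex.I).im = Real.pi := fun R => by simp
      have hvy : Tendsto (fun R : ℝ => fderiv ℂ v (R + Real.pi * Complex.I, y) (0, 1)) atTop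
          (𝓝 0) := by
        refine squeeze_zero_norm (a := fun R : ℝ => ψ R / (r / 2)) (fun R => ?_) ?_
        · exact norm_fderiv_snd_le hr hv (by rw [him]; linarith) (by rw [him]; linarith) hy
            fun w hw => hvψ R w hw
        · simpa using hψ.div_const (r / 2)
      have hvz : Tendsto (fun R : ℝ => fderiv ℂ v (R + Real.pi * Complex.I, y) (1, 0) *
          Complex.exp (-R)) atTop (𝓝 0) := by
        refine squeeze_zero_norm (a := fun R : ℝ => 2 * ‖Complex.exp (-(R : ℂ))‖) (fun R => ?_) ?_
        · rw [norm_mul]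
          gcongr
          exact norm_fderiv_fst_le hv hvb (by rw [him]; linarith) (by rw [him]; linarith) hyr
        · simpa using hexp.norm.const_mul 2
      have hMt : Tendsto (fun R : ℝ => (M (R + Real.pi * Complex.I, y))⁻¹) atTop (𝓝 1) := by
        have := (hvy.const_mul y).const_add 1
        rw [mul_zero, add_zero] at this
        simpa using this.inv₀ one_ne_zero
      have hlim := ((hvz.add ((hexp.add_const 1).const_mul (μ : ℂ))).mul hMt).sub_const (μ : ℂ)
      have e0 : (0 + (μ : ℂ) * (0 + 1)) * 1 - μ = 0 := by ring
      rw [e0] at hlim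
      refine hlim.congr fun R => ?_
      have e1 : Complex.exp (R + Real.pi * Complex.I) = -Complex.exp R := by
        rw [Complex.exp_add, Complex.exp_pi_mul_I, mul_neg_one]
      have e2 : Complex.exp R * Complex.exp (-R) = 1 := by
        rw [← Complex.exp_add, add_neg_cancel, Complex.exp_zero]
      simp only [hF, hN, e1]
      linear_combination (-μ * (M (R + Real.pi * Complex.I, y))⁻¹ + μ) * e2
  have hpiI : (Real.pi * Complex.I).im = Real.pi := by simp
  refine ⟨fun y => (μ : ℂ)⁻¹ * F (Real.pi * Complex.I, y), ?_, ?_, ?_⟩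
  · refine DifferentiableOn.const_mul ?_ _
    refine hFd.comp (f := fun y : ℂ => ((Real.pi * Complex.I : ℂ), y)) (by fun_prop)
      fun y hy => ⟨?_, ?_, mem_ball_zero_iff.1 hy⟩
    · simp only [hpiI]; linarith
    · simp only [hpiI]; linarith
  · have hmem : ((Real.pi * Complex.I : ℂ), (0 : ℂ)) ∈ wideStrip r :=
      ⟨by simp only [hpiI]; linarith, by simp only [hpiI]; linarith, by simpa using hr⟩
    have h1 := (hv.differentiableAt (hWo.mem_nhds hmem)).hasDerivAt_fst
    have h2 : fderiv ℂ v (Real.pi * Complex.I, 0) (1, 0) = 0 := by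
      refine h1.unique ((hasDerivAt_const _ (0 : ℂ)).congr_of_eventuallyEq ?_)
      filter_upwards [(hWo.slice_fst 0).mem_nhds hmem] with w hw using hv0 w hw
    have hμ' : (μ : ℂ) ≠ 0 := by exact_mod_cast hμ.ne'
    simp only [hF, hN, hM, h2, Complex.exp_pi_mul_I]
    field_simp
    ring
  · intro z y h1 h2 h3
    obtain ⟨k, hk⟩ := hconst y h3
    have hμ' : (μ : ℂ) ≠ 0 := by exact_mod_cast hμ.ne'
    have e1 := hk z h1 h2
    have e2 := hk (Real.pi * Complex.I) (by rw [hpiI]; linarith) (by rw [hpiI]; linarith)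
    have e3 : F (Real.pi * Complex.I, y) = N (z, y) * (M (z, y))⁻¹ + μ * Complex.exp z :=
      e2.trans e1.symm
    have hm := hM0 z y h1 h2 h3
    simp only [e3]
    change N (z, y) = _ * M (z, y)
    field_simp
    ring

theorem norm_modelFactor_le_of_re_neg {μ : ℝ} (hμ : 0 < μ) {z : ℂ} (hz : z.re < 0) :
    ‖modelFactor μ z‖ ≤ Real.exp μ ∧
      ‖modelFactor μ z * Complex.exp (-(μ * z))‖ ≤ Real.exp μ := by
  have h1 : ‖Complex.exp z‖ < 1 := by rw [Complex.norm_exp]; exact Real.exp_lt_one_iff.2 hz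
  have h2 := (abs_le.1 ((Complex.abs_re_le_norm (Complex.exp z)).trans h1.le)).1
  constructor
  · rw [modelFactor, Complex.norm_exp, Real.exp_le_exp, Complex.re_ofReal_mul, Complex.sub_re]
    nlinarith
  · have e : modelFactor μ z * Complex.exp (-(μ * z)) = Complex.exp (μ * -Complex.exp z) := by
      rw [modelFactor, ← Complex.exp_add]; ring_nf
    rw [e, Complex.norm_exp, Real.exp_le_exp, Complex.re_ofReal_mul, Complex.neg_re]
    nlinarith

/-- The vertical part of the conjugacy, as a function of `x`: both the model and the given vector
field have the same monodromy, so comparing their first integrals gives a single-valued function. -/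
theorem exists_conjugacy_exponent {μ ε r s : ℝ} (hμ : 0 < μ) (hε : 0 < ε) {h : ℂ × ℂ → ℂ}
    (hl : ∀ x ∈ ball (0 : ℂ) 3, ∀ y ∈ ball (0 : ℂ) 1, ∀ y' ∈ ball (0 : ℂ) 1,
        ‖h (x, y) - h (x, y')‖ ≤ ε * ‖y - y'‖) {D : ℂ × ℂ → ℂ}
    (hDd : DifferentiableOn ℂ D (flowBox μ (1 / 3)))
    (hDb : ∀ p ∈ flowBox μ (1 / 3), ‖D p‖ ≤ 1) (hD0 : ∀ c, D (twoPiI, c) = 0)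
    (hD : ∀ z c, (z, c) ∈ flowBox μ (1 / 3) → HasDerivAt (fun z => D (z, c))
        (-(μ * h (-Complex.exp z, c * Complex.exp (-(μ * z)) * Complex.exp (D (z, c))))) z)
    {v : ℂ × ℂ → ℂ} (hv : DifferentiableOn ℂ v (wideStrip r)) (hvb : ∀ p ∈ wideStrip r, ‖v p‖ ≤ 1)
    (hvp : ∀ z y : ℂ, |z.im| < 1 → ‖y‖ < r →
        v (z + twoPiI, y) = v (z, y) + D (0, y * Complex.exp (v (z, y)) * modelFactor μ z))
    {f : ℂ → ℂ}
    (hf : ∀ z y : ℂ, -1 < z.im → z.im < 2 * Real.pi + 1 → ‖y‖ < s →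
          fderiv ℂ v (z, y) (1, 0) + μ * (1 - Complex.exp z) =
          μ * (f y - Complex.exp z) * (1 + y * fderiv ℂ v (z, y) (0, 1)))
    (hsr : s ≤ r) (hs : s * Real.exp (1 + μ) < 1 / 9) :
    ∃ Q : ℂ × ℂ → ℂ, DifferentiableOn ℂ Q (ball 0 1 ×ˢ ball 0 s) ∧
      ∀ x y : ℂ, x ≠ 0 → ‖x‖ < 1 → ‖y‖ < s →
        -x * fderiv ℂ Q (x, y) (1, 0) + μ * (f y + x) * (1 + y * fderiv ℂ Q (x, y) (0, 1)) =
          μ * (1 + h (x, y * Complex.exp (Q (x, y)))) := by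
  have hpi := Real.pi_gt_three
  set W : ℂ × ℂ → ℂ := fun p => p.2 * Complex.exp (v p) * modelFactor μ p.1 with hW
  set T : Set (ℂ × ℂ) := {p | -1 < p.1.im ∧ p.1.im < 2 * Real.pi + 1 ∧
      -Complex.exp p.1 ∈ ball (0 : ℂ) 1 ∧ p.2 ∈ ball (0 : ℂ) s} with hT
  have hre : ∀ z : ℂ, -Complex.exp z ∈ ball (0 : ℂ) 1 → z.re < 0 := fun z hz => by
    rwa [mem_ball_zero_iff, norm_neg, Complex.norm_exp, Real.exp_lt_one_iff] at hz
  have hTW : T ⊆ wideStrip r := fun p hp =>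
    ⟨hp.1, hp.2.1, (mem_ball_zero_iff.1 hp.2.2.2).trans_le hsr⟩
  have hTo : IsOpen T := by
    have h1 : Continuous fun p : ℂ × ℂ => p.1.im := Complex.continuous_im.comp continuous_fst
    have h2 : Continuous fun p : ℂ × ℂ => -Complex.exp p.1 :=
      (Complex.continuous_exp.comp continuous_fst).neg
    exact (isOpen_lt continuous_const h1).inter ((isOpen_lt h1 continuous_const).inter
      ((isOpen_ball.preimage h2).inter (isOpen_ball.preimage continuous_snd)))
  have hWb : ∀ p ∈ T, ‖W p‖ < 1 / 9 ∧ ‖W p * Complex.exp (-(μ * p.1))‖ < 1 / 9 := by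
    intro p hp
    obtain ⟨m1, m2⟩ := norm_modelFactor_le_of_re_neg hμ (hre _ hp.2.2.1)
    have e1 : ‖Complex.exp (v p)‖ ≤ Real.exp 1 :=
      (Complex.norm_exp_le_exp_norm _).trans (Real.exp_le_exp.2 (hvb p (hTW hp)))
    have e2 := (mem_ball_zero_iff.1 hp.2.2.2).le
    rw [Real.exp_add, ← mul_assoc] at hs
    have hs0 : 0 ≤ s := (norm_nonneg _).trans e2
    constructor
    · refine lt_of_le_of_lt ?_ hs
      simp only [hW]
      rw [norm_mul, norm_mul]
      gcongr
    · refine lt_of_le_of_lt ?_ hs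
      simp only [hW]
      rw [mul_assoc, norm_mul, norm_mul]
      gcongr
  have hWf : ∀ p ∈ T, (p.1, W p) ∈ flowBox μ (1 / 3) := fun p hp =>
    ⟨(hre _ hp.2.2.1).trans one_pos, hp.1, hp.2.1, (hWb p hp).1.trans (by norm_num),
      (hWb p hp).2.trans (by norm_num)⟩
  have hvT := hv.mono hTW
  have hWd : DifferentiableOn ℂ W T :=
    (differentiableOn_snd.fun_mul hvT.cexp).fun_mul
      ((differentiable_modelFactor μ).comp differentiable_fst).differentiableOn
  set q : ℂ × ℂ → ℂ := fun p => v p - μ * Complex.exp p.1 + D (p.1, W p) with hq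
  have hqd : DifferentiableOn ℂ q T := by
    refine (hvT.fun_sub ?_).fun_add ?_
    · exact (differentiable_fst.cexp.const_mul _).differentiableOn
    · exact hDd.comp (f := fun p : ℂ × ℂ => (p.1, W p)) (differentiableOn_fst.prodMk hWd) hWf
  have hqb : ∀ p ∈ T, ‖q p‖ ≤ 2 + μ := by
    intro p hp
    have h1 := hvb p (hTW hp)
    have h2 := hDb _ (hWf p hp)
    have h3 : ‖(μ : ℂ) * Complex.exp p.1‖ ≤ μ := by
      have := mem_ball_zero_iff.1 hp.2.2.1
      rw [norm_neg] at this
      rw [norm_mul, Complex.norm_real, Real.norm_of_nonneg hμ.le]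
      nlinarith
    have h4 := norm_add_le (v p - μ * Complex.exp p.1) (D (p.1, W p))
    have h5 := norm_sub_le (v p) (μ * Complex.exp p.1)
    simp only [hq]
    linarith
  have eT : ∀ z : ℂ, Complex.exp (z + twoPiI) = Complex.exp z := fun z => by
    rw [Complex.exp_add, exp_twoPiI, mul_one]
  have hqp : ∀ z y : ℂ, |z.im| < 1 → -Complex.exp z ∈ ball (0 : ℂ) 1 → y ∈ ball (0 : ℂ) s →
      q (z + twoPiI, y) = q (z, y) := by
    intro z y hz hz' hy
    obtain ⟨hz1, hz2⟩ := abs_lt.1 hz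
    have hp : (z, y) ∈ T := ⟨hz1, by simp only; linarith, hz', hy⟩
    have h1 := hvp z y hz ((mem_ball_zero_iff.1 hy).trans_le hsr)
    have h2 := flowBox_monodromy hμ hε hl hDb hD0 hD ((hre z hz').trans one_pos) hz1 hz2
      (hWb _ hp).1 (hWb _ hp).2
    change v (z + twoPiI, y) = v (z, y) + D (0, W (z, y)) at h1
    have h3 : W (z + twoPiI, y) = W (z, y) * Complex.exp (μ * twoPiI + D (0, W (z, y))) := by
      have e : modelFactor μ (z + twoPiI) = modelFactor μ z * Complex.exp (μ * twoPiI) := by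
        rw [modelFactor, eT, modelFactor, ← Complex.exp_add]
        ring_nf
      simp only [hW] at h1 ⊢
      rw [e, h1, Complex.exp_add, Complex.exp_add]
      ring
    simp only [hq, eT, h1, h3]
    linear_combination -h2
  obtain ⟨G, hGd, hGe⟩ := exists_descent isOpen_ball isOpen_ball hqd hqp
  have hlog : ∀ x : ℂ, x ≠ 0 → -Complex.exp (Complex.log x + Real.pi * Complex.I) = x :=
    fun x hx => by
      rw [Complex.exp_add, Complex.exp_log hx, Complex.exp_pi_mul_I, mul_neg_one, neg_neg]
  have hlogT : ∀ x y : ℂ, x ≠ 0 → ‖x‖ < 1 → ‖y‖ < s →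
      (Complex.log x + Real.pi * Complex.I, y) ∈ T := by
    intro x y hx hx1 hy
    have h1 := Complex.neg_pi_lt_log_im x
    have h2 := Complex.log_im_le_pi x
    refine ⟨by simp; linarith, by simp; linarith, ?_, mem_ball_zero_iff.2 hy⟩
    simp only
    rw [hlog x hx]
    exact mem_ball_zero_iff.2 hx1
  obtain ⟨Q, hQd, hQe⟩ := exists_extension_of_bounded one_pos isOpen_ball hGd
    (C := fun _ => 2 + μ) (by
      intro x hx y hy
      have hx0 : x ≠ 0 := hx.2
      have hm := hlogT x y hx0 (mem_ball_zero_iff.1 hx.1) (mem_ball_zero_iff.1 hy)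
      have := hGe _ y hm.1 hm.2.1 hm.2.2.1 hm.2.2.2
      rw [hlog x hx0] at this
      rw [this]
      exact hqb _ hm)
  refine ⟨Q, hQd, fun x y hx hx1 hy => ?_⟩
  have hQq : ∀ p ∈ T, Q (-Complex.exp p.1, p.2) = q p := fun p hp => by
    rw [hQe _ _ (neg_ne_zero.2 (Complex.exp_ne_zero _)), hGe _ _ hp.1 hp.2.1 hp.2.2.1 hp.2.2.2]
  have hzT := hlogT x y hx hx1 hy
  have hxz := hlog x hx
  generalize Complex.log x + Real.pi * Complex.I = z at hzT hxz
  have hvD := hvT.differentiableAt (hTo.mem_nhds hzT)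
  have hDD := hDd.differentiableAt ((isOpen_flowBox _ _).mem_nhds (hWf _ hzT))
  have hQD := hQd.differentiableAt ((isOpen_ball.prod isOpen_ball).mem_nhds
    (⟨mem_ball_zero_iff.2 hx1, mem_ball_zero_iff.2 hy⟩ : (x, y) ∈ ball (0 : ℂ) 1 ×ˢ ball (0 : ℂ) s))
  set Dc := fderiv ℂ D (z, W (z, y)) (0, 1) with hDc
  have hDz : fderiv ℂ D (z, W (z, y)) (1, 0) = -(μ * h (x, y * Complex.exp (Q (x, y)))) := by
    rw [hDD.hasDerivAt_fst.unique (hD z _ (hWf _ hzT)), hxz]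
    have e1 : Q (x, y) = q (z, y) := by
      rw [← hxz]
      exact hQq _ hzT
    have e2 : W (z, y) * Complex.exp (-(μ * z)) * Complex.exp (D (z, W (z, y))) =
        y * Complex.exp (Q (x, y)) := by
      have e3 : Complex.exp (q (z, y)) = Complex.exp (v (z, y)) *
          (modelFactor μ z * Complex.exp (-(μ * z))) * Complex.exp (D (z, W (z, y))) := by
        rw [modelFactor, ← Complex.exp_add, ← Complex.exp_add, ← Complex.exp_add]
        simp only [hq]
        ring_nf
      rw [e1, e3]
      simp only [hW]
      ring
    rw [e2]
  have hsplit : ∀ a b : ℂ, fderiv ℂ D (z, W (z, y)) (a, b) =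
      a * fderiv ℂ D (z, W (z, y)) (1, 0) + b * Dc := fun a b => by
    have : (a, b) = a • ((1, 0) : ℂ × ℂ) + b • ((0, 1) : ℂ × ℂ) := by simp
    rw [this, map_add, map_smul, map_smul, smul_eq_mul, smul_eq_mul]
  have hf' := hf z y hzT.1 hzT.2.1 hy
  have hqz : fderiv ℂ Q (x, y) (1, 0) * x = fderiv ℂ v (z, y) (1, 0) - μ * Complex.exp z +
      (-(μ * h (x, y * Complex.exp (Q (x, y)))) +
        W (z, y) * (fderiv ℂ v (z, y) (1, 0) + μ * (1 - Complex.exp z)) * Dc) := by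
    have hWz : HasDerivAt (fun z => W (z, y))
        (W (z, y) * (fderiv ℂ v (z, y) (1, 0) + μ * (1 - Complex.exp z))) z :=
      ((hvD.hasDerivAt_fst.cexp.const_mul y).fun_mul (hasDerivAt_modelFactor μ z)).congr_deriv (by
        simp only [hW]; ring)
    have h1 : HasDerivAt (fun z => D (z, W (z, y))) _ z :=
      HasFDerivAt.comp_hasDerivAt (f := fun z : ℂ => (z, W (z, y))) z hDD.hasFDerivAt
        ((hasDerivAt_id z).prodMk hWz)
    have h2 := (hvD.hasDerivAt_fst.fun_sub ((Complex.hasDerivAt_exp z).const_mul (μ : ℂ))).fun_add h1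
    have h3 : HasDerivAt (fun z => Q (-Complex.exp z, y)) (fderiv ℂ Q (x, y) (1, 0) * x) z := by
      have h4 := hQD.hasDerivAt_fst
      rw [← hxz] at h4
      refine (HasDerivAt.comp (h₂ := fun x => Q (x, y)) (h := fun z => -Complex.exp z) z h4
        (Complex.hasDerivAt_exp z).fun_neg).congr_deriv ?_
      rw [hxz]
    have hev : (fun z => Q (-Complex.exp z, y)) =ᶠ[𝓝 z]
        fun z => v (z, y) - μ * Complex.exp z + D (z, W (z, y)) := by
      filter_upwards [(hTo.slice_fst y).mem_nhds hzT] with w hw using hQq _ hw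
    rw [h3.unique (h2.congr_of_eventuallyEq hev), hsplit, hDz, one_mul]
  have hqy : fderiv ℂ Q (x, y) (0, 1) = fderiv ℂ v (z, y) (0, 1) +
      Complex.exp (v (z, y)) * modelFactor μ z * (1 + y * fderiv ℂ v (z, y) (0, 1)) * Dc := by
    have hWy : HasDerivAt (fun y => W (z, y))
        (Complex.exp (v (z, y)) * modelFactor μ z * (1 + y * fderiv ℂ v (z, y) (0, 1))) y :=
      (((hasDerivAt_id y).fun_mul hvD.hasDerivAt_snd.cexp).mul_const (modelFactor μ z)).congr_deriv
        (by simp only [id]; ring)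
    have h1 : HasDerivAt (fun y => D (z, W (z, y))) _ y :=
      HasFDerivAt.comp_hasDerivAt (f := fun y : ℂ => (z, W (z, y))) y hDD.hasFDerivAt
        ((hasDerivAt_const y z).prodMk hWy)
    have h2 := (hvD.hasDerivAt_snd.sub_const (μ * Complex.exp z)).fun_add h1
    have hev : (fun y => Q (x, y)) =ᶠ[𝓝 y]
        fun y => v (z, y) - μ * Complex.exp z + D (z, W (z, y)) := by
      filter_upwards [(hTo.slice_snd z).mem_nhds hzT] with w hw
      rw [← hxz]
      exact hQq _ hw
    rw [hQD.hasDerivAt_snd.unique (h2.congr_of_eventuallyEq hev), hsplit, zero_mul, zero_add]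
  have hWe : W (z, y) = y * Complex.exp (v (z, y)) * modelFactor μ z := rfl
  have hez : Complex.exp z = -x := by rw [← hxz, neg_neg]
  rw [hez, hWe] at hqz
  rw [hez] at hf'
  rw [hqy]
  linear_combination -hqz - hf' * (1 + y * Complex.exp (v (z, y)) * modelFactor μ z * Dc)

theorem AnalyticAt.exists_lipschitz_ball {a : ℂ → ℂ} (ha : AnalyticAt ℂ a 0) {ρ₀ : ℝ}
    (hρ₀ : 0 < ρ₀) : ∃ ρ > 0, ρ ≤ ρ₀ ∧ ∃ A ≥ 0,
      ∀ c ∈ ball (0 : ℂ) ρ, ∀ c' ∈ ball (0 : ℂ) ρ, ‖a c - a c'‖ ≤ A * ‖c - c'‖ := by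
  obtain ⟨K, t, ht, hK⟩ := (ha.contDiffAt (n := 1)).exists_lipschitzOnWith
  obtain ⟨R, hR, h⟩ := Metric.nhds_basis_ball.mem_iff.1 ht
  refine ⟨min R ρ₀, lt_min hR hρ₀, min_le_right _ _, K, K.2, fun c hc c' hc' => ?_⟩
  have hsub := ball_subset_ball (x := (0 : ℂ)) (min_le_left R ρ₀)
  simpa [dist_eq_norm] using hK.dist_le_mul c (h (hsub hc)) c' (h (hsub hc'))

theorem FoliationEquiv.of_conjugacy_exponent {μ s : ℝ} (hs : 0 < s) {h Q : ℂ × ℂ → ℂ} {f : ℂ → ℂ}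
    (hd : DifferentiableOn ℂ h (ball 0 3 ×ˢ ball 0 1)) (hf : DifferentiableOn ℂ f (ball 0 s))
    (hQ : DifferentiableOn ℂ Q (ball 0 1 ×ˢ ball 0 s))
    (hQe : ∀ x y : ℂ, x ≠ 0 → ‖x‖ < 1 → ‖y‖ < s →
        -x * fderiv ℂ Q (x, y) (1, 0) + μ * (f y + x) * (1 + y * fderiv ℂ Q (x, y) (0, 1)) =
          μ * (1 + h (x, y * Complex.exp (Q (x, y))))) :
    FoliationEquiv (fun p => (-p.1, μ * (f p.2 + p.1) * p.2))
      (fun p => (-p.1, μ * (1 + h p) * p.2)) := by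
  have hBo : IsOpen (ball (0 : ℂ) 1 ×ˢ ball (0 : ℂ) s) := isOpen_ball.prod isOpen_ball
  have h0 : (0 : ℂ × ℂ) ∈ ball (0 : ℂ) 1 ×ˢ ball (0 : ℂ) s :=
    ⟨mem_ball_self one_pos, mem_ball_self hs⟩
  have hQ0 : AnalyticAt ℂ Q 0 := hQ.analyticOnNhd_prod hBo 0 h0
  have hyc : ContinuousOn (fun p : ℂ × ℂ => p.2 * Complex.exp (Q p))
      (ball (0 : ℂ) 1 ×ˢ ball (0 : ℂ) s) := continuousOn_snd.mul hQ.continuousOn.cexp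
  set V : Set (ℂ × ℂ) := (ball (0 : ℂ) 1 ×ˢ ball (0 : ℂ) s) ∩
    (fun p : ℂ × ℂ => p.2 * Complex.exp (Q p)) ⁻¹' ball 0 1 with hV
  have hVo : IsOpen V := hyc.isOpen_inter_preimage hBo isOpen_ball
  have hV0 : (0 : ℂ × ℂ) ∈ V := ⟨h0, by simp⟩
  have hE : ∀ p ∈ V, -p.1 * fderiv ℂ Q p (1, 0) +
      μ * (f p.2 + p.1) * (1 + p.2 * fderiv ℂ Q p (0, 1)) -
        μ * (1 + h (p.1, p.2 * Complex.exp (Q p))) = 0 := by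
    set E : ℂ × ℂ → ℂ := fun p => -p.1 * fderiv ℂ Q p (1, 0) +
      μ * (f p.2 + p.1) * (1 + p.2 * fderiv ℂ Q p (0, 1)) -
        μ * (1 + h (p.1, p.2 * Complex.exp (Q p))) with hEdef
    have hEc : ContinuousOn E V := by
      have c1 := ((hQ.fderiv_prod_apply hBo (1, 0)).mono inter_subset_left).continuousOn (s := V)
      have c2 := ((hQ.fderiv_prod_apply hBo (0, 1)).mono inter_subset_left).continuousOn (s := V)
      have c3 : ContinuousOn (fun p : ℂ × ℂ => f p.2) V :=
        hf.continuousOn.comp continuousOn_snd fun p hp => hp.1.2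
      have c4 : ContinuousOn (fun p : ℂ × ℂ => h (p.1, p.2 * Complex.exp (Q p))) V :=
        hd.continuousOn.comp (continuousOn_fst.prodMk (hyc.mono inter_subset_left))
          fun p hp => ⟨ball_subset_ball (by norm_num) hp.1.1, hp.2⟩
      exact ((continuousOn_fst.neg.mul c1).add ((continuousOn_const.mul
        (c3.add continuousOn_fst)).mul (continuousOn_const.add (continuousOn_snd.mul c2)))).sub
          (continuousOn_const.mul (continuousOn_const.add c4))
    rintro ⟨x, y⟩ hp
    have hslice : Tendsto (fun x => E (x, y)) (𝓝[≠] x) (𝓝 (E (x, y))) :=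
      (ContinuousAt.comp (f := fun x : ℂ => (x, y)) (hEc.continuousAt (hVo.mem_nhds hp))
        (by fun_prop)).tendsto.mono_left nhdsWithin_le_nhds
    have hzero : ∀ᶠ w in 𝓝[≠] x, E (w, y) = 0 := by
      have h1 : ∀ᶠ w in 𝓝[≠] x, (w, y) ∈ V :=
        nhdsWithin_le_nhds ((hVo.slice_fst y).mem_nhds hp)
      have h2 : ∀ᶠ w in 𝓝[≠] x, w ≠ 0 := by
        by_cases hx : x = 0
        · rw [hx]; exact self_mem_nhdsWithin
        · exact nhdsWithin_le_nhds (isOpen_ne.mem_nhds hx)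
      filter_upwards [h1, h2] with w hw1 hw2
      exact sub_eq_zero.2 (hQe w y hw2 (mem_ball_zero_iff.1 hw1.1.1) (mem_ball_zero_iff.1 hw1.1.2))
    exact tendsto_nhds_unique hslice
      ((tendsto_congr' hzero).2 tendsto_const_nhds)
  refine FoliationEquiv.of_fibred (U := fun p => Complex.exp (Q p)) one_ne_zero hQ0.cexp
    (Complex.exp_ne_zero _) ?_
  filter_upwards [hVo.mem_nhds hV0] with p hp
  refine ⟨by simp, ?_⟩
  obtain ⟨x, y⟩ := p
  have hQD := hQ.differentiableAt (hBo.mem_nhds hp.1)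
  have d1 : HasDerivAt (fun x => y * Complex.exp (Q (x, y))) _ x :=
    hQD.hasDerivAt_fst.cexp.const_mul y
  have d2 : HasDerivAt (fun y => y * Complex.exp (Q (x, y))) _ y :=
    (hasDerivAt_id y).fun_mul hQD.hasDerivAt_snd.cexp
  simp only [d1.deriv, d2.deriv, one_mul, id]
  linear_combination (y * Complex.exp (Q (x, y))) * hE _ hp

/-- Normalization of a vector field already linear in the first coordinate. -/
theorem exists_normal_form {μ ε : ℝ} (hμ : 0 < μ) (hε : 0 < ε) (hεμ : ε * (1 + 9 * μ) ≤ 1 / 2)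
    {h : ℂ × ℂ → ℂ} (hd : DifferentiableOn ℂ h (ball 0 3 ×ˢ ball 0 1))
    (h0 : ∀ x ∈ ball (0 : ℂ) 3, h (x, 0) = 0)
    (hl : ∀ x ∈ ball (0 : ℂ) 3, ∀ y ∈ ball (0 : ℂ) 1, ∀ y' ∈ ball (0 : ℂ) 1,
        ‖h (x, y) - h (x, y')‖ ≤ ε * ‖y - y'‖) :
    ∃ f : ℂ → ℂ, AnalyticAt ℂ f 0 ∧ f 0 = 1 ∧
      FoliationEquiv (fun p => (-p.1, μ * (f p.2 + p.1) * p.2))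
        (fun p => (-p.1, μ * (1 + h p) * p.2)) := by
  have hpi := Real.pi_gt_three
  obtain ⟨D, hDd, hDb, hDz, hD0, hD⟩ := exists_flowBox_solution hμ hε hεμ hd h0 hl
  have hmem : ∀ c ∈ ball (0 : ℂ) (1 / 3), ((0 : ℂ), c) ∈ flowBox μ (1 / 3) := fun c hc =>
    ⟨by simp, by simp, by simp; linarith, mem_ball_zero_iff.1 hc,
      by simpa using mem_ball_zero_iff.1 hc⟩
  have had : DifferentiableOn ℂ (fun c => D (0, c)) (ball 0 (1 / 3)) :=
    hDd.comp (f := fun c : ℂ => ((0 : ℂ), c)) (by fun_prop) hmem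
  obtain ⟨ρ, hρ, hρ9, A, hA, hal⟩ := AnalyticAt.exists_lipschitz_ball
    (had.analyticAt (ball_mem_nhds _ (by norm_num))) (ρ₀ := 1 / 9) (by norm_num)
  replace had := had.mono (ball_subset_ball (hρ9.trans (by norm_num)))
  have hJ := jumpBound_pos μ
  set J := jumpBound μ
  set B := Real.exp (1 + 2 * μ) with hB
  have hBpos : 0 < B := Real.exp_pos _
  set τ := min ρ (1 / (2 * (J * A + 1))) with hτ
  have hJA : 0 ≤ J * A := by positivity
  have hτ0 : 0 < τ := lt_min hρ (by positivity)
  set r := τ / B with hr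
  have hr0 : 0 < r := by positivity
  have hrB : r * B = τ := div_mul_cancel₀ _ hBpos.ne'
  obtain ⟨v, ψ, hv, hvb, hv0, hvp, hψ, hvψ⟩ := exists_jump_fixedPoint hμ hA hr0 had
    (hDz 0 (hmem 0 (mem_ball_self (by norm_num)))) hal (by rw [hrB]; exact min_le_left _ _) (by
      rw [hrB]
      calc J * (A * τ) = J * A * τ := by ring
        _ ≤ J * A * (1 / (2 * (J * A + 1))) := by gcongr; exact min_le_right _ _
        _ ≤ 1 / 2 := by
          rw [mul_one_div, div_le_div_iff₀ (by positivity) two_pos]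
          linarith)
  obtain ⟨f, hfd, hf1, hf⟩ := exists_normal_form_function hμ hr0 had hv hvb hv0 hvp hψ hvψ
  obtain ⟨Q, hQ, hQe⟩ := exists_conjugacy_exponent hμ hε hl hDd hDb hD0 hD hv hvb
    (fun z y hz hy => (hvp z y hz hy).2) hf (by linarith) (by
      have h1 : Real.exp (1 + μ) ≤ B := Real.exp_le_exp.2 (by linarith)
      have h2 : τ ≤ ρ := min_le_left _ _
      nlinarith)
  exact ⟨f, hfd.analyticAt (ball_mem_nhds _ (by positivity)), hf1,
    FoliationEquiv.of_conjugacy_exponent (by positivity) hd hfd hQ hQe⟩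

end

/-- **Corollary (normal form for saddles with negative eigenratio `−μ`).**
If `X` is a holomorphic germ vanishing at `0` whose linear part `DX(0)` has
eigenvalues `lam₁ ≠ 0` and `lam₂ = −μ·lam₁` with `μ > 0` real (the eigenvalue pair
being encoded by the determinant `lam₁·lam₂` and trace `lam₁ + lam₂` of the linear
part, which characterizes it in dimension `2`), then `X` is analytically
equivalent, as a singular foliation, to `X_f = −x∂x + μ·(f(y) + x)·y∂y`
for some holomorphic `f` with `f 0 = 1`. -/
theorem saddle_normal_form (X : ℂ × ℂ → ℂ × ℂ) (hX : AnalyticAt ℂ X 0) (hX0 : X 0 = 0)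
    (μ : ℝ) (hμ : 0 < μ) (lam₁ lam₂ : ℂ) (hlam₁ : lam₁ ≠ 0)
    (hlam₂ : lam₂ = -(μ : ℂ) * lam₁)
    (hdet : LinearMap.det ((fderiv ℂ X 0).toLinearMap) = lam₁ * lam₂)
    (htr : LinearMap.trace ℂ (ℂ × ℂ) ((fderiv ℂ X 0).toLinearMap) = lam₁ + lam₂) :
    ∃ f : ℂ → ℂ, AnalyticAt ℂ f 0 ∧ f 0 = 1 ∧
      FoliationEquiv X (fun p => (-p.1, (μ : ℂ) * (f p.2 + p.1) * p.2)) := by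
  have hε : 0 < 1 / (2 * (1 + 9 * μ)) := by positivity
  obtain ⟨h, hd, h0, hl, he⟩ := exists_preliminary_form hX hX0 hμ hlam₁ hlam₂ hdet htr hε
  obtain ⟨f, hf, hf1, hfe⟩ := exists_normal_form hμ hε (by field_simp; norm_num) hd h0 hl
  exact ⟨f, hf, hf1, he.trans hfe.symm⟩
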